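/- Let d ≥ 1 and let w be a doubling weight on the closed unit ball B^d (with respect to the metric ρ), normalized by w(B^d) = 1. For each positive integer n let N_n denote the minimal integer N for which there exist N distinct points z_1, …, z_N ∈ B^d with ∫_{B^d} P(x) w(x) dx = (1/N) · Σ_{j=1}^N P(z_j) for every polynomial P in d variables of total degree at most n, and let M_n = max_{x ∈ B^d} 1/w(B_ρ(x, 1/n)). Then there exist constants 0 < c ≤ C, depending only on d and the doubling constant of w, such that c · M_n ≤ N_n ≤ C · M_n for every positive integer n. -/

import Mathlib

open MeasureTheory Real Set

noncomputable section

variable {d : ℕ}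

/-- The metric `ρ(x,y) = ‖x−y‖ + |√(1−‖x‖²) − √(1−‖y‖²)|` on the unit ball. -/
def rhoB (x y : EuclideanSpace ℝ (Fin d)) : ℝ :=
  ‖x - y‖ + |Real.sqrt (1 - ‖x‖ ^ 2) - Real.sqrt (1 - ‖y‖ ^ 2)|

/-- The ball `B_ρ(x,r) = {y ∈ B^d : ρ(x,y) ≤ r}`. -/
def ballRho (x : EuclideanSpace ℝ (Fin d)) (r : ℝ) : Set (EuclideanSpace ℝ (Fin d)) :=
  {y | ‖y‖ ≤ 1 ∧ rhoB x y ≤ r}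

/-- Lebesgue measure restricted to the closed unit ball `B^d`. -/
def ballVol (d : ℕ) : Measure (EuclideanSpace ℝ (Fin d)) :=
  volume.restrict (Metric.closedBall (0 : EuclideanSpace ℝ (Fin d)) 1)

/-- `w(A) = ∫_A w(x) dx`. -/
def wMassB (w : EuclideanSpace ℝ (Fin d) → ℝ) (A : Set (EuclideanSpace ℝ (Fin d))) : ℝ :=
  ∫ x in A, w x ∂(ballVol d)

/-- Evaluation of a `d`-variate real polynomial at a point of `ℝ^d`. -/
def pEval (P : MvPolynomial (Fin d) ℝ) (x : EuclideanSpace ℝ (Fin d)) : ℝ :=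
  MvPolynomial.eval (fun i => x i) P
/-- The minimal number of nodes of a strict Chebyshev-type cubature formula of
degree `n` for the measure `w(x) dx` on the unit ball. -/
def minCubNodesB (d : ℕ) (w : EuclideanSpace ℝ (Fin d) → ℝ) (n : ℕ) : ℕ :=
  sInf {N : ℕ | 0 < N ∧ ∃ Z : Finset (EuclideanSpace ℝ (Fin d)), Z.card = N ∧
    (∀ z ∈ Z, ‖z‖ ≤ 1) ∧
    ∀ P : MvPolynomial (Fin d) ℝ, P.totalDegree ≤ n →
      (∫ x, pEval P x * w x ∂(ballVol d)) = (1 / (N : ℝ)) * ∑ z ∈ Z, pEval P z}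

namespace CubBall

section

open Polynomial in
/-- A polynomial bounded by `M` on the unit circle is bounded by `M * R ^ N` on the disc of
radius `R ≥ 1`. -/
lemma norm_eval_le_of_circle {p : ℂ[X]} {N : ℕ} (hp : p.natDegree ≤ N) {M : ℝ}
    (hM : ∀ w : ℂ, ‖w‖ = 1 → ‖p.eval w‖ ≤ M) {R : ℝ} (hR : 1 ≤ R) {w : ℂ} (hw : ‖w‖ ≤ R) :
    ‖p.eval w‖ ≤ M * R ^ N := by
  have key : ∀ q : ℂ[X], (∀ w : ℂ, ‖w‖ = 1 → ‖q.eval w‖ ≤ M) → ∀ w : ℂ, ‖w‖ ≤ 1 →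
      ‖q.eval w‖ ≤ M := by
    intro q hq w hw
    refine Complex.norm_le_of_forall_mem_frontier_norm_le (U := Metric.ball 0 1)
      Metric.isBounded_ball (f := fun w => q.eval w) ?_ ?_ ?_
    · exact (Polynomial.differentiable q).diffContOnCl
    · intro z hz
      rw [frontier_ball (0 : ℂ) one_ne_zero] at hz
      exact hq z (by simpa using hz)
    · rw [closure_ball (0 : ℂ) one_ne_zero]; simpa using hw
  have hM0 : 0 ≤ M := (norm_nonneg _).trans (hM 1 (by simp))
  rcases le_total ‖w‖ 1 with h1 | h1
  · calc ‖p.eval w‖ ≤ M := key p hM w h1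
      _ ≤ M * R ^ N := le_mul_of_one_le_right hM0 (one_le_pow₀ hR)
  · have hw0 : w ≠ 0 := by rintro rfl; norm_num at h1
    have hrefl : ∀ z : ℂ, z ≠ 0 → (p.reflect N).eval z⁻¹ * z ^ N = p.eval z := by
      intro z hz
      have := invertibleOfNonzero hz
      have := eval₂_reflect_mul_pow (RingHom.id ℂ) z N p hp
      simpa [eval₂_id] using this
    have hq : ∀ z : ℂ, ‖z‖ = 1 → ‖(p.reflect N).eval z‖ ≤ M := by
      intro z hz
      have hz0 : z ≠ 0 := by rintro rfl; norm_num at hz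
      have h2 := hrefl z⁻¹ (inv_ne_zero hz0)
      have h3 := congrArg norm h2
      rw [inv_inv, norm_mul, norm_pow, norm_inv, hz, inv_one, one_pow, mul_one] at h3
      rw [h3]
      exact hM _ (by rw [norm_inv, hz, inv_one])
    rw [← hrefl w hw0, norm_mul, norm_pow]
    have h4 := key _ hq w⁻¹ (by rw [norm_inv]; exact inv_le_one_of_one_le₀ h1)
    gcongr

open Polynomial in
lemma norm_derivative_eval_le_of_circle {p : ℂ[X]} {N : ℕ} (hN : 0 < N) (hp : p.natDegree ≤ N)
    {M : ℝ} (hM : ∀ w : ℂ, ‖w‖ = 1 → ‖p.eval w‖ ≤ M) {w : ℂ} (hw : ‖w‖ = 1) :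
    ‖p.derivative.eval w‖ ≤ 3 * N * M := by
  have hN' : (0 : ℝ) < N := by exact_mod_cast hN
  have hM0 : 0 ≤ M := (norm_nonneg _).trans (hM 1 (by simp))
  have hR : (1 : ℝ) ≤ 1 + 1 / N := by have : 0 < 1 / (N : ℝ) := by positivity
                                      linarith
  have h := Complex.norm_deriv_le_of_forall_mem_sphere_norm_le (c := w) (R := 1 / N)
    (C := M * (1 + 1 / N) ^ N) (f := fun z => p.eval z) (by positivity)
    (Polynomial.differentiable p).diffContOnCl (by
      intro z hz
      refine norm_eval_le_of_circle hp hM hR ?_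
      have : ‖z - w‖ = 1 / N := by simpa [dist_eq_norm] using hz
      calc ‖z‖ = ‖w + (z - w)‖ := by congr 1; ring
        _ ≤ ‖w‖ + ‖z - w‖ := norm_add_le _ _
        _ = _ := by rw [hw, this])
  rw [Polynomial.deriv] at h
  have hexp : (1 + 1 / (N : ℝ)) ^ N ≤ 3 := by
    calc (1 + 1 / (N : ℝ)) ^ N ≤ (Real.exp (1 / N)) ^ N := by
          gcongr; rw [add_comm]; exact Real.add_one_le_exp _
      _ = Real.exp 1 := by rw [← Real.exp_nat_mul]; congr 1; field_simp
      _ ≤ 3 := by have := Real.exp_one_lt_d9; linarith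
  calc _ ≤ _ := h
    _ = (M * N) * (1 + 1 / (N : ℝ)) ^ N := by field_simp
    _ ≤ (M * N) * 3 := by gcongr
    _ = _ := by ring

open Polynomial in
/-- Real trigonometric polynomials of degree at most `n`. -/
def IsTrig (n : ℕ) (g : ℝ → ℝ) : Prop :=
  ∃ p : ℂ[X], p.natDegree ≤ 2 * n ∧
    ∀ t : ℝ, (g t : ℂ) * Complex.exp (t * Complex.I) ^ n = p.eval (Complex.exp (t * Complex.I))

open Polynomial in
lemma IsTrig.add {n : ℕ} {g h : ℝ → ℝ} (hg : IsTrig n g) (hh : IsTrig n h) :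
    IsTrig n (fun t => g t + h t) := by
  obtain ⟨p, hp, hp'⟩ := hg
  obtain ⟨q, hq, hq'⟩ := hh
  refine ⟨p + q, (natDegree_add_le _ _).trans (max_le hp hq), fun t => ?_⟩
  rw [eval_add, ← hp', ← hq']; push_cast; ring

open Polynomial in
lemma IsTrig.mul {n m : ℕ} {g h : ℝ → ℝ} (hg : IsTrig n g) (hh : IsTrig m h) :
    IsTrig (n + m) (fun t => g t * h t) := by
  obtain ⟨p, hp, hp'⟩ := hg
  obtain ⟨q, hq, hq'⟩ := hh
  refine ⟨p * q, (natDegree_mul_le).trans (by omega), fun t => ?_⟩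
  rw [eval_mul, ← hp', ← hq']; push_cast; ring

open Polynomial in
lemma isTrig_const (n : ℕ) (c : ℝ) : IsTrig n (fun _ => c) := by
  refine ⟨C (c : ℂ) * X ^ n, (natDegree_C_mul_X_pow_le _ _).trans (by omega), fun t => ?_⟩
  simp

lemma IsTrig.mono {n m : ℕ} {g : ℝ → ℝ} (hg : IsTrig n g) (h : n ≤ m) : IsTrig m g := by
  obtain ⟨k, rfl⟩ := Nat.exists_eq_add_of_le h
  simpa using hg.mul (isTrig_const k 1)

open Polynomial in
lemma isTrig_cos_sin (a b : ℝ) : IsTrig 1 (fun t => cos t * a + sin t * b) := by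
  refine ⟨C ((a - Complex.I * b) / 2) * X ^ 2 + C ((a + Complex.I * b) / 2), ?_, fun t => ?_⟩
  · refine (natDegree_add_le _ _).trans (max_le ?_ (by simp))
    exact natDegree_C_mul_X_pow_le _ _
  · have h : Complex.exp (t * Complex.I) = Complex.cos t + Complex.sin t * Complex.I :=
      Complex.exp_mul_I _
    have hI := Complex.I_sq
    have hcs := Complex.sin_sq_add_cos_sq t
    simp only [eval_add, eval_mul, eval_C, eval_pow, eval_X, h]
    push_cast
    have hs : Complex.sin (t : ℂ) ^ 2 = 1 - Complex.cos t ^ 2 := by linear_combination hcs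
    linear_combination (exp := 1) ((a:ℂ) / 2 + Complex.I * b / 2) * hcs
      + (- (a:ℂ)/2 * Complex.sin t ^2 + Complex.I * b / 2 * Complex.sin t ^2
          + b * Complex.sin t * Complex.cos t) * hI

lemma isTrig_pEval {D n : ℕ} (p : MvPolynomial (Fin D) ℝ) (hp : p.totalDegree ≤ n)
    (x u : EuclideanSpace ℝ (Fin D)) :
    IsTrig n (fun t => pEval p (cos t • x + sin t • u)) := by
  have hprod : ∀ (s : Finset (Fin D)) (e : Fin D → ℕ),
      IsTrig (∑ i ∈ s, e i) (fun t => ∏ i ∈ s, (cos t * x i + sin t * u i) ^ e i) := by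
    intro s e
    induction s using Finset.induction_on with
    | empty => simpa using isTrig_const 0 1
    | insert a s ha ih =>
      have hpow : ∀ k : ℕ, IsTrig k (fun t => (cos t * x a + sin t * u a) ^ k) := by
        intro k
        induction k with
        | zero => simpa using isTrig_const 0 1
        | succ k ihk => simpa [pow_succ] using ihk.mul (isTrig_cos_sin (x a) (u a))
      simpa [Finset.sum_insert ha, Finset.prod_insert ha] using (hpow (e a)).mul ih
  have hsum : ∀ s : Finset (Fin D →₀ ℕ), (∀ m ∈ s, ∑ i, m i ≤ n) →
      IsTrig n (fun t => ∑ m ∈ s, p.coeff m * ∏ i, (cos t * x i + sin t * u i) ^ m i) := by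
    intro s
    induction s using Finset.induction_on with
    | empty => intro _; simpa using isTrig_const n 0
    | insert a s ha ih =>
      intro h
      have h1 := (isTrig_const 0 (p.coeff a)).mul (hprod Finset.univ a)
      rw [zero_add] at h1
      have h2 := (h1.mono (h a (by simp))).add (ih fun m hm => h m (by simp [hm]))
      simpa [Finset.sum_insert ha] using h2
  have h := hsum p.support (fun m hm => by
    have := MvPolynomial.le_totalDegree hm
    rw [Finsupp.sum_fintype _ _ (by simp)] at this
    exact this.trans hp)
  convert h using 2 with t
  rw [pEval, MvPolynomial.eval_eq']
  simp

/-- Bernstein's inequality at the origin, with a non-sharp constant. -/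
lemma IsTrig.abs_deriv_le {n : ℕ} (hn : 0 < n) {g : ℝ → ℝ} (hg : IsTrig n g) {M g' : ℝ}
    (hM : ∀ t, |g t| ≤ M) (hd : HasDerivAt g g' 0) : |g'| ≤ 7 * n * M := by
  obtain ⟨p, hp, hp'⟩ := hg
  have hcirc : ∀ w : ℂ, ‖w‖ = 1 → ‖p.eval w‖ ≤ M := by
    intro w hw
    have hw' : w = Complex.exp (w.arg * Complex.I) := by
      have := Complex.norm_mul_exp_arg_mul_I w
      rw [hw] at this; simpa using this.symm
    rw [hw', ← hp', norm_mul, norm_pow, Complex.norm_exp_ofReal_mul_I, one_pow, mul_one,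
      Complex.norm_real]
    exact hM _
  have h1 : HasDerivAt (fun t : ℝ => Complex.exp (t * Complex.I)) Complex.I 0 := by
    have h := ((hasDerivAt_id (0 : ℂ)).mul_const Complex.I).cexp
    have h' := h.comp_ofReal (z := 0)
    simpa using h'
  have h2 : HasDerivAt (fun t : ℝ => (g t : ℂ) * Complex.exp (t * Complex.I) ^ n)
      (g' + g 0 * (n * Complex.I)) 0 := by
    refine (hd.ofReal_comp.mul (h1.pow n)).congr_deriv ?_
    simp
  have h3 : HasDerivAt (fun t : ℝ => p.eval (Complex.exp (t * Complex.I)))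
      (p.derivative.eval 1 * Complex.I) 0 := by
    have hp1 := p.hasDerivAt (Complex.exp (((0 : ℝ) : ℂ) * Complex.I))
    refine (hp1.comp (0 : ℝ) h1).congr_deriv ?_
    simp
  have h4 : (g' : ℂ) + g 0 * (n * Complex.I) = p.derivative.eval 1 * Complex.I := by
    refine h2.unique ?_
    have : (fun t : ℝ => (g t : ℂ) * Complex.exp (t * Complex.I) ^ n)
      = fun t : ℝ => p.eval (Complex.exp (t * Complex.I)) := funext hp'
    rw [this]; exact h3
  have h5 : (g' : ℂ) = p.derivative.eval 1 * Complex.I - g 0 * (n * Complex.I) := by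
    rw [← h4]; ring
  have h6 := norm_derivative_eval_le_of_circle (by omega : 0 < 2 * n) hp hcirc
    (w := 1) (by simp)
  have h7 : |g'| = ‖(g' : ℂ)‖ := by simp
  rw [h7, h5]
  calc _ ≤ ‖p.derivative.eval 1 * Complex.I‖ + ‖(g 0 : ℂ) * (n * Complex.I)‖ := norm_sub_le _ _
    _ = ‖p.derivative.eval 1‖ + |g 0| * n := by simp
    _ ≤ 3 * (2 * n : ℕ) * M + M * n := by gcongr; exact hM 0
    _ = _ := by push_cast; ring

end

section

variable {D : ℕ}

lemma pEval_add (p q : MvPolynomial (Fin D) ℝ) (x : EuclideanSpace ℝ (Fin D)) :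
    pEval (p + q) x = pEval p x + pEval q x := by simp [pEval]

lemma pEval_sub (p q : MvPolynomial (Fin D) ℝ) (x : EuclideanSpace ℝ (Fin D)) :
    pEval (p - q) x = pEval p x - pEval q x := by simp [pEval]

lemma pEval_mul (p q : MvPolynomial (Fin D) ℝ) (x : EuclideanSpace ℝ (Fin D)) :
    pEval (p * q) x = pEval p x * pEval q x := by simp [pEval]

lemma pEval_C (c : ℝ) (x : EuclideanSpace ℝ (Fin D)) :
    pEval (MvPolynomial.C c : MvPolynomial (Fin D) ℝ) x = c := by simp [pEval]

lemma pEval_X (i : Fin D) (x : EuclideanSpace ℝ (Fin D)) :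
    pEval (MvPolynomial.X i : MvPolynomial (Fin D) ℝ) x = x i := by simp [pEval]

lemma pEval_sum {ι : Type*} (s : Finset ι) (p : ι → MvPolynomial (Fin D) ℝ)
    (x : EuclideanSpace ℝ (Fin D)) : pEval (∑ i ∈ s, p i) x = ∑ i ∈ s, pEval (p i) x := by
  simp [pEval]

lemma pEval_pow (p : MvPolynomial (Fin D) ℝ) (k : ℕ) (x : EuclideanSpace ℝ (Fin D)) :
    pEval (p ^ k) x = pEval p x ^ k := by simp [pEval]

@[fun_prop]
lemma continuous_pEval (p : MvPolynomial (Fin D) ℝ) : Continuous (pEval p) := by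
  have h : pEval p = fun x : EuclideanSpace ℝ (Fin D) =>
    MvPolynomial.eval (fun i => x i) p := rfl
  rw [h]
  exact (MvPolynomial.continuous_eval p).comp (by fun_prop)

lemma hasDerivAt_pEval_comp (p : MvPolynomial (Fin D) ℝ) {γ : ℝ → EuclideanSpace ℝ (Fin D)}
    {v : EuclideanSpace ℝ (Fin D)} {s : ℝ} (hγ : HasDerivAt γ v s) :
    HasDerivAt (fun t => pEval p (γ t))
      (∑ k, v k * pEval (MvPolynomial.pderiv k p) (γ s)) s := by
  induction p using MvPolynomial.induction_on with
  | C a => simpa [pEval] using hasDerivAt_const s a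
  | add p q hp hq =>
    simp only [pEval_add, map_add, mul_add, Finset.sum_add_distrib]
    exact hp.add hq
  | mul_X p i hp =>
    have hi : HasDerivAt (fun t => γ t i) (v i) s :=
      ((EuclideanSpace.proj i : EuclideanSpace ℝ (Fin D) →L[ℝ] ℝ).hasFDerivAt.comp_hasDerivAt s hγ)
    simp only [pEval_mul, pEval_X]
    refine (hp.mul hi).congr_deriv ?_
    simp only [Derivation.leibniz, MvPolynomial.pderiv_X, smul_eq_mul, pEval_add, pEval_mul,
      pEval_X, mul_add, Finset.sum_add_distrib, Finset.sum_mul]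
    rw [add_comm]
    congr 1
    · rw [Finset.sum_eq_single i]
      · simp [pEval]; ring
      · intro b _ hb
        simp [hb.symm, pEval]
      · simp
    · exact Finset.sum_congr rfl fun k _ => by ring

/-- The components of the tangential gradient of a polynomial along the unit sphere. -/
def tangGrad (p : MvPolynomial (Fin D) ℝ) (k : Fin D) : MvPolynomial (Fin D) ℝ :=
  MvPolynomial.pderiv k p
    - MvPolynomial.X k * ∑ l, MvPolynomial.X l * MvPolynomial.pderiv l p

lemma pEval_tangGrad (p : MvPolynomial (Fin D) ℝ) (k : Fin D) (x : EuclideanSpace ℝ (Fin D)) :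
    pEval (tangGrad p k) x = pEval (MvPolynomial.pderiv k p) x
      - x k * ∑ l, x l * pEval (MvPolynomial.pderiv l p) x := by
  simp [tangGrad, pEval_sub, pEval_mul, pEval_X, pEval_sum]

lemma totalDegree_pderiv_le_sub_one (p : MvPolynomial (Fin D) ℝ) (l : Fin D) :
    (MvPolynomial.pderiv l p).totalDegree ≤ p.totalDegree - 1 := by
  conv_lhs => rw [p.as_sum]
  rw [map_sum]
  refine MvPolynomial.totalDegree_finsetSum_le fun m hm => ?_
  rw [MvPolynomial.pderiv_monomial]
  rcases Nat.eq_zero_or_pos (m l) with h0 | h0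
  · simp [h0]
  refine (MvPolynomial.totalDegree_monomial_le _ _).trans ?_
  have h1 := MvPolynomial.le_totalDegree hm
  have h2 : Finsupp.degree (m - Finsupp.single l 1) + 1 = Finsupp.degree m := by
    have h3 : m - Finsupp.single l 1 + Finsupp.single l 1 = m :=
      tsub_add_cancel_of_le (by simpa using Nat.one_le_iff_ne_zero.2 h0.ne')
    conv_rhs => rw [← h3]
    simp
  have h4 : (m.sum fun _ e => e) = Finsupp.degree m := rfl
  have h5 : ((m - Finsupp.single l 1).sum fun _ => id)
    = Finsupp.degree (m - Finsupp.single l 1) := rfl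
  omega

lemma totalDegree_tangGrad_le (p : MvPolynomial (Fin D) ℝ) (k : Fin D) :
    (tangGrad p k).totalDegree ≤ p.totalDegree + 1 := by
  have hpd : ∀ l, (MvPolynomial.pderiv l p).totalDegree ≤ p.totalDegree - 1 := fun l =>
    totalDegree_pderiv_le_sub_one p l
  rcases Nat.eq_zero_or_pos p.totalDegree with h0 | h0
  · rw [MvPolynomial.totalDegree_eq_zero_iff_eq_C] at h0
    rw [h0]
    simp [tangGrad]
  refine (MvPolynomial.totalDegree_sub _ _).trans (max_le ((hpd k).trans (by omega)) ?_)
  refine (MvPolynomial.totalDegree_mul _ _).trans ?_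
  have : (∑ l, MvPolynomial.X l * MvPolynomial.pderiv l p).totalDegree ≤ p.totalDegree := by
    refine MvPolynomial.totalDegree_finsetSum_le fun l _ => ?_
    refine (MvPolynomial.totalDegree_mul _ _).trans ?_
    have := hpd l
    rw [MvPolynomial.totalDegree_X]; omega
  rw [MvPolynomial.totalDegree_X]; omega

/-- The radial projection of `x + v` to the unit sphere. -/
def sph (x v : EuclideanSpace ℝ (Fin D)) : EuclideanSpace ℝ (Fin D) := ‖x + v‖⁻¹ • (x + v)

lemma abs_norm_add_sub_one_le {x v : EuclideanSpace ℝ (Fin D)} (hx : ‖x‖ = 1) :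
    |‖x + v‖ - 1| ≤ ‖v‖ := by
  have := abs_norm_sub_norm_le (x + v) x
  simpa [hx] using this

lemma norm_sph {x v : EuclideanSpace ℝ (Fin D)} (hx : ‖x‖ = 1) (hv : ‖v‖ ≤ 1 / 2) :
    ‖sph x v‖ = 1 := by
  have h := abs_le.1 (abs_norm_add_sub_one_le (v := v) hx)
  have : 0 < ‖x + v‖ := by linarith
  rw [sph, norm_smul, norm_inv, norm_norm, inv_mul_cancel₀ this.ne']

lemma norm_sph_sub_le {x v : EuclideanSpace ℝ (Fin D)} (hx : ‖x‖ = 1) (hv : ‖v‖ ≤ 1 / 2) :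
    ‖sph x v - x‖ ≤ 2 * ‖v‖ := by
  have h := abs_norm_add_sub_one_le (v := v) hx
  have h' := abs_le.1 h
  have hpos : 0 < ‖x + v‖ := by linarith
  have e : sph x v - x = (1 - ‖x + v‖) • sph x v + v := by
    rw [sub_smul, one_smul, sph, smul_smul, mul_inv_cancel₀ hpos.ne', one_smul]; abel
  calc ‖sph x v - x‖ ≤ ‖(1 - ‖x + v‖) • sph x v‖ + ‖v‖ := by rw [e]; exact norm_add_le _ _
    _ = |‖x + v‖ - 1| + ‖v‖ := by
      rw [norm_smul, norm_sph hx hv, mul_one, Real.norm_eq_abs, abs_sub_comm]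
    _ ≤ _ := by linarith

lemma hasDerivAt_pEval_sph (p : MvPolynomial (Fin D) ℝ) {x v : EuclideanSpace ℝ (Fin D)} {s : ℝ}
    (h0 : x + s • v ≠ 0) :
    HasDerivAt (fun t : ℝ => pEval p (sph x (t • v)))
      (‖x + s • v‖⁻¹ * ∑ k, v k * pEval (tangGrad p k) (sph x (s • v))) s := by
  have hpos : 0 < ‖x + s • v‖ := norm_pos_iff.2 h0
  have hlin : HasDerivAt (fun t : ℝ => x + t • v) v s := by
    simpa using ((hasDerivAt_id s).smul_const v).const_add x
  have hnorm : HasDerivAt (fun t : ℝ => ‖x + t • v‖)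
      (inner ℝ (x + s • v) v / ‖x + s • v‖) s := by
    have h1 := hlin.norm_sq
    have h2 := h1.sqrt (by positivity)
    simp only [Real.sqrt_sq (norm_nonneg _)] at h2
    refine h2.congr_deriv ?_
    field_simp
  have hγ : HasDerivAt (fun t : ℝ => sph x (t • v))
      (‖x + s • v‖⁻¹ • (v - inner ℝ (sph x (s • v)) v • sph x (s • v))) s := by
    refine ((hnorm.inv hpos.ne').smul hlin).congr_deriv ?_
    rw [sph, inner_smul_left, smul_sub, smul_smul, smul_smul, sub_eq_add_neg, ← neg_smul]
    congr 2
    simp only [conj_trivial]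
    field_simp
  refine (hasDerivAt_pEval_comp p hγ).congr_deriv ?_
  have hin : inner ℝ (sph x (s • v)) v = ∑ k, v k * sph x (s • v) k := by
    simp [PiLp.inner_apply]
  generalize sph x (s • v) = z at hin ⊢
  simp only [pEval_tangGrad, PiLp.smul_apply, PiLp.sub_apply, smul_eq_mul, mul_assoc,
    ← Finset.mul_sum, sub_mul, mul_sub, Finset.sum_sub_distrib, hin]
  congr 2
  rw [Finset.sum_mul]
  exact Finset.sum_congr rfl fun k _ => by ring

lemma exists_pEval_sph_sub_eq (p : MvPolynomial (Fin D) ℝ) {x v : EuclideanSpace ℝ (Fin D)}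
    (hx : ‖x‖ = 1) (hv : ‖v‖ ≤ 1 / 2) :
    ∃ z : EuclideanSpace ℝ (Fin D), ∃ r : ℝ, ‖z‖ = 1 ∧ ‖z - x‖ ≤ 2 * ‖v‖ ∧ |r - 1| ≤ 2 * ‖v‖ ∧
      pEval p (sph x v) - pEval p x = r * ∑ k, v k * pEval (tangGrad p k) z := by
  have hle : ∀ s ∈ Icc (0 : ℝ) 1, ‖s • v‖ ≤ ‖v‖ := by
    intro s hs
    rw [norm_smul, Real.norm_eq_abs, abs_of_nonneg hs.1]
    exact mul_le_of_le_one_left (norm_nonneg _) hs.2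
  have hne : ∀ s ∈ Icc (0 : ℝ) 1, 1 / 2 ≤ ‖x + s • v‖ := by
    intro s hs
    have h := abs_le.1 (abs_norm_add_sub_one_le (v := s • v) hx)
    have := hle s hs
    linarith
  have hd : ∀ s ∈ Icc (0 : ℝ) 1, HasDerivAt (fun t : ℝ => pEval p (sph x (t • v)))
      (‖x + s • v‖⁻¹ * ∑ k, v k * pEval (tangGrad p k) (sph x (s • v))) s := by
    intro s hs
    refine hasDerivAt_pEval_sph p ?_
    intro h; have := hne s hs; rw [h, norm_zero] at this; linarith
  obtain ⟨s, hs, h⟩ := exists_hasDerivAt_eq_slope (fun t : ℝ => pEval p (sph x (t • v)))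
    (fun s => ‖x + s • v‖⁻¹ * ∑ k, v k * pEval (tangGrad p k) (sph x (s • v))) zero_lt_one
    (fun s hs => (hd s hs).continuousAt.continuousWithinAt)
    (fun s hs => hd s (Ioo_subset_Icc_self hs))
  have hs' := Ioo_subset_Icc_self hs
  have hv' := hle s hs'
  refine ⟨sph x (s • v), ‖x + s • v‖⁻¹, norm_sph hx (hv'.trans hv),
    (norm_sph_sub_le hx (hv'.trans hv)).trans (by linarith), ?_, ?_⟩
  · have h1 := abs_norm_add_sub_one_le (v := s • v) hx
    have h2 := hne s hs'
    have h3 : ‖x + s • v‖⁻¹ - 1 = (1 - ‖x + s • v‖) * ‖x + s • v‖⁻¹ := by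
      field_simp
    have h4 : ‖x + s • v‖⁻¹ ≤ 2 := by
      rw [inv_le_comm₀ (by linarith) (by norm_num)]; linarith
    rw [h3, abs_mul, abs_sub_comm, abs_of_nonneg (inv_nonneg.2 (norm_nonneg (x + s • v)))]
    calc _ ≤ ‖v‖ * 2 := by gcongr; exact h1.trans hv'
      _ = _ := by ring
  · rw [h]; simp [sph, hx]

/-- Bernstein's inequality for the tangential gradient on the sphere. -/
lemma abs_sum_tangGrad_le {n : ℕ} (hn : 0 < n) {p : MvPolynomial (Fin D) ℝ}
    (hp : p.totalDegree ≤ n) {M : ℝ}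
    (hM : ∀ z : EuclideanSpace ℝ (Fin D), ‖z‖ = 1 → |pEval p z| ≤ M)
    {x : EuclideanSpace ℝ (Fin D)} (hx : ‖x‖ = 1) (v : EuclideanSpace ℝ (Fin D)) :
    |∑ k, v k * pEval (tangGrad p k) x| ≤ 7 * n * M * ‖v‖ := by
  have hM0 : 0 ≤ M := (abs_nonneg _).trans (hM x hx)
  set u := v - inner ℝ x v • x with hu
  have hxx : inner ℝ x x = (1 : ℝ) := by rw [real_inner_self_eq_norm_sq, hx]; norm_num
  have hxu : inner ℝ x u = (0 : ℝ) := by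
    rw [hu, inner_sub_right, inner_smul_right, hxx]; ring
  have hsum : ∑ k, v k * pEval (tangGrad p k) x
      = ∑ k, u k * pEval (MvPolynomial.pderiv k p) x := by
    have hin : inner ℝ x v = ∑ k, v k * x k := by simp [PiLp.inner_apply]
    simp only [pEval_tangGrad, hu, PiLp.smul_apply, PiLp.sub_apply, smul_eq_mul, mul_assoc,
      ← Finset.mul_sum, sub_mul, mul_sub, Finset.sum_sub_distrib, hin]
    congr 1
    rw [Finset.sum_mul]
    exact Finset.sum_congr rfl fun k _ => by ring
  have huv : ‖u‖ ≤ ‖v‖ := by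
    have h1 : ‖u‖ ^ 2 = ‖v‖ ^ 2 - (inner ℝ x v) ^ 2 := by
      rw [hu, norm_sub_sq_real, norm_smul, inner_smul_right, real_inner_comm x v, hx,
        Real.norm_eq_abs, mul_one, sq_abs]; ring
    exact (sq_le_sq₀ (norm_nonneg _) (norm_nonneg _)).1 (by rw [h1]; nlinarith [sq_nonneg (inner ℝ x v : ℝ)])
  rw [hsum]
  rcases eq_or_ne u 0 with h0 | h0
  · rw [h0]; simp; positivity
  have hupos : 0 < ‖u‖ := norm_pos_iff.2 h0
  set e := ‖u‖⁻¹ • u with he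
  have hen : ‖e‖ = 1 := by
    rw [he, norm_smul, norm_inv, norm_norm, inv_mul_cancel₀ hupos.ne']
  have hxe : inner ℝ x e = (0 : ℝ) := by rw [he, inner_smul_right, hxu, mul_zero]
  have hue : u = ‖u‖ • e := by rw [he, smul_smul, mul_inv_cancel₀ hupos.ne', one_smul]
  have hcirc : ∀ t : ℝ, ‖cos t • x + sin t • e‖ = 1 := by
    intro t
    have : ‖cos t • x + sin t • e‖ ^ 2 = 1 := by
      rw [norm_add_sq_real, norm_smul, norm_smul, inner_smul_left, inner_smul_right, hxe, hx, hen,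
        Real.norm_eq_abs, Real.norm_eq_abs, mul_one, mul_one, sq_abs, sq_abs]
      have := Real.sin_sq_add_cos_sq t
      linarith
    nlinarith [norm_nonneg (cos t • x + sin t • e)]
  have hγ : HasDerivAt (fun t : ℝ => cos t • x + sin t • e) e 0 := by
    have := ((Real.hasDerivAt_cos 0).smul_const x).add ((Real.hasDerivAt_sin 0).smul_const e)
    refine this.congr_deriv ?_
    simp
  have hd := hasDerivAt_pEval_comp p hγ
  have hx0 : cos (0 : ℝ) • x + sin (0 : ℝ) • e = x := by simp
  rw [hx0] at hd
  have h := (isTrig_pEval p hp x e).abs_deriv_le hn (fun t => hM _ (hcirc t)) hd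
  have hfac : ∑ k, u k * pEval (MvPolynomial.pderiv k p) x
      = ‖u‖ * ∑ k, e k * pEval (MvPolynomial.pderiv k p) x := by
    rw [Finset.mul_sum]
    refine Finset.sum_congr rfl fun k _ => ?_
    have : u k = ‖u‖ * e k := by
      conv_lhs => rw [hue]
      simp
    rw [this, mul_assoc]
  rw [hfac, abs_mul, abs_norm, mul_comm]
  gcongr

lemma abs_pEval_sub_le {n : ℕ} (hn : 0 < n) {p : MvPolynomial (Fin D) ℝ}
    (hp : p.totalDegree ≤ n) {M : ℝ}
    (hM : ∀ z : EuclideanSpace ℝ (Fin D), ‖z‖ = 1 → |pEval p z| ≤ M)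
    {x y : EuclideanSpace ℝ (Fin D)} (hx : ‖x‖ = 1) (hy : ‖y‖ = 1) :
    |pEval p y - pEval p x| ≤ 14 * n * ‖y - x‖ * M := by
  have hM0 : 0 ≤ M := (abs_nonneg _).trans (hM x hx)
  have hn1 : (1 : ℝ) ≤ n := by exact_mod_cast hn
  rcases le_total ‖y - x‖ (1 / 2) with h | h
  · obtain ⟨z, r, hz, -, hr, he⟩ := exists_pEval_sph_sub_eq p hx h
    have hy' : sph x (y - x) = y := by simp [sph, hy]
    rw [hy'] at he
    have h1 := abs_sum_tangGrad_le hn hp hM hz (y - x)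
    have hr2 : |r| ≤ 2 := by
      have := abs_le.1 hr
      rw [abs_le]; constructor <;> linarith
    rw [he, abs_mul]
    calc _ ≤ 2 * (7 * n * M * ‖y - x‖) := by gcongr
      _ = _ := by ring
  · have h1 := hM x hx
    have h2 := hM y hy
    calc |pEval p y - pEval p x| ≤ |pEval p y| + |pEval p x| := abs_sub _ _
      _ ≤ 2 * M := by linarith
      _ ≤ 14 * 1 * (1 / 2) * M := by linarith
      _ ≤ _ := by gcongr

end

section

open Polynomial in
lemma exists_fejer (m : ℕ) (hm : 0 < m) : ∃ q : ℝ[X], q.natDegree ≤ m - 1 ∧ q.eval 1 = 1 ∧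
    ∀ u ∈ Icc (-1 : ℝ) 1, 0 ≤ q.eval u ∧ q.eval u ≤ 1 ∧ (1 - u) * (m ^ 2 * q.eval u) ≤ 2 := by
  have hm0 : (m : ℝ) ≠ 0 := by positivity
  set F : ℝ[X] := Chebyshev.T ℝ m - 1 with hF
  have hroot : F.IsRoot 1 := by simp [hF]
  have hdiv : (X - C 1) * (F /ₘ (X - C 1)) = F := mul_divByMonic_eq_iff_isRoot.2 hroot
  set G := F /ₘ (X - C 1) with hG
  have hev : ∀ u, (u - 1) * G.eval u = (Chebyshev.T ℝ m).eval u - 1 := by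
    intro u
    have := congrArg (Polynomial.eval u) hdiv
    simpa [hF] using this
  have hG1 : G.eval 1 = m ^ 2 := by
    have := congrArg (fun p => (derivative p).eval 1) hdiv
    simp only [derivative_mul, hF] at this
    have h2 := Chebyshev.derivative_T_eval_one (R := ℝ) m
    simp at this h2
    rw [this, h2]
  have hsin : ∀ (j : ℕ) (t : ℝ), |sin (j * t)| ≤ j * |sin t| := by
    intro j t
    induction j with
    | zero => simp
    | succ j ih =>
      push_cast
      rw [add_mul, one_mul, sin_add]
      calc _ ≤ |sin (j * t) * cos t| + |cos (j * t) * sin t| := abs_add_le _ _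
        _ = |sin (j * t)| * |cos t| + |cos (j * t)| * |sin t| := by rw [abs_mul, abs_mul]
        _ ≤ (j * |sin t|) * 1 + 1 * |sin t| := by
          gcongr
          · exact abs_cos_le_one _
          · exact abs_cos_le_one _
        _ = _ := by ring
  refine ⟨C ((m : ℝ) ^ 2)⁻¹ * G, ?_, ?_, ?_⟩
  · refine (natDegree_C_mul_le _ _).trans ?_
    rw [hG, natDegree_divByMonic _ (monic_X_sub_C 1), natDegree_X_sub_C]
    refine Nat.sub_le_sub_right ((natDegree_sub_le _ _).trans ?_) 1
    simp
  · rw [eval_mul, eval_C, hG1, inv_mul_cancel₀ (by positivity)]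
  · intro u hu
    rw [eval_mul, eval_C, mul_inv_cancel_left₀ (by positivity)]
    have hT : (1 - u) * G.eval u = 1 - (Chebyshev.T ℝ m).eval u := by linarith [hev u]
    have habs := abs_le.1 (Chebyshev.abs_eval_T_real_le_one m
      (abs_le.2 hu))
    have hT2 : 1 - (Chebyshev.T ℝ m).eval u ≤ m ^ 2 * (1 - u) := by
      obtain ⟨θ, rfl⟩ : ∃ θ, cos θ = u := ⟨arccos u, cos_arccos hu.1 hu.2⟩
      rw [Chebyshev.T_real_cos]
      have h1 := hsin m (θ / 2)
      have h2 : 1 - cos θ = 2 * sin (θ / 2) ^ 2 := by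
        have := cos_two_mul (θ / 2); have h3 := sin_sq_add_cos_sq (θ / 2)
        rw [mul_div_cancel₀ _ (two_ne_zero)] at this; linarith
      have h4 : 1 - cos (m * θ) = 2 * sin (m * (θ / 2)) ^ 2 := by
        have := cos_two_mul (m * (θ / 2)); have h3 := sin_sq_add_cos_sq (m * (θ / 2))
        rw [show 2 * (m * (θ / 2)) = m * θ by ring] at this; linarith
      have h5 : sin (m * (θ / 2)) ^ 2 ≤ (m * |sin (θ / 2)|) ^ 2 := by
        rw [← sq_abs]; gcongr
      rw [mul_pow, sq_abs] at h5
      push_cast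
      rw [h2, h4]; linarith
    rcases eq_or_lt_of_le hu.2 with h1 | h1
    · subst h1
      rw [hG1, inv_mul_cancel₀ (by positivity)]
      norm_num
    · have h0 : 0 < 1 - u := by linarith
      refine ⟨?_, ?_, by rw [hT]; linarith⟩
      · have : 0 ≤ G.eval u := by
          by_contra hneg
          push Not at hneg
          nlinarith
        positivity
      · rw [inv_mul_le_iff₀ (by positivity), mul_one]
        have : (1 - u) * G.eval u ≤ (1 - u) * m ^ 2 := by rw [hT]; linarith
        exact le_of_mul_le_mul_left this h0

variable {D : ℕ}

lemma totalDegree_aeval_le (q : Polynomial ℝ) (p : MvPolynomial (Fin D) ℝ)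
    (hp : p.totalDegree ≤ 1) : (Polynomial.aeval p q).totalDegree ≤ q.natDegree := by
  rw [Polynomial.aeval_eq_sum_range]
  refine MvPolynomial.totalDegree_finsetSum_le fun i hi => ?_
  refine (MvPolynomial.totalDegree_smul_le _ _).trans ((MvPolynomial.totalDegree_pow _ _).trans ?_)
  have := Finset.mem_range.1 hi
  nlinarith

lemma pEval_aeval (q : Polynomial ℝ) (p : MvPolynomial (Fin D) ℝ)
    (x : EuclideanSpace ℝ (Fin D)) : pEval (Polynomial.aeval p q) x = q.eval (pEval p x) := by
  rw [Polynomial.aeval_eq_sum_range, pEval_sum, Polynomial.eval_eq_sum_range]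
  refine Finset.sum_congr rfl fun i _ => ?_
  rw [MvPolynomial.smul_eq_C_mul, pEval_mul, pEval_C, pEval_pow]

/-- The linear polynomial `z ↦ ⟪x, z⟫`. -/
def innerPoly (x : EuclideanSpace ℝ (Fin D)) : MvPolynomial (Fin D) ℝ :=
  ∑ l, MvPolynomial.C (x l) * MvPolynomial.X l

lemma totalDegree_innerPoly_le (x : EuclideanSpace ℝ (Fin D)) :
    (innerPoly x).totalDegree ≤ 1 := by
  refine MvPolynomial.totalDegree_finsetSum_le fun l _ => ?_
  refine (MvPolynomial.totalDegree_mul _ _).trans ?_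
  simp

lemma pEval_innerPoly (x z : EuclideanSpace ℝ (Fin D)) : pEval (innerPoly x) z = inner ℝ x z := by
  simp [innerPoly, pEval_sum, pEval_mul, pEval_C, pEval_X, PiLp.inner_apply, mul_comm]

lemma norm_sub_sq_of_norm_one {x z : EuclideanSpace ℝ (Fin D)} (hx : ‖x‖ = 1) (hz : ‖z‖ = 1) :
    ‖x - z‖ ^ 2 = 2 * (1 - inner ℝ x z) := by
  rw [norm_sub_sq_real, hx, hz]; ring

/-- A nonnegative polynomial of degree `n` peaking at `x`, decaying at scale `1 / (n + 1)`. -/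
lemma exists_peak {k : ℕ} (hk : 0 < k) (n : ℕ) {x : EuclideanSpace ℝ (Fin D)} (hx : ‖x‖ = 1) :
    ∃ Q : MvPolynomial (Fin D) ℝ, Q.totalDegree ≤ n ∧ pEval Q x = 1 ∧
      ∀ z : EuclideanSpace ℝ (Fin D), ‖z‖ = 1 → 0 ≤ pEval Q z ∧ pEval Q z ≤ 1 ∧
        pEval Q z * (1 + (n + 1) * ‖x - z‖) ^ (2 * k) ≤ (2 + 8 * (k : ℝ) ^ 2) ^ k := by
  obtain ⟨q, hq1, hq2, hq3⟩ := exists_fejer (n / k + 1) (Nat.succ_pos _)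
  have hxx : inner ℝ x x = (1 : ℝ) := by rw [real_inner_self_eq_norm_sq, hx]; norm_num
  have hev : ∀ z, pEval ((Polynomial.aeval (innerPoly x) q) ^ k) z = q.eval (inner ℝ x z) ^ k := by
    intro z; rw [pEval_pow, pEval_aeval, pEval_innerPoly]
  refine ⟨(Polynomial.aeval (innerPoly x) q) ^ k, ?_, ?_, ?_⟩
  · refine (MvPolynomial.totalDegree_pow _ _).trans ?_
    have := (totalDegree_aeval_le q _ (totalDegree_innerPoly_le x)).trans hq1
    exact (Nat.mul_le_mul_left k this).trans (Nat.mul_div_le n k)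
  · rw [hev, hxx, hq2, one_pow]
  · intro z hz
    have hu : inner ℝ x z ∈ Icc (-1 : ℝ) 1 := by
      have := abs_real_inner_le_norm x z
      rw [hx, hz, one_mul] at this
      exact abs_le.1 this
    obtain ⟨h0, h1, h2⟩ := hq3 _ hu
    rw [hev]
    refine ⟨by positivity, pow_le_one₀ h0 h1, ?_⟩
    rw [pow_mul, ← mul_pow]
    refine pow_le_pow_left₀ (by positivity) ?_ k
    have hsq := norm_sub_sq_of_norm_one hx hz
    set m : ℕ := n / k + 1 with hm
    have hmn : (n : ℝ) + 1 ≤ m * k := by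
      have : n + 1 ≤ m * k := by
        have := Nat.lt_div_mul_add (a := n) hk
        rw [hm]; nlinarith
      exact_mod_cast this
    have hr := norm_nonneg (x - z)
    set r := ‖x - z‖
    set c := Polynomial.eval (inner ℝ x z) q
    have h3 : (1 + (n + 1) * r) ^ 2 ≤ 2 + 2 * (m ^ 2 * k ^ 2 * r ^ 2) := by
      have : (1 + (n + 1) * r) ^ 2 ≤ (1 + (m * k) * r) ^ 2 := by gcongr
      nlinarith [sq_nonneg (1 - (m * k) * r)]
    have h4 : c * (m ^ 2 * r ^ 2) ≤ 4 := by
      rw [hsq]; linarith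
    calc c * (1 + (n + 1) * r) ^ 2 ≤ c * (2 + 2 * (m ^ 2 * k ^ 2 * r ^ 2)) := by gcongr
      _ = 2 * c + 2 * k ^ 2 * (c * (m ^ 2 * r ^ 2)) := by ring
      _ ≤ 2 * 1 + 2 * k ^ 2 * 4 := by gcongr
      _ = _ := by ring

end

section

variable {D : ℕ}

/-- The scaled distance `1 + n ‖x - z‖`. -/
def sdist (n : ℕ) (x z : EuclideanSpace ℝ (Fin D)) : ℝ := 1 + n * ‖x - z‖

lemma one_le_sdist (n : ℕ) (x z : EuclideanSpace ℝ (Fin D)) : 1 ≤ sdist n x z := by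
  have := norm_nonneg (x - z)
  simp only [sdist, le_add_iff_nonneg_right]; positivity

lemma sdist_pos (n : ℕ) (x z : EuclideanSpace ℝ (Fin D)) : 0 < sdist n x z :=
  zero_lt_one.trans_le (one_le_sdist n x z)

lemma sdist_le_mul (n : ℕ) (x y z : EuclideanSpace ℝ (Fin D)) :
    sdist n x z ≤ sdist n x y * sdist n y z := by
  have h := norm_sub_le_norm_sub_add_norm_sub x y z
  have h1 : (n : ℝ) * ‖x - z‖ ≤ n * (‖x - y‖ + ‖y - z‖) := by gcongr
  have h2 : 0 ≤ ((n : ℝ) * ‖x - y‖) * (n * ‖y - z‖) := by positivity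
  simp only [sdist]
  nlinarith

/-- The constant in the weighted Bernstein inequality. -/
def bernC (k : ℕ) : ℝ := 28 * (2 + 8 * (k : ℝ) ^ 2) ^ k + 14 * 4 ^ k

lemma one_le_bernC (k : ℕ) : 1 ≤ bernC k := by
  have h1 : (1 : ℝ) ≤ (2 + 8 * (k : ℝ) ^ 2) ^ k := by
    apply one_le_pow₀
    have : (0 : ℝ) ≤ (k : ℝ) ^ 2 := by positivity
    linarith
  have h2 : (0 : ℝ) ≤ 4 ^ k := by positivity
  simp only [bernC]; linarith

/-- A Bernstein inequality with polynomially growing bounds. -/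
lemma abs_pEval_sub_le_of_growth {k : ℕ} (hk : 0 < k) {n : ℕ} (hn : 0 < n)
    {p : MvPolynomial (Fin D) ℝ} (hp : p.totalDegree ≤ n) {x y : EuclideanSpace ℝ (Fin D)}
    {S : ℝ} (hx : ‖x‖ = 1) (hy : ‖y‖ = 1)
    (hS : ∀ z : EuclideanSpace ℝ (Fin D), ‖z‖ = 1 → |pEval p z| ≤ S * sdist n x z ^ (2 * k))
    (hxy : n * ‖y - x‖ ≤ 1) : |pEval p y - pEval p x| ≤ bernC k * (n * ‖y - x‖) * S := by
  obtain ⟨Q, hQ1, hQ2, hQ3⟩ := exists_peak hk n hx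
  have hS0 : 0 ≤ S := by
    have := (abs_nonneg _).trans (hS x hx)
    simpa [sdist] using this
  set A : ℝ := (2 + 8 * (k : ℝ) ^ 2) ^ k with hA
  have hprod : ∀ z : EuclideanSpace ℝ (Fin D), ‖z‖ = 1 → |pEval (Q * p) z| ≤ A * S := by
    intro z hz
    obtain ⟨h0, -, h2⟩ := hQ3 z hz
    have hb : sdist n x z ≤ 1 + (n + 1) * ‖x - z‖ := by
      have := norm_nonneg (x - z)
      simp only [sdist]; nlinarith
    rw [pEval_mul, abs_mul, abs_of_nonneg h0]
    calc _ ≤ pEval Q z * (S * sdist n x z ^ (2 * k)) := by gcongr; exact hS z hz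
      _ = pEval Q z * sdist n x z ^ (2 * k) * S := by ring
      _ ≤ pEval Q z * (1 + (n + 1) * ‖x - z‖) ^ (2 * k) * S := by
        gcongr; exact (sdist_pos _ _ _).le
      _ ≤ _ := by gcongr
  have hdeg : (Q * p).totalDegree ≤ 2 * n :=
    (MvPolynomial.totalDegree_mul _ _).trans (by omega)
  have h1 := abs_pEval_sub_le (by omega) hdeg hprod hx hy
  have h2 := abs_pEval_sub_le hn hQ1 (M := 1)
    (fun z hz => by rw [abs_of_nonneg (hQ3 z hz).1]; exact (hQ3 z hz).2.1) hx hy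
  rw [hQ2, mul_one] at h2
  rw [pEval_mul, pEval_mul, hQ2, one_mul] at h1
  have h3 : |pEval p y| ≤ S * 4 ^ k := by
    refine (hS y hy).trans ?_
    rw [show (4 : ℝ) ^ k = 2 ^ (2 * k) by rw [pow_mul]; norm_num]
    gcongr
    · exact (sdist_pos _ _ _).le
    · rw [sdist, norm_sub_rev]; linarith
  have e : pEval p y - pEval p x
      = (pEval Q y * pEval p y - pEval p x) - (pEval Q y - 1) * pEval p y := by ring
  rw [e]
  refine (abs_sub _ _).trans ?_
  rw [abs_mul]
  have h4 : |pEval Q y - 1| * |pEval p y| ≤ (14 * n * ‖y - x‖) * (S * 4 ^ k) := by gcongr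
  push_cast at h1
  simp only [bernC]
  rw [← hA]
  linarith

lemma inv_pow_le_dyadic {t : ℝ} (ht : 0 ≤ t) {m : ℕ} (htm : t ≤ 2 ^ m) (p : ℕ) :
    ((1 + t) ^ p)⁻¹ ≤ ∑ l ∈ Finset.range (m + 1),
      2 ^ p * ((2 : ℝ) ^ (l * p))⁻¹ * (if t ≤ 2 ^ l then 1 else 0) := by
  have hex : ∃ l, t ≤ 2 ^ l := ⟨m, htm⟩
  classical
  set l := Nat.find hex with hl
  have hlt : t ≤ 2 ^ l := Nat.find_spec hex
  have hlm : l ≤ m := Nat.find_min' hex htm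
  refine le_trans ?_ (Finset.single_le_sum (f := fun l =>
    2 ^ p * ((2 : ℝ) ^ (l * p))⁻¹ * (if t ≤ 2 ^ l then 1 else 0)) (fun i _ => ?_)
    (Finset.mem_range.2 (Nat.lt_succ_of_le hlm)))
  · simp only [if_pos hlt, mul_one]
    rw [pow_mul, ← div_eq_mul_inv, ← div_pow, ← inv_pow]
    refine pow_le_pow_left₀ (by positivity) ?_ p
    rcases Nat.eq_zero_or_pos l with h0 | h0
    · rw [h0, pow_zero, div_one]
      exact (inv_le_one_of_one_le₀ (by linarith)).trans (by norm_num)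
    · have := Nat.find_min hex (m := l - 1) (by omega)
      push Not at this
      rw [inv_le_comm₀ (by positivity) (by positivity), inv_div]
      have h2 : (2 : ℝ) ^ l = 2 * 2 ^ (l - 1) := by
        rw [← pow_succ']; congr 1; omega
      rw [h2]; linarith
  · split_ifs <;> positivity

lemma dyadic_sum_le {G : ℕ → ℝ} {s p : ℕ} (hp : s + 1 ≤ p) (hG0 : 0 ≤ G 0)
    (hG : ∀ l, G (l + 1) ≤ 2 ^ s * G l) (m : ℕ) :
    ∑ l ∈ Finset.range (m + 1), 2 ^ p * ((2 : ℝ) ^ (l * p))⁻¹ * G l ≤ 2 ^ (p + 1) * G 0 := by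
  have hGl : ∀ l, G l ≤ 2 ^ (s * l) * G 0 := by
    intro l
    induction l with
    | zero => simp
    | succ l ih =>
      refine (hG l).trans ?_
      rw [mul_add, mul_one, pow_add]
      calc _ ≤ 2 ^ s * (2 ^ (s * l) * G 0) := by gcongr
        _ = _ := by ring
  have hterm : ∀ l, 2 ^ p * ((2 : ℝ) ^ (l * p))⁻¹ * G l ≤ 2 ^ p * G 0 * (1 / 2) ^ l := by
    intro l
    have h1 : ((2 : ℝ) ^ (l * p))⁻¹ * 2 ^ (s * l) ≤ (1 / 2) ^ l := by
      rw [one_div, inv_pow, inv_mul_le_iff₀ (by positivity), ← div_eq_mul_inv, le_div_iff₀ (by positivity),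
        ← pow_add]
      refine pow_le_pow_right₀ (by norm_num) ?_
      nlinarith
    calc _ ≤ 2 ^ p * ((2 : ℝ) ^ (l * p))⁻¹ * (2 ^ (s * l) * G 0) := by gcongr; exact hGl l
      _ = 2 ^ p * G 0 * (((2 : ℝ) ^ (l * p))⁻¹ * 2 ^ (s * l)) := by ring
      _ ≤ _ := by gcongr
  calc _ ≤ ∑ l ∈ Finset.range (m + 1), 2 ^ p * G 0 * (1 / 2) ^ l :=
        Finset.sum_le_sum fun l _ => hterm l
    _ = 2 ^ p * G 0 * ∑ l ∈ Finset.range (m + 1), (1 / 2 : ℝ) ^ l := by rw [Finset.mul_sum]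
    _ ≤ 2 ^ p * G 0 * 2 := by gcongr; exact sum_geometric_two_le _
    _ = _ := by ring

variable {ι : Type*} [Fintype ι]

/-- The number of points of a configuration at distance at most `r` from `z`. -/
def cnt (y : ι → EuclideanSpace ℝ (Fin D)) (z : EuclideanSpace ℝ (Fin D)) (r : ℝ) : ℝ :=
  ∑ i, if ‖y i - z‖ ≤ r then 1 else 0

lemma cnt_nonneg (y : ι → EuclideanSpace ℝ (Fin D)) (z : EuclideanSpace ℝ (Fin D)) (r : ℝ) :
    0 ≤ cnt y z r := Finset.sum_nonneg fun i _ => by split_ifs <;> norm_num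

lemma cnt_mono (y : ι → EuclideanSpace ℝ (Fin D)) {z z' : EuclideanSpace ℝ (Fin D)} {r r' : ℝ}
    (h : ‖z - z'‖ + r ≤ r') : cnt y z r ≤ cnt y z' r' := by
  refine Finset.sum_le_sum fun i _ => ?_
  by_cases h1 : ‖y i - z‖ ≤ r
  · have := norm_sub_le_norm_sub_add_norm_sub (y i) z z'
    rw [if_pos h1, if_pos (by linarith)]
  · rw [if_neg h1]; split_ifs <;> norm_num

/-- A configuration on the sphere whose counting measure is doubling at scales at least `r₀`. -/
def RegConf (s : ℕ) (r₀ : ℝ) (y : ι → EuclideanSpace ℝ (Fin D)) : Prop :=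
  (∀ i, ‖y i‖ = 1) ∧ ∀ z : EuclideanSpace ℝ (Fin D), ‖z‖ = 1 → ∀ r, r₀ ≤ r →
    cnt y z (2 * r) ≤ 2 ^ s * cnt y z r

lemma RegConf.cnt_le {s : ℕ} {r₀ : ℝ} {y : ι → EuclideanSpace ℝ (Fin D)} (h : RegConf s r₀ y)
    (hr₀ : 0 < r₀) {z : EuclideanSpace ℝ (Fin D)} (hz : ‖z‖ = 1) {t r : ℝ} (ht : 1 ≤ t)
    (hr : r₀ ≤ r) : cnt y z (t * r) ≤ (2 * t) ^ s * cnt y z r := by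
  have hm : ∀ m : ℕ, cnt y z (2 ^ m * r) ≤ (2 ^ m) ^ s * cnt y z r := by
    intro m
    induction m with
    | zero => simp
    | succ m ih =>
      have h1 : r₀ ≤ 2 ^ m * r := hr.trans (le_mul_of_one_le_left (hr₀.le.trans hr)
        (one_le_pow₀ (by norm_num)))
      have h2 := h.2 z hz _ h1
      rw [pow_succ', mul_pow, mul_assoc, mul_assoc]
      exact h2.trans (by gcongr)
  obtain ⟨m, hm1, hm2⟩ := exists_nat_pow_near ht (one_lt_two)
  have h0 : 0 ≤ r := hr₀.le.trans hr
  calc cnt y z (t * r) ≤ cnt y z (2 ^ (m + 1) * r) := by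
        apply cnt_mono; simp only [sub_self, norm_zero, zero_add]; gcongr
    _ ≤ (2 ^ (m + 1)) ^ s * cnt y z r := hm _
    _ ≤ _ := by
      have := cnt_nonneg y z r
      gcongr
      rw [pow_succ']; gcongr

lemma RegConf.cnt_pos [Nonempty ι] {s : ℕ} {r₀ : ℝ} {y : ι → EuclideanSpace ℝ (Fin D)}
    (h : RegConf s r₀ y) (hr₀ : 0 < r₀) {z : EuclideanSpace ℝ (Fin D)} (hz : ‖z‖ = 1) {r : ℝ}
    (hr : r₀ ≤ r) : 0 < cnt y z r := by
  have h0 : 0 < r := hr₀.trans_le hr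
  have h1 := h.cnt_le hr₀ hz (t := 1 + 2 / r) (by simp; positivity) hr
  have h2 : 0 < cnt y z ((1 + 2 / r) * r) := by
    refine Finset.sum_pos (fun i _ => ?_) Finset.univ_nonempty
    have h3 := norm_sub_le (y i) z
    rw [h.1 i, hz] at h3
    rw [if_pos]
    · norm_num
    · rw [add_mul, div_mul_cancel₀ _ h0.ne']; linarith
  by_contra hneg
  have : cnt y z r = 0 := le_antisymm (not_lt.1 hneg) (cnt_nonneg _ _ _)
  rw [this, mul_zero] at h1
  linarith

lemma RegConf.sum_inv_sdist_le {s n p : ℕ} (hn : 0 < n) {r₀ : ℝ}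
    {y : ι → EuclideanSpace ℝ (Fin D)}
    (h : RegConf s r₀ y) (hr : r₀ ≤ 1 / n) (hp : s + 1 ≤ p)
    {z : EuclideanSpace ℝ (Fin D)} (hz : ‖z‖ = 1) :
    ∑ i, (sdist n (y i) z ^ p)⁻¹ ≤ 2 ^ (p + 1) * cnt y z (1 / n) := by
  have hn0 : (0 : ℝ) < n := by exact_mod_cast hn
  obtain ⟨m, hm⟩ := pow_unbounded_of_one_lt ((n : ℝ) * 2) one_lt_two
  have hb : ∀ i, (n : ℝ) * ‖y i - z‖ ≤ 2 ^ m := by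
    intro i
    have h3 := norm_sub_le (y i) z
    rw [h.1 i, hz] at h3
    refine le_trans ?_ hm.le
    gcongr; linarith
  calc _ ≤ ∑ i, ∑ l ∈ Finset.range (m + 1),
        2 ^ p * ((2 : ℝ) ^ (l * p))⁻¹ * (if (n : ℝ) * ‖y i - z‖ ≤ 2 ^ l then 1 else 0) :=
        Finset.sum_le_sum fun i _ => inv_pow_le_dyadic (by positivity) (hb i) p
    _ = ∑ l ∈ Finset.range (m + 1), 2 ^ p * ((2 : ℝ) ^ (l * p))⁻¹ * cnt y z (2 ^ l * (1 / n)) := by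
      rw [Finset.sum_comm]
      refine Finset.sum_congr rfl fun l _ => ?_
      rw [cnt, Finset.mul_sum]
      refine Finset.sum_congr rfl fun i _ => ?_
      congr 2
      rw [mul_one_div, le_div_iff₀ hn0, mul_comm]
    _ ≤ _ := by
      refine (dyadic_sum_le (G := fun l => cnt y z (2 ^ l * (1 / n))) hp (cnt_nonneg _ _ _)
        (fun l => ?_) m).trans (by simp)
      rw [pow_succ', mul_assoc]
      exact h.2 z hz _ (hr.trans (le_mul_of_one_le_left (by positivity)
        (one_le_pow₀ (by norm_num))))

/-- The scale at which a polynomial is comparable to its weighted maximum. -/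
def etaC (s : ℕ) : ℝ := 1 / (2 * bernC (2 * s + 1))

lemma etaC_pos (s : ℕ) : 0 < etaC s := by
  have := one_le_bernC (2 * s + 1)
  simp only [etaC]; positivity

lemma etaC_le_one (s : ℕ) : etaC s ≤ 1 := by
  have := one_le_bernC (2 * s + 1)
  rw [etaC, div_le_one (by positivity)]; linarith

lemma exists_growth_max (k n : ℕ) (p : MvPolynomial (Fin D) ℝ) {x : EuclideanSpace ℝ (Fin D)}
    (hx : ‖x‖ = 1) : ∃ z : EuclideanSpace ℝ (Fin D), ‖z‖ = 1 ∧
      ∀ u : EuclideanSpace ℝ (Fin D), ‖u‖ = 1 →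
        |pEval p u| / sdist n x u ^ (2 * k) ≤ |pEval p z| / sdist n x z ^ (2 * k) := by
  have hc : ContinuousOn (fun u => |pEval p u| / sdist n x u ^ (2 * k))
      (Metric.sphere (0 : EuclideanSpace ℝ (Fin D)) 1) := by
    apply Continuous.continuousOn
    refine Continuous.div (by fun_prop) (by unfold sdist; fun_prop) fun u => ?_
    exact (pow_pos (sdist_pos _ _ _) _).ne'
  obtain ⟨z, hz, h⟩ := (isCompact_sphere (0 : EuclideanSpace ℝ (Fin D)) 1).exists_isMaxOn
    ⟨x, by simpa using hx⟩ hc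
  exact ⟨z, by simpa using hz, fun u hu => h (by simpa using hu)⟩

/-- The constant in the discrete maximal inequality. -/
def maxC (s : ℕ) : ℝ :=
  2 * (2 * (2 / etaC s)) ^ s * 2 ^ (3 * s + 2) * (2 ^ s * 2 ^ (2 * s + 3))

lemma maxC_pos (s : ℕ) : 0 < maxC s := by
  have := etaC_pos s
  simp only [maxC]; positivity

/-- The weighted maxima of a polynomial over a regular configuration are summable against the
values of the polynomial. -/
lemma RegConf.exists_sum_growth_le {s n : ℕ} (hn : 0 < n)
    {y : ι → EuclideanSpace ℝ (Fin D)} (h : RegConf s (etaC s / n) y)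
    {p : MvPolynomial (Fin D) ℝ} (hp : p.totalDegree ≤ n) :
    ∃ S : ι → ℝ, (∀ i, ∀ z : EuclideanSpace ℝ (Fin D), ‖z‖ = 1 →
        |pEval p z| ≤ S i * sdist n (y i) z ^ (2 * (2 * s + 1))) ∧
      ∑ i, S i ≤ maxC s * ∑ i, |pEval p (y i)| := by
  classical
  set k := 2 * s + 1 with hk
  set η := etaC s with hη
  have hη0 : 0 < η := etaC_pos s
  have hη1 : η ≤ 1 := etaC_le_one s
  have hn0 : (0 : ℝ) < n := by exact_mod_cast hn
  have hr0 : 0 < η / n := by positivity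
  have hr1 : η / n ≤ 1 / n := by gcongr
  choose z hz hzmax using fun i => exists_growth_max k n p (h.1 i)
  set S : ι → ℝ := fun i => |pEval p (z i)| / sdist n (y i) (z i) ^ (2 * k) with hSdef
  have hS0 : ∀ i, 0 ≤ S i := fun i => div_nonneg (abs_nonneg _) (pow_pos (sdist_pos _ _ _) _).le
  have hS : ∀ i, ∀ u : EuclideanSpace ℝ (Fin D), ‖u‖ = 1 →
      |pEval p u| ≤ S i * sdist n (y i) u ^ (2 * k) := by
    intro i u hu
    rw [← div_le_iff₀ (pow_pos (sdist_pos _ _ _) _)]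
    exact hzmax i u hu
  have hfz : ∀ i, |pEval p (z i)| = S i * sdist n (y i) (z i) ^ (2 * k) := by
    intro i
    rw [hSdef, div_mul_cancel₀ _ (pow_pos (sdist_pos _ _ _) _).ne']
  have hloc : ∀ i, ∀ u : EuclideanSpace ℝ (Fin D), ‖u‖ = 1 → ‖u - z i‖ ≤ η / n →
      |pEval p (z i)| ≤ 2 * |pEval p u| := by
    intro i u hu huz
    have hnu : n * ‖u - z i‖ ≤ η := by rwa [le_div_iff₀ hn0, mul_comm] at huz
    have hgrow : ∀ v : EuclideanSpace ℝ (Fin D), ‖v‖ = 1 →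
        |pEval p v| ≤ |pEval p (z i)| * sdist n (z i) v ^ (2 * k) := by
      intro v hv
      refine (hS i v hv).trans ?_
      rw [hfz, mul_assoc, ← mul_pow]
      have := sdist_le_mul n (y i) (z i) v
      have := hS0 i
      gcongr
      exact (sdist_pos _ _ _).le
    have h1 := abs_pEval_sub_le_of_growth (k := k) (by omega) hn hp (hz i) hu hgrow
      (hnu.trans hη1)
    have h2 : bernC k * (n * ‖u - z i‖) ≤ 1 / 2 := by
      have hb := one_le_bernC k
      calc _ ≤ bernC k * η := by gcongr
        _ = 1 / 2 := by rw [hη, etaC, ← hk]; field_simp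
    have h3 : |pEval p u - pEval p (z i)| ≤ 1 / 2 * |pEval p (z i)| := h1.trans (by gcongr)
    have h4 := abs_sub_abs_le_abs_sub (pEval p (z i)) (pEval p u)
    rw [abs_sub_comm] at h4
    linarith
  have hpos : ∀ i : ι, ∀ u : EuclideanSpace ℝ (Fin D), ‖u‖ = 1 → ∀ r, η / n ≤ r → 0 < cnt y u r :=
    fun i u hu r hr => by
      have : Nonempty ι := ⟨i⟩
      exact h.cnt_pos hr0 hu hr
  refine ⟨S, hS, ?_⟩
  have hSi : ∀ i, S i ≤ ∑ j, (2 * (2 * (2 / η)) ^ s * 2 ^ (3 * s + 2) * 2 ^ s) * |pEval p (y j)| *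
      (sdist n (y i) (y j) ^ (2 * s + 2))⁻¹ / cnt y (y j) (1 / n) := by
    intro i
    set t := sdist n (y i) (z i) with ht
    have ht1 : 1 ≤ t := one_le_sdist _ _ _
    have hc1 : cnt y (y i) (1 / n) ≤ (2 * (t / η)) ^ s * cnt y (z i) (η / n) := by
      refine le_trans ?_ (h.cnt_le hr0 (hz i) (t := t / η) ?_ le_rfl)
      · apply cnt_mono
        rw [ht, sdist]
        apply le_of_eq
        field_simp
        ring
      · rw [le_div_iff₀ hη0]; linarith
    have hcz := hpos i (z i) (hz i) _ le_rfl
    have hci := hpos i (y i) (h.1 i) _ hr1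
    have hterm : ∀ j, (if ‖y j - z i‖ ≤ η / n then (1 : ℝ) else 0) * |pEval p (z i)| ≤
        2 * |pEval p (y j)| * ((2 * t) ^ (3 * s + 2) * (sdist n (y i) (y j) ^ (3 * s + 2))⁻¹) := by
      intro j
      split_ifs with hj
      · rw [one_mul]
        refine (hloc i _ (h.1 j) hj).trans (le_mul_of_one_le_right (by positivity) ?_)
        rw [← div_eq_mul_inv, ← div_pow]
        apply one_le_pow₀
        rw [one_le_div (sdist_pos _ _ _)]
        refine (sdist_le_mul n (y i) (z i) (y j)).trans ?_
        rw [mul_comm 2 t]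
        gcongr
        rw [sdist, norm_sub_rev]
        have : n * ‖y j - z i‖ ≤ η := by rwa [le_div_iff₀ hn0, mul_comm] at hj
        linarith
      · rw [zero_mul]
        have := sdist_pos n (y i) (y j)
        positivity
    have hsum : cnt y (z i) (η / n) * |pEval p (z i)| ≤ ∑ j,
        2 * |pEval p (y j)| * ((2 * t) ^ (3 * s + 2) * (sdist n (y i) (y j) ^ (3 * s + 2))⁻¹) := by
      rw [cnt, Finset.sum_mul]
      exact Finset.sum_le_sum fun j _ => hterm j
    rw [hfz] at hsum
    have hA : ∀ j, 2 * |pEval p (y j)| *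
        ((2 * t) ^ (3 * s + 2) * (sdist n (y i) (y j) ^ (3 * s + 2))⁻¹) =
        t ^ (3 * s + 2) * (2 * |pEval p (y j)| *
          (2 ^ (3 * s + 2) * (sdist n (y i) (y j) ^ (3 * s + 2))⁻¹)) := by
      intro j; rw [mul_pow]; ring
    simp only [hA, ← Finset.mul_sum] at hsum
    set W := ∑ j, 2 * |pEval p (y j)| * (2 ^ (3 * s + 2) * (sdist n (y i) (y j) ^ (3 * s + 2))⁻¹)
      with hW
    have hsum2 : cnt y (z i) (η / n) * (S i * t ^ s) ≤ W := by
      have e : t ^ (2 * k) = t ^ (3 * s + 2) * t ^ s := by rw [← pow_add]; congr 1; omega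
      rw [e] at hsum
      refine le_of_mul_le_mul_left (a := t ^ (3 * s + 2)) ?_ (by positivity)
      linarith
    have hsum3 : cnt y (y i) (1 / n) * S i ≤ (2 * (1 / η)) ^ s * W := by
      calc _ ≤ ((2 * (t / η)) ^ s * cnt y (z i) (η / n)) * S i := by gcongr
        _ = (2 * (1 / η)) ^ s * (cnt y (z i) (η / n) * (S i * t ^ s)) := by
          rw [show 2 * (t / η) = 2 * (1 / η) * t by ring, mul_pow]; ring
        _ ≤ _ := by gcongr
    have hsum4 : S i ≤ ∑ j, (2 * (1 / η)) ^ s * (2 * |pEval p (y j)| *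
        (2 ^ (3 * s + 2) * (sdist n (y i) (y j) ^ (3 * s + 2))⁻¹)) / cnt y (y i) (1 / n) := by
      rw [← Finset.sum_div, ← Finset.mul_sum, le_div_iff₀ hci]
      linarith
    refine hsum4.trans (Finset.sum_le_sum fun j _ => ?_)
    have hcj := hpos i (y j) (h.1 j) _ hr1
    set b := sdist n (y i) (y j) with hb
    have hb0 : 1 ≤ b := one_le_sdist _ _ _
    have hcc : cnt y (y j) (1 / n) ≤ (2 * b) ^ s * cnt y (y i) (1 / n) := by
      refine le_trans ?_ (h.cnt_le hr0 (h.1 i) hb0 hr1)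
      apply cnt_mono
      rw [hb, sdist, norm_sub_rev]
      apply le_of_eq
      field_simp
      ring
    rw [div_le_div_iff₀ hci hcj]
    have hbe : b ^ (3 * s + 2) = b ^ (2 * s + 2) * b ^ s := by rw [← pow_add]; congr 1; omega
    have hη2 : (2 * (1 / η)) ^ s ≤ (2 * (2 / η)) ^ s := by gcongr; norm_num
    calc _ ≤ (2 * (1 / η)) ^ s * (2 * |pEval p (y j)| * (2 ^ (3 * s + 2) * (b ^ (3 * s + 2))⁻¹)) *
          ((2 * b) ^ s * cnt y (y i) (1 / n)) := by gcongr
      _ = (2 * (2 * (1 / η)) ^ s * 2 ^ (3 * s + 2) * 2 ^ s) * |pEval p (y j)| *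
          (b ^ (2 * s + 2))⁻¹ * cnt y (y i) (1 / n) := by
        rw [hbe, mul_pow 2 b]; field_simp
      _ ≤ _ := by gcongr
  calc _ ≤ ∑ i, ∑ j, (2 * (2 * (2 / η)) ^ s * 2 ^ (3 * s + 2) * 2 ^ s) * |pEval p (y j)| *
      (sdist n (y i) (y j) ^ (2 * s + 2))⁻¹ / cnt y (y j) (1 / n) :=
        Finset.sum_le_sum fun i _ => hSi i
    _ = ∑ j, (2 * (2 * (2 / η)) ^ s * 2 ^ (3 * s + 2) * 2 ^ s) * |pEval p (y j)| *
      (∑ i, (sdist n (y i) (y j) ^ (2 * s + 2))⁻¹) / cnt y (y j) (1 / n) := by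
      rw [Finset.sum_comm]
      refine Finset.sum_congr rfl fun j _ => ?_
      rw [Finset.mul_sum, Finset.sum_div]
    _ ≤ ∑ j, (2 * (2 * (2 / η)) ^ s * 2 ^ (3 * s + 2) * 2 ^ s) * |pEval p (y j)| *
      2 ^ (2 * s + 3) := by
      refine Finset.sum_le_sum fun j _ => ?_
      have hcj := hpos j (y j) (h.1 j) _ hr1
      rw [div_le_iff₀ hcj, mul_assoc _ (2 ^ (2 * s + 3) : ℝ)]
      gcongr
      exact h.sum_inv_sdist_le hn hr1 (by omega) (h.1 j)
    _ = _ := by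
      rw [maxC, Finset.mul_sum]
      exact Finset.sum_congr rfl fun j _ => by ring

/-- The constant in the oscillation inequality. -/
def oscC (s : ℕ) : ℝ := 2 * bernC (2 * s + 1) * maxC s

lemma oscC_pos (s : ℕ) : 0 < oscC s := by
  have := one_le_bernC (2 * s + 1)
  have := maxC_pos s
  simp only [oscC]; positivity

lemma RegConf.sum_abs_sub_le {s n : ℕ} (hn : 0 < n)
    {y : ι → EuclideanSpace ℝ (Fin D)} (h : RegConf s (etaC s / n) y)
    {p : MvPolynomial (Fin D) ℝ} (hp : p.totalDegree ≤ n) {τ : ℝ} (hτ : τ ≤ 1)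
    {z z' : ι → EuclideanSpace ℝ (Fin D)} (hz : ∀ i, ‖z i‖ = 1) (hz' : ∀ i, ‖z' i‖ = 1)
    (hyz : ∀ i, n * ‖z i - y i‖ ≤ τ) (hyz' : ∀ i, n * ‖z' i - y i‖ ≤ τ) :
    ∑ i, |pEval p (z i) - pEval p (z' i)| ≤ oscC s * τ * ∑ i, |pEval p (y i)| := by
  obtain ⟨S, hS, hsum⟩ := h.exists_sum_growth_le hn hp
  have hS0 : ∀ i, 0 ≤ S i := by
    intro i
    have := (abs_nonneg _).trans (hS i (y i) (h.1 i))
    simpa [sdist] using this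
  have hb := one_le_bernC (2 * s + 1)
  have key : ∀ i, ∀ u : EuclideanSpace ℝ (Fin D), ‖u‖ = 1 → n * ‖u - y i‖ ≤ τ →
      |pEval p u - pEval p (y i)| ≤ bernC (2 * s + 1) * τ * S i := by
    intro i u hu hun
    refine (abs_pEval_sub_le_of_growth (by omega) hn hp (h.1 i) hu (hS i) (hun.trans hτ)).trans ?_
    have := hS0 i
    gcongr
  calc _ ≤ ∑ i, 2 * bernC (2 * s + 1) * τ * S i := by
        refine Finset.sum_le_sum fun i _ => ?_
        have h1 := key i _ (hz i) (hyz i)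
        have h2 := key i _ (hz' i) (hyz' i)
        rw [abs_sub_comm] at h2
        have h3 := abs_sub_le (pEval p (z i)) (pEval p (y i)) (pEval p (z' i))
        linarith
    _ = 2 * bernC (2 * s + 1) * τ * ∑ i, S i := by rw [Finset.mul_sum]
    _ ≤ 2 * bernC (2 * s + 1) * τ * (maxC s * ∑ i, |pEval p (y i)|) := by
        rcases isEmpty_or_nonempty ι with hι | ⟨⟨i⟩⟩
        · simp
        · have : 0 ≤ τ := le_trans (by positivity) (hyz i)
          gcongr
    _ = _ := by rw [oscC]; ring

end

section

variable {D : ℕ}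

open Classical in
/-- Separated finite subsets of the sphere built by successively attaching nearby points. -/
inductive SepTree (r : ℝ) : Finset (EuclideanSpace ℝ (Fin D)) → Prop
  | single (x : EuclideanSpace ℝ (Fin D)) : ‖x‖ = 1 → SepTree r {x}
  | insert (A : Finset (EuclideanSpace ℝ (Fin D))) (y a : EuclideanSpace ℝ (Fin D)) :
      SepTree r A → ‖y‖ = 1 → a ∈ A → ‖y - a‖ ≤ 2 * r → (∀ b ∈ A, r < ‖y - b‖) →
      SepTree r (insert y A)

lemma SepTree.nonempty {r : ℝ} {A : Finset (EuclideanSpace ℝ (Fin D))} (h : SepTree r A) :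
    A.Nonempty := by
  cases h <;> simp

lemma SepTree.norm_eq {r : ℝ} {A : Finset (EuclideanSpace ℝ (Fin D))} (h : SepTree r A) :
    ∀ a ∈ A, ‖a‖ = 1 := by
  induction h with
  | single x hx => simpa using hx
  | insert A y a _ hy _ _ _ ih =>
    intro b hb
    rcases Finset.mem_insert.1 hb with rfl | hb
    exacts [hy, ih b hb]

lemma SepTree.separated {r : ℝ} {A : Finset (EuclideanSpace ℝ (Fin D))} (h : SepTree r A) :
    ∀ a ∈ A, ∀ b ∈ A, a ≠ b → r < ‖a - b‖ := by
  induction h with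
  | single x hx =>
    intro a ha b hb hab
    simp only [Finset.mem_singleton] at ha hb
    exact absurd (ha.trans hb.symm) hab
  | insert A y a _ _ _ _ hs ih =>
    intro b hb c hc hbc
    rcases Finset.mem_insert.1 hb with hb1 | hb1 <;> rcases Finset.mem_insert.1 hc with hc1 | hc1
    · exact absurd (hb1.trans hc1.symm) hbc
    · rw [hb1]; exact hs c hc1
    · rw [hc1, norm_sub_rev]; exact hs b hb1
    · exact ih b hb1 c hc1 hbc

lemma exists_card_bound {r : ℝ} (hr : 0 < r) : ∃ K : ℕ,
    ∀ A : Finset (EuclideanSpace ℝ (Fin D)), SepTree r A → A.card ≤ K := by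
  classical
  obtain ⟨t, -, htf, ht⟩ := (isCompact_sphere (0 : EuclideanSpace ℝ (Fin D)) 1).finite_cover_balls
    (half_pos hr)
  refine ⟨htf.toFinset.card, fun A hA => ?_⟩
  have hex : ∀ a ∈ A, ∃ c ∈ htf.toFinset, ‖a - c‖ < r / 2 := by
    intro a ha
    have := ht (show a ∈ Metric.sphere 0 1 by simpa using hA.norm_eq a ha)
    simp only [mem_iUnion, Metric.mem_ball, dist_eq_norm] at this
    obtain ⟨c, hc, h⟩ := this
    exact ⟨c, by simpa using hc, h⟩
  choose! f hf1 hf2 using hex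
  refine Finset.card_le_card_of_injOn f hf1 fun a ha b hb hab => ?_
  by_contra hne
  have h1 := hA.separated a ha b hb hne
  have h2 := hf2 a ha
  have h3 := hf2 b hb
  rw [← hab, norm_sub_rev] at h3
  have := norm_sub_le_norm_sub_add_norm_sub a (f a) b
  linarith

lemma exists_sepTree_net (hD : 2 ≤ D) {r : ℝ} (hr : 0 < r) :
    ∃ A : Finset (EuclideanSpace ℝ (Fin D)), SepTree r A ∧
      ∀ z : EuclideanSpace ℝ (Fin D), ‖z‖ = 1 → ∃ a ∈ A, ‖z - a‖ ≤ r := by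
  classical
  obtain ⟨K, hK⟩ := exists_card_bound (D := D) hr
  obtain ⟨x, hx⟩ : ∃ x : EuclideanSpace ℝ (Fin D), ‖x‖ = 1 :=
    ⟨EuclideanSpace.single ⟨0, by omega⟩ 1, by simp⟩
  have hex : ∃ m, ∃ A : Finset (EuclideanSpace ℝ (Fin D)), SepTree r A ∧ A.card = m :=
    ⟨1, {x}, SepTree.single x hx, by simp⟩
  obtain ⟨m, ⟨A, hA, hAm⟩, hmax⟩ : ∃ m, (∃ A : Finset (EuclideanSpace ℝ (Fin D)),
      SepTree r A ∧ A.card = m) ∧ ∀ B : Finset (EuclideanSpace ℝ (Fin D)),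
      SepTree r B → B.card ≤ m := by
    set P : ℕ → Prop := fun m => ∃ A : Finset (EuclideanSpace ℝ (Fin D)), SepTree r A ∧ A.card = m
      with hP
    refine ⟨Nat.findGreatest P K, ?_, ?_⟩
    · obtain ⟨m, hm⟩ := hex
      obtain ⟨B, hB, hBm⟩ := hm
      exact Nat.findGreatest_spec (P := P) (hBm ▸ hK B hB) ⟨B, hB, hBm⟩
    · intro B hB
      exact Nat.le_findGreatest (hK B hB) ⟨B, hB, rfl⟩
  refine ⟨A, hA, fun z hz => ?_⟩
  by_contra hneg
  push Not at hneg
  have hne : (A : Set (EuclideanSpace ℝ (Fin D))).Nonempty := hA.nonempty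
  set f : EuclideanSpace ℝ (Fin D) → ℝ := fun u => Metric.infDist u A with hf
  have hfc : Continuous f := Metric.continuous_infDist_pt _
  have hatt : ∀ u, ∃ a ∈ A, f u = ‖u - a‖ := by
    intro u
    obtain ⟨a, ha, h⟩ := A.finite_toSet.isCompact.exists_infDist_eq_dist hne u
    exact ⟨a, ha, by rw [← dist_eq_norm]; exact h⟩
  have hfz : r < f z := by
    obtain ⟨a, ha, h⟩ := hatt z
    rw [h]; exact hneg a ha
  obtain ⟨a0, ha0⟩ := hne
  have hfa : f a0 = 0 := Metric.infDist_zero_of_mem ha0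
  have hconn : IsPreconnected (Metric.sphere (0 : EuclideanSpace ℝ (Fin D)) 1) := by
    apply (isConnected_sphere _ _ zero_le_one).isPreconnected
    rw [← Module.finrank_eq_rank, finrank_euclideanSpace_fin]
    exact_mod_cast hD
  have hivt := hconn.intermediate_value (a := a0) (b := z)
    (by simpa using hA.norm_eq a0 ha0) (by simpa using hz) hfc.continuousOn
  obtain ⟨y, hy, hfy⟩ := hivt (show min (f z) (2 * r) ∈ Icc (f a0) (f z) from
    ⟨by rw [hfa]; exact le_min (by linarith) (by linarith), min_le_left _ _⟩)
  have hy1 : ‖y‖ = 1 := by simpa using hy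
  obtain ⟨a, ha, hya⟩ := hatt y
  have hlow : r < f y := by rw [hfy]; exact lt_min hfz (by linarith)
  have hsep : ∀ b ∈ A, r < ‖y - b‖ := fun b hb => hlow.trans_le (by
    rw [← dist_eq_norm]; exact Metric.infDist_le_dist_of_mem hb)
  have hB := SepTree.insert A y a hA hy1 ha
    (by rw [← hya, hfy]; exact min_le_right _ _) hsep
  have hyA : y ∉ A := by
    intro h
    have := hsep y h
    rw [sub_self, norm_zero] at this; linarith
  have := hmax _ hB
  rw [Finset.card_insert_of_notMem hyA] at this
  omega

lemma SepTree.exists_transport {r : ℝ} (hr : 0 < r) {A : Finset (EuclideanSpace ℝ (Fin D))}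
    (h : SepTree r A) {ε : ℝ} (hε : 0 < ε) :
    ∀ (o s : EuclideanSpace ℝ (Fin D) → ℝ) (K : ℕ), (∀ v ∈ A, ε ≤ o v) → (∀ v ∈ A, 0 ≤ s v) →
      ∑ v ∈ A, (o v + s v) = K * ε →
      ∃ (k : EuclideanSpace ℝ (Fin D) → ℕ)
        (F : EuclideanSpace ℝ (Fin D) → EuclideanSpace ℝ (Fin D) → ℝ),
        (∀ v u, 0 ≤ F v u) ∧ (∀ v u, F v u ≠ 0 → v ∈ A ∧ u ∈ A ∧ ‖v - u‖ ≤ 2 * r) ∧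
        (∀ v ∈ A, ∑ u ∈ A, F v u = o v) ∧ ∀ u ∈ A, ∑ v ∈ A, F v u + s u = k u * ε := by
  classical
  induction h with
  | single x hx =>
    intro o s K ho hs hsum
    simp only [Finset.mem_singleton, forall_eq, Finset.sum_singleton] at ho hs hsum
    refine ⟨fun _ => K, fun v u => if v = x ∧ u = x then o x else 0, ?_, ?_, ?_, ?_⟩
    · intro v u; simp only; split_ifs <;> linarith
    · intro v u hvu
      have : v = x ∧ u = x := by by_contra h; simp [h] at hvu
      simp [this.1, this.2, hr.le]
    · simp
    · simpa using hsum
  | insert A y a hA hy ha hya hsep ih =>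
    intro o s K ho hs hsum
    have hyA : y ∉ A := by
      intro h
      have := hsep y h
      rw [sub_self, norm_zero] at this; linarith
    have hay : a ≠ y := fun h => hyA (h ▸ ha)
    rw [Finset.sum_insert hyA] at hsum
    have hoy := ho y (Finset.mem_insert_self _ _)
    have hsy := hs y (Finset.mem_insert_self _ _)
    have hoA : ∀ v ∈ A, ε ≤ o v := fun v hv => ho v (Finset.mem_insert_of_mem hv)
    have hsA : ∀ v ∈ A, 0 ≤ s v := fun v hv => hs v (Finset.mem_insert_of_mem hv)
    set t := o y + s y with ht
    have ht0 : 0 ≤ t / ε := div_nonneg (by linarith) hε.le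
    set j := ⌊t / ε⌋₊ with hj
    set q := t - j * ε with hq
    have hq0 : 0 ≤ q := by
      have := Nat.floor_le ht0
      rw [le_div_iff₀ hε] at this; linarith
    have hq1 : q < ε := by
      have := Nat.lt_floor_add_one (t / ε)
      rw [div_lt_iff₀ hε] at this; linarith
    have hsumA : 0 ≤ ∑ v ∈ A, (o v + s v) :=
      Finset.sum_nonneg fun v hv => by linarith [hoA v hv, hsA v hv]
    have hjK : j ≤ K := by
      have : (j : ℝ) * ε ≤ K * ε := by linarith
      exact_mod_cast le_of_mul_le_mul_right this hε
    obtain ⟨k, F, hF0, hFs, hFr, hFc⟩ := ih o (fun v => s v + if v = a then q else 0) (K - j) hoA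
      (fun v hv => by have := hsA v hv; split_ifs <;> linarith) (by
        simp only [← add_assoc]
        rw [Finset.sum_add_distrib, Finset.sum_ite_eq' A a, if_pos ha, Nat.cast_sub hjK, sub_mul]
        linarith)
    have hFy1 : ∀ u, F y u = 0 := fun u => by
      by_contra hne; exact hyA (hFs _ _ hne).1
    have hFy2 : ∀ u, F u y = 0 := fun u => by
      by_contra hne; exact hyA (hFs _ _ hne).2.1
    refine ⟨fun u => if u = y then j else k u,
      fun v u => F v u + if v = y then (if u = y then o y - q else if u = a then q else 0) else 0,
      ?_, ?_, ?_, ?_⟩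
    · intro v u
      have := hF0 v u
      simp only
      split_ifs <;> linarith
    · intro v u hvu
      simp only at hvu
      by_cases hF : F v u = 0
      · rw [hF, zero_add] at hvu
        have hv : v = y := by by_contra h; simp [h] at hvu
        subst hv
        by_cases hu : u = v
        · subst hu; simp [hr.le]
        · have hua : u = a := by by_contra h; simp [h, hu] at hvu
          subst hua
          exact ⟨Finset.mem_insert_self _ _, Finset.mem_insert_of_mem ha, hya⟩
      · obtain ⟨h1, h2, h3⟩ := hFs v u hF
        exact ⟨Finset.mem_insert_of_mem h1, Finset.mem_insert_of_mem h2, h3⟩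
    · intro v hv
      rw [Finset.sum_insert hyA]
      rcases Finset.mem_insert.1 hv with rfl | hv
      · simp only [if_true, hFy1, zero_add]
        have : ∑ u ∈ A, (if u = v then o v - q else if u = a then q else 0) = q := by
          rw [Finset.sum_eq_single_of_mem a ha]
          · simp [hay]
          · intro b hb hba
            have : b ≠ v := fun h => hyA (h ▸ hb)
            simp [this, hba]
        rw [this]; ring
      · have hvy : v ≠ y := fun h => hyA (h ▸ hv)
        simp only [if_neg hvy, add_zero, hFy2, zero_add]
        exact hFr v hv
    · intro u hu
      rw [Finset.sum_insert hyA]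
      have hz : ∀ G : EuclideanSpace ℝ (Fin D) → ℝ, ∑ v ∈ A, (F v u + if v = y then G u else 0)
          = ∑ v ∈ A, F v u := by
        intro G
        refine Finset.sum_congr rfl fun v hv => ?_
        have hvy : v ≠ y := fun h => hyA (h ▸ hv)
        simp [hvy]
      rw [hz fun u => if u = y then o y - q else if u = a then q else 0]
      rcases Finset.mem_insert.1 hu with rfl | hu
      · simp only [hFy2, if_true, Finset.sum_const_zero]
        linarith
      · have huy : u ≠ y := fun h => hyA (h ▸ hu)
        simp only [if_neg huy, hFy1, if_true, zero_add]
        have := hFc u hu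
        linarith

end

section

variable {D : ℕ}

/-- The indicator function of the Voronoi cell of `u` with respect to `A`. -/
def cellInd (A : Finset (EuclideanSpace ℝ (Fin D))) (u z : EuclideanSpace ℝ (Fin D)) : ℝ :=
  {z | ∀ w ∈ A, ‖z - u‖ ≤ ‖z - w‖}.indicator 1 z

/-- The Voronoi partition of unity associated with `A`. -/
def cellFn (A : Finset (EuclideanSpace ℝ (Fin D))) (u z : EuclideanSpace ℝ (Fin D)) : ℝ :=
  cellInd A u z / ∑ v ∈ A, cellInd A v z

lemma measurable_cellInd (A : Finset (EuclideanSpace ℝ (Fin D))) (u : EuclideanSpace ℝ (Fin D)) :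
    Measurable (cellInd A u) := by
  refine measurable_one.indicator ?_
  have : {z | ∀ w ∈ A, ‖z - u‖ ≤ ‖z - w‖} = ⋂ w ∈ A, {z | ‖z - u‖ ≤ ‖z - w‖} := by
    ext z; simp
  rw [this]
  refine MeasurableSet.biInter A.countable_toSet fun w _ => ?_
  exact (isClosed_le (by fun_prop) (by fun_prop)).measurableSet

lemma measurable_cellFn (A : Finset (EuclideanSpace ℝ (Fin D))) (u : EuclideanSpace ℝ (Fin D)) :
    Measurable (cellFn A u) :=
  (measurable_cellInd A u).div (Finset.measurable_sum _ fun v _ => measurable_cellInd A v)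

lemma cellInd_nonneg (A : Finset (EuclideanSpace ℝ (Fin D))) (u z : EuclideanSpace ℝ (Fin D)) :
    0 ≤ cellInd A u z := indicator_nonneg (fun _ _ => zero_le_one) z

lemma cellFn_nonneg (A : Finset (EuclideanSpace ℝ (Fin D))) (u z : EuclideanSpace ℝ (Fin D)) :
    0 ≤ cellFn A u z :=
  div_nonneg (cellInd_nonneg _ _ _) (Finset.sum_nonneg fun _ _ => cellInd_nonneg _ _ _)

lemma sum_cellInd_pos {A : Finset (EuclideanSpace ℝ (Fin D))} (hA : A.Nonempty)
    (z : EuclideanSpace ℝ (Fin D)) : 0 < ∑ v ∈ A, cellInd A v z := by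
  obtain ⟨u, hu, h⟩ := A.exists_min_image (fun u => ‖z - u‖) hA
  have h1 : cellInd A u z = 1 := by
    rw [cellInd, indicator_of_mem (by exact h)]; rfl
  have := Finset.single_le_sum (f := fun v => cellInd A v z)
    (fun v _ => cellInd_nonneg A v z) hu
  linarith

lemma sum_cellFn {A : Finset (EuclideanSpace ℝ (Fin D))} (hA : A.Nonempty)
    (z : EuclideanSpace ℝ (Fin D)) : ∑ v ∈ A, cellFn A v z = 1 := by
  simp only [cellFn]
  rw [← Finset.sum_div, div_self (sum_cellInd_pos hA z).ne']

lemma le_of_cellFn_ne_zero {A : Finset (EuclideanSpace ℝ (Fin D))}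
    {u z : EuclideanSpace ℝ (Fin D)} (h : cellFn A u z ≠ 0) :
    ∀ w ∈ A, ‖z - u‖ ≤ ‖z - w‖ := by
  by_contra hneg
  apply h
  rw [cellFn, cellInd, indicator_of_notMem (by exact hneg), zero_div]

lemma cellFn_le_one {A : Finset (EuclideanSpace ℝ (Fin D))}
    {u : EuclideanSpace ℝ (Fin D)} (hu : u ∈ A) (z : EuclideanSpace ℝ (Fin D)) :
    cellFn A u z ≤ 1 := by
  rw [← sum_cellFn ⟨u, hu⟩ z]
  exact Finset.single_le_sum (f := fun v => cellFn A v z) (fun v _ => cellFn_nonneg A v z) hu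

lemma cellFn_eq_one {A : Finset (EuclideanSpace ℝ (Fin D))}
    {u z : EuclideanSpace ℝ (Fin D)} (hu : u ∈ A) (h : ∀ w ∈ A, w ≠ u → ‖z - u‖ < ‖z - w‖) :
    cellFn A u z = 1 := by
  have hz : ∀ w ∈ A, w ≠ u → cellFn A w z = 0 := by
    intro w hw hwu
    by_contra hne
    have := le_of_cellFn_ne_zero hne u hu
    linarith [h w hw hwu]
  rw [← sum_cellFn ⟨u, hu⟩ z, Finset.sum_eq_single_of_mem u hu hz]

lemma integrable_cellFn (μ : Measure (EuclideanSpace ℝ (Fin D))) [IsFiniteMeasure μ]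
    {A : Finset (EuclideanSpace ℝ (Fin D))} {u : EuclideanSpace ℝ (Fin D)} (hu : u ∈ A) :
    Integrable (cellFn A u) μ := by
  refine Integrable.of_bound (measurable_cellFn A u).aestronglyMeasurable 1
    (Filter.Eventually.of_forall fun z => ?_)
  rw [Real.norm_eq_abs, abs_of_nonneg (cellFn_nonneg _ _ _)]
  exact cellFn_le_one hu z

/-- Splitting a probability measure on the sphere into `N` equal localized pieces. -/
lemma exists_equal_partition (hD : 2 ≤ D) (μ : Measure (EuclideanSpace ℝ (Fin D)))
    [IsProbabilityMeasure μ] {r : ℝ} (hr : 0 < r) {N : ℕ} (hN : 0 < N)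
    (hmass : ∀ x : EuclideanSpace ℝ (Fin D), ‖x‖ = 1 →
      (1 : ℝ) / N ≤ μ.real (Metric.closedBall x (r / 2))) :
    ∃ (x : Fin N → EuclideanSpace ℝ (Fin D)) (ψ : Fin N → EuclideanSpace ℝ (Fin D) → ℝ),
      (∀ i, ‖x i‖ = 1) ∧ (∀ i, Measurable (ψ i)) ∧ (∀ i z, 0 ≤ ψ i z) ∧
      (∀ z, ∑ i, ψ i z = 1) ∧ (∀ i, ∫ z, ψ i z ∂μ = 1 / N) ∧
      ∀ i z, ‖z‖ = 1 → ψ i z ≠ 0 → ‖z - x i‖ ≤ 3 * r := by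
  classical
  obtain ⟨A, hA, hnet⟩ := exists_sepTree_net hD hr
  have hN0 : (0 : ℝ) < N := by exact_mod_cast hN
  set ε : ℝ := 1 / N with hε
  have hε0 : 0 < ε := by positivity
  set o : EuclideanSpace ℝ (Fin D) → ℝ := fun v => ∫ z, cellFn A v z ∂μ with ho
  have hoε : ∀ v ∈ A, ε ≤ o v := by
    intro v hv
    refine (hmass v (hA.norm_eq v hv)).trans ?_
    have h1 : ∫ z, (Metric.closedBall v (r / 2)).indicator (fun _ => (1 : ℝ)) z ∂μ
        = μ.real (Metric.closedBall v (r / 2)) := by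
      rw [integral_indicator_const _ Metric.isClosed_closedBall.measurableSet]; simp
    rw [← h1]
    refine integral_mono ((integrable_const _).indicator
      Metric.isClosed_closedBall.measurableSet) (integrable_cellFn μ hv) fun z => ?_
    by_cases hz : z ∈ Metric.closedBall v (r / 2)
    · rw [indicator_of_mem hz, cellFn_eq_one hv]
      intro w hw hwv
      rw [Metric.mem_closedBall, dist_eq_norm] at hz
      have h2 := hA.separated w hw v hv hwv
      have h3 := norm_sub_le_norm_sub_add_norm_sub w z v
      rw [norm_sub_rev w z] at h3
      linarith
    · rw [indicator_of_notMem hz]; exact cellFn_nonneg _ _ _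
  have hosum : ∑ v ∈ A, o v = 1 := by
    rw [ho, ← integral_finsetSum A fun v hv => integrable_cellFn μ hv]
    simp [sum_cellFn hA.nonempty]
  obtain ⟨k, F, hF0, hFs, hFr, hFc⟩ := hA.exists_transport hr hε0 o (fun _ => 0) N hoε
    (fun _ _ => le_rfl) (by
      simp only [add_zero]
      rw [hosum, hε]; field_simp)
  simp only [add_zero] at hFc
  have ho0 : ∀ v ∈ A, o v ≠ 0 := fun v hv => (hε0.trans_le (hoε v hv)).ne'
  have hcard : Fintype.card (Σ u : A, Fin (k u)) = N := by
    rw [Fintype.card_sigma]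
    simp only [Fintype.card_fin]
    rw [Finset.sum_coe_sort A k]
    have h1 : ∑ u ∈ A, ∑ v ∈ A, F v u = ∑ u ∈ A, k u * ε := Finset.sum_congr rfl hFc
    rw [Finset.sum_comm, Finset.sum_congr rfl hFr, hosum, ← Finset.sum_mul, hε] at h1
    field_simp at h1
    exact_mod_cast h1.symm
  set e : Fin N ≃ Σ u : A, Fin (k u) := (Fintype.equivFinOfCardEq hcard).symm with he
  have hk0 : ∀ i, (k (e i).1 : ℝ) ≠ 0 := by
    intro i
    have := (e i).2.pos
    positivity
  set g : EuclideanSpace ℝ (Fin D) → EuclideanSpace ℝ (Fin D) → ℝ :=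
    fun u z => ∑ v ∈ A, F v u / o v * cellFn A v z with hg
  refine ⟨fun i => (e i).1, fun i z => (k (e i).1 : ℝ)⁻¹ * g (e i).1 z,
    fun i => hA.norm_eq _ (e i).1.2, fun i => ?_, fun i z => ?_, fun z => ?_, fun i => ?_,
    fun i z hz hne => ?_⟩
  · refine Measurable.const_mul ?_ _
    exact Finset.measurable_sum _ fun v _ => (measurable_cellFn A v).const_mul _
  · refine mul_nonneg (by positivity) (Finset.sum_nonneg fun v hv => ?_)
    exact mul_nonneg (div_nonneg (hF0 _ _) (hε0.le.trans (hoε v hv))) (cellFn_nonneg _ _ _)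
  · rw [Equiv.sum_comp e fun j => (k j.1 : ℝ)⁻¹ * g j.1 z, Fintype.sum_sigma]
    simp only [Finset.sum_const, Finset.card_univ, Fintype.card_fin, nsmul_eq_mul]
    rw [Finset.sum_coe_sort A fun u => (k u : ℝ) * ((k u : ℝ)⁻¹ * g u z)]
    have h1 : ∀ u ∈ A, (k u : ℝ) * ((k u : ℝ)⁻¹ * g u z) = g u z := by
      intro u hu
      rcases eq_or_ne (k u : ℝ) 0 with h0 | h0
      · have h2 := hFc u hu
        rw [h0, zero_mul, Finset.sum_eq_zero_iff_of_nonneg fun v _ => hF0 v u] at h2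
        rw [h0, zero_mul, hg]
        exact (Finset.sum_eq_zero fun v hv => by rw [h2 v hv]; simp).symm
      · rw [mul_inv_cancel_left₀ h0]
    rw [Finset.sum_congr rfl h1, hg, Finset.sum_comm]
    have h2 : ∀ v ∈ A, ∑ u ∈ A, F v u / o v * cellFn A v z = cellFn A v z := by
      intro v hv
      rw [← Finset.sum_mul, ← Finset.sum_div, hFr v hv, div_self (ho0 v hv), one_mul]
    rw [Finset.sum_congr rfl h2, sum_cellFn hA.nonempty]
  · rw [integral_const_mul, hg]
    simp only
    rw [integral_finsetSum A fun v hv => (integrable_cellFn μ hv).const_mul _]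
    simp only [integral_const_mul]
    have h2 : ∀ v ∈ A, F v (e i).1 / o v * ∫ z, cellFn A v z ∂μ = F v (e i).1 :=
      fun v hv => div_mul_cancel₀ _ (ho0 v hv)
    rw [Finset.sum_congr rfl h2, hFc _ (e i).1.2, inv_mul_cancel_left₀ (hk0 i)]
  · have h1 : g (e i).1 z ≠ 0 := fun h => hne (by simp only; rw [h, mul_zero])
    obtain ⟨v, hv, hv2⟩ := Finset.exists_ne_zero_of_sum_ne_zero h1
    have h2 : cellFn A v z ≠ 0 := fun h => hv2 (by rw [h, mul_zero])
    have h3 : F v (e i).1 ≠ 0 := fun h => hv2 (by rw [h]; simp)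
    obtain ⟨a, ha, haz⟩ := hnet z hz
    have h4 := le_of_cellFn_ne_zero h2 a ha
    have h5 := (hFs _ _ h3).2.2
    have := norm_sub_le_norm_sub_add_norm_sub z v (e i).1
    linarith

end

section

lemma exists_bounded_coeff {V κ : Type*} [AddCommGroup V] [Module ℝ V] [Fintype κ]
    (T : V →ₗ[ℝ] κ → ℝ) (E : V →ₗ[ℝ] ℝ) {ε : ℝ} (hε : 0 ≤ ε)
    (h : ∀ v, |E v| ≤ ε * ∑ k, |T v k|) :
    ∃ c : κ → ℝ, (∀ k, |c k| ≤ ε) ∧ ∀ v, E v = ∑ k, c k * T v k := by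
  classical
  obtain ⟨σ, hσ⟩ := T.rangeRestrict.exists_rightInverse_of_surjective T.range_rangeRestrict
  have hσ' : ∀ x : LinearMap.range T, T (σ x) = x := fun x =>
    congrArg Subtype.val (LinearMap.congr_fun hσ x)
  obtain ⟨g, hg1, hg2⟩ := exists_extension_of_le_sublinear
    (⟨LinearMap.range T, E ∘ₗ σ⟩ : (κ → ℝ) →ₗ.[ℝ] ℝ) (fun x => ε * ∑ k, |x k|)
    (fun c hc x => by
      simp only [Pi.smul_apply, smul_eq_mul, abs_mul, abs_of_pos hc, ← Finset.mul_sum]; ring)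
    (fun x y => by
      rw [← mul_add, ← Finset.sum_add_distrib]
      gcongr with k
      exact abs_add_le _ _)
    (fun x => by
      have := (le_abs_self _).trans (h (σ x))
      rw [hσ'] at this
      exact this)
  have hgT : ∀ v, g (T v) = E v := by
    intro v
    have h1 := hg1 ⟨T v, LinearMap.mem_range_self T v⟩
    have h2 := h (v - σ ⟨T v, LinearMap.mem_range_self T v⟩)
    rw [map_sub, map_sub, hσ'] at h2
    simp only [sub_self, Pi.zero_apply, abs_zero, Finset.sum_const_zero, mul_zero] at h2
    have h3 := abs_eq_zero.1 (le_antisymm h2 (abs_nonneg _))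
    change g (T v) = E (σ _) at h1
    rw [h1]; linarith
  have hsingle : ∀ k, ∑ l, |(Pi.single k (1 : ℝ) : κ → ℝ) l| = 1 := by
    intro k
    rw [Finset.sum_eq_single k]
    · simp
    · intro b _ hb; simp [hb]
    · simp
  refine ⟨fun k => g (Pi.single k 1), fun k => ?_, fun v => ?_⟩
  · have h1 := hg2 (Pi.single k 1)
    have h2 := hg2 (-Pi.single k 1)
    simp only [Pi.neg_apply, abs_neg, hsingle, mul_one, map_neg] at h1 h2
    exact abs_le.2 ⟨by linarith, h1⟩
  · rw [← hgT v]
    conv_lhs => rw [pi_eq_sum_univ' (T v), map_sum]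
    refine Finset.sum_congr rfl fun k _ => ?_
    rw [map_smul, smul_eq_mul, mul_comm]

variable {D : ℕ} {ι : Type*} [Fintype ι]

/-- The total size of the tangential gradients over a configuration. -/
def gradSum (y : ι → EuclideanSpace ℝ (Fin D)) (p : MvPolynomial (Fin D) ℝ) : ℝ :=
  ∑ i, ∑ k, |pEval (tangGrad p k) (y i)|

lemma gradSum_nonneg (y : ι → EuclideanSpace ℝ (Fin D)) (p : MvPolynomial (Fin D) ℝ) :
    0 ≤ gradSum y p := Finset.sum_nonneg fun _ _ => Finset.sum_nonneg fun _ _ => abs_nonneg _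

/-- The defect of the equal-weight sum over `y` as a representation of `I`. -/
def defect (I : MvPolynomial (Fin D) ℝ →ₗ[ℝ] ℝ) (y : ι → EuclideanSpace ℝ (Fin D))
    (p : MvPolynomial (Fin D) ℝ) : ℝ := ∑ i, pEval p (y i) - I p

lemma pEval_smul (c : ℝ) (p : MvPolynomial (Fin D) ℝ) (x : EuclideanSpace ℝ (Fin D)) :
    pEval (c • p) x = c * pEval p x := by simp [pEval]

/-- The evaluation of a polynomial at a point as a linear map. -/
def pEvalL (x : EuclideanSpace ℝ (Fin D)) : MvPolynomial (Fin D) ℝ →ₗ[ℝ] ℝ where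
  toFun p := pEval p x
  map_add' p q := pEval_add p q x
  map_smul' c p := pEval_smul c p x

/-- The tangential derivative at a point as a linear map. -/
def tangGradL (k : Fin D) (x : EuclideanSpace ℝ (Fin D)) : MvPolynomial (Fin D) ℝ →ₗ[ℝ] ℝ where
  toFun p := pEval (tangGrad p k) x
  map_add' p q := by
    simp only [pEval_tangGrad, map_add, pEval_add, mul_add, Finset.sum_add_distrib]; ring
  map_smul' c p := by
    simp only [pEval_tangGrad, Derivation.map_smul, pEval_smul, RingHom.id_apply, smul_eq_mul,
      mul_left_comm _ c, ← Finset.mul_sum]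
    ring

lemma exists_defect_coeff (W : Submodule ℝ (MvPolynomial (Fin D) ℝ))
    (I : MvPolynomial (Fin D) ℝ →ₗ[ℝ] ℝ) (y : ι → EuclideanSpace ℝ (Fin D)) {ε : ℝ}
    (hε : 0 ≤ ε) (h : ∀ p ∈ W, |defect I y p| ≤ ε * gradSum y p) :
    ∃ v : ι → EuclideanSpace ℝ (Fin D), (∀ i k, |v i k| ≤ ε) ∧
      ∀ p ∈ W, defect I y p = - ∑ i, ∑ k, v i k * pEval (tangGrad p k) (y i) := by
  obtain ⟨c, hc1, hc2⟩ := exists_bounded_coeff (V := W) (κ := ι × Fin D)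
    (LinearMap.pi fun j => tangGradL j.2 (y j.1) ∘ₗ W.subtype)
    (((∑ i, pEvalL (y i)) - I) ∘ₗ W.subtype) hε (fun p => by
      have := h p p.2
      simp only [defect, gradSum] at this
      simpa [pEvalL, tangGradL, Fintype.sum_prod_type] using this)
  refine ⟨fun i => WithLp.toLp 2 fun k => -c (i, k), fun i k => by simpa using hc1 (i, k),
    fun p hp => ?_⟩
  have := hc2 ⟨p, hp⟩
  simp only [Fintype.sum_prod_type] at this
  simpa [pEvalL, tangGradL, defect] using this

lemma norm_le_of_abs_le {v : EuclideanSpace ℝ (Fin D)} {ε : ℝ}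
    (h : ∀ k, |v k| ≤ ε) : ‖v‖ ≤ D * ε := by
  have h1 : v = ∑ k, v k • EuclideanSpace.single k (1 : ℝ) := by
    ext l; simp [Pi.single_apply]
  rw [h1]
  refine (norm_sum_le _ _).trans ?_
  calc _ ≤ ∑ _k : Fin D, ε := by
        refine Finset.sum_le_sum fun k _ => ?_
        rw [norm_smul]; simpa using h k
    _ = _ := by simp

/-- The constant of the quadratic defect estimate. -/
def quadC (D s m : ℕ) : ℝ := 4 * D * m * (1 + 2 * oscC s)

lemma quadC_nonneg (D s m : ℕ) : 0 ≤ quadC D s m := by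
  have := oscC_pos s
  simp only [quadC]; positivity

/-- One step of Newton's method: the defect after cancelling the first order term. -/
lemma RegConf.abs_defect_sph_le {s m : ℕ} (hm : 0 < m) (hD : 0 < D)
    {y : ι → EuclideanSpace ℝ (Fin D)} (hy : RegConf s (etaC s / m) y)
    {p : MvPolynomial (Fin D) ℝ} (hp : p.totalDegree < m)
    (I : MvPolynomial (Fin D) ℝ →ₗ[ℝ] ℝ) {ε : ℝ} (hε : 0 ≤ ε) (hε2 : quadC D s m * ε ≤ 1 / 2)
    {v : ι → EuclideanSpace ℝ (Fin D)} (hv : ∀ i k, |v i k| ≤ ε)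
    (hdef : defect I y p = - ∑ i, ∑ k, v i k * pEval (tangGrad p k) (y i)) :
    |defect I (fun i => sph (y i) (v i)) p| ≤
      quadC D s m * ε ^ 2 * gradSum (fun i => sph (y i) (v i)) p := by
  have hC := oscC_pos s
  set C := oscC s with hCdef
  have hD1 : (1 : ℝ) ≤ D := by exact_mod_cast hD
  have hm1 : (1 : ℝ) ≤ m := by exact_mod_cast hm
  set τ : ℝ := 2 * D * m * ε with hτ
  have hτ0 : 0 ≤ τ := by positivity
  have hquad : quadC D s m * ε = 2 * (τ + 2 * (C * τ)) := by rw [quadC, hτ]; ring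
  have hCτ : 0 ≤ C * τ := by positivity
  have hτ1 : τ ≤ 1 := by linarith
  have hDm : 2 * (D * ε) ≤ τ := by
    have : D * ε ≤ D * ε * m := le_mul_of_one_le_right (by positivity) hm1
    rw [hτ]; linarith
  have hvn : ∀ i, ‖v i‖ ≤ D * ε := fun i => norm_le_of_abs_le (hv i)
  have hvn2 : ∀ i, ‖v i‖ ≤ 1 / 2 := fun i => (hvn i).trans (by linarith)
  choose z r hz hzy hr heq using fun i => exists_pEval_sph_sub_eq p (hy.1 i) (hvn2 i)
  have hscale : ∀ u : EuclideanSpace ℝ (Fin D), ∀ i, ‖u‖ ≤ 2 * ‖v i‖ → (m : ℝ) * ‖u‖ ≤ τ := by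
    intro u i hu
    have : ‖u‖ ≤ 2 * (D * ε) := by linarith [hvn i]
    calc (m : ℝ) * ‖u‖ ≤ m * (2 * (D * ε)) := by gcongr
      _ = τ := by rw [hτ]; ring
  have hdeg : ∀ k, (tangGrad p k).totalDegree ≤ m := fun k =>
    (totalDegree_tangGrad_le p k).trans hp
  have hself : ∀ i, (m : ℝ) * ‖y i - y i‖ ≤ τ := fun i => by simpa using hτ0
  have hosc1 : ∀ k, ∑ i, |pEval (tangGrad p k) (z i) - pEval (tangGrad p k) (y i)|
      ≤ C * τ * ∑ i, |pEval (tangGrad p k) (y i)| := fun k =>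
    hy.sum_abs_sub_le hm (hdeg k) hτ1 hz hy.1 (fun i => hscale _ i (hzy i)) hself
  have hosc2 : ∀ k, ∑ i, |pEval (tangGrad p k) (y i) - pEval (tangGrad p k) (sph (y i) (v i))|
      ≤ C * τ * ∑ i, |pEval (tangGrad p k) (y i)| := fun k =>
    hy.sum_abs_sub_le hm (hdeg k) hτ1 hy.1 (fun i => norm_sph (hy.1 i) (hvn2 i)) hself
      (fun i => hscale _ i (norm_sph_sub_le (hy.1 i) (hvn2 i)))
  have hG : gradSum y p ≤ 2 * gradSum (fun i => sph (y i) (v i)) p := by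
    have h1 : ∀ k, ∑ i, |pEval (tangGrad p k) (y i)| ≤
        2 * ∑ i, |pEval (tangGrad p k) (sph (y i) (v i))| := by
      intro k
      have h2 : ∑ i, |pEval (tangGrad p k) (y i)| ≤
          ∑ i, |pEval (tangGrad p k) (sph (y i) (v i))| +
          ∑ i, |pEval (tangGrad p k) (y i) - pEval (tangGrad p k) (sph (y i) (v i))| := by
        rw [← Finset.sum_add_distrib]
        refine Finset.sum_le_sum fun i _ => ?_
        have := abs_sub_abs_le_abs_sub (pEval (tangGrad p k) (y i))
          (pEval (tangGrad p k) (sph (y i) (v i)))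
        linarith
      have h3 := hosc2 k
      have h4 : C * τ * ∑ i, |pEval (tangGrad p k) (y i)| ≤
          1 / 2 * ∑ i, |pEval (tangGrad p k) (y i)| := by
        gcongr; linarith
      linarith
    rw [gradSum, gradSum, Finset.sum_comm, Finset.sum_comm (γ := ι), Finset.mul_sum]
    exact Finset.sum_le_sum fun k _ => h1 k
  have hval : defect I (fun i => sph (y i) (v i)) p = ∑ i, ∑ k, v i k *
      ((r i - 1) * pEval (tangGrad p k) (z i) +
        (pEval (tangGrad p k) (z i) - pEval (tangGrad p k) (y i))) := by
    have h1 : defect I (fun i => sph (y i) (v i)) p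
        = ∑ i, (pEval p (sph (y i) (v i)) - pEval p (y i)) + defect I y p := by
      simp only [defect, Finset.sum_sub_distrib]; ring
    rw [h1, hdef, ← sub_eq_add_neg, ← Finset.sum_sub_distrib]
    refine Finset.sum_congr rfl fun i _ => ?_
    rw [heq, Finset.mul_sum, ← Finset.sum_sub_distrib]
    exact Finset.sum_congr rfl fun k _ => by ring
  have hterm : ∀ i k, |v i k * ((r i - 1) * pEval (tangGrad p k) (z i) +
      (pEval (tangGrad p k) (z i) - pEval (tangGrad p k) (y i)))| ≤
      ε * (τ * |pEval (tangGrad p k) (y i)| +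
        2 * |pEval (tangGrad p k) (z i) - pEval (tangGrad p k) (y i)|) := by
    intro i k
    rw [abs_mul]
    have hr' : |r i - 1| ≤ τ := (hr i).trans (by linarith [hvn i])
    refine mul_le_mul (hv i k) ?_ (abs_nonneg _) hε
    refine (abs_add_le _ _).trans ?_
    rw [abs_mul]
    set a := pEval (tangGrad p k) (z i)
    set b := pEval (tangGrad p k) (y i)
    have h1 : |a| ≤ |b| + |a - b| := by
      have := abs_sub_abs_le_abs_sub a b
      linarith
    have h2 : |r i - 1| * |a| ≤ τ * (|b| + |a - b|) := by gcongr
    have h3 : τ * |a - b| ≤ 1 * |a - b| := by gcongr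
    linarith
  calc _ ≤ ∑ i, ∑ k, ε * (τ * |pEval (tangGrad p k) (y i)| +
        2 * |pEval (tangGrad p k) (z i) - pEval (tangGrad p k) (y i)|) := by
        rw [hval]
        refine (Finset.abs_sum_le_sum_abs _ _).trans (Finset.sum_le_sum fun i _ => ?_)
        exact (Finset.abs_sum_le_sum_abs _ _).trans (Finset.sum_le_sum fun k _ => hterm i k)
    _ = ε * (τ * gradSum y p + 2 * ∑ k, ∑ i,
        |pEval (tangGrad p k) (z i) - pEval (tangGrad p k) (y i)|) := by
        rw [gradSum, Finset.sum_comm (s := (Finset.univ : Finset (Fin D)))]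
        simp only [Finset.mul_sum, mul_add, Finset.sum_add_distrib]
    _ ≤ ε * (τ * gradSum y p + 2 * ∑ k, C * τ * ∑ i, |pEval (tangGrad p k) (y i)|) := by
        gcongr with k; exact hosc1 k
    _ = ε * (τ + 2 * (C * τ)) * gradSum y p := by
        rw [← Finset.mul_sum, Finset.sum_comm, gradSum]; ring
    _ ≤ ε * (τ + 2 * (C * τ)) * (2 * gradSum (fun i => sph (y i) (v i)) p) := by gcongr
    _ = _ := by
        rw [show quadC D s m * ε ^ 2 = quadC D s m * ε * ε by ring, hquad]; ring

/-- Metric regularity: an almost exact configuration is close to an exact one. -/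
lemma exists_exact {s m : ℕ} (hm : 0 < m) (hD : 0 < D)
    {W : Submodule ℝ (MvPolynomial (Fin D) ℝ)} (hW : ∀ p ∈ W, p.totalDegree < m)
    (I : MvPolynomial (Fin D) ℝ →ₗ[ℝ] ℝ) {ε₁ : ℝ} (hε₁ : 0 ≤ ε₁)
    (hε₁2 : quadC D s m * ε₁ ≤ 1 / 2) {y₀ : ι → EuclideanSpace ℝ (Fin D)}
    (hy₀ : ∀ i, ‖y₀ i‖ = 1) (hE : ∀ p ∈ W, |defect I y₀ p| ≤ ε₁ * gradSum y₀ p)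
    (hreg : ∀ y : ι → EuclideanSpace ℝ (Fin D), (∀ i, ‖y i‖ = 1) →
      (∀ i, ‖y i - y₀ i‖ ≤ 4 * D * ε₁) → RegConf s (etaC s / m) y) :
    ∃ y : ι → EuclideanSpace ℝ (Fin D), (∀ i, ‖y i‖ = 1) ∧
      (∀ i, ‖y i - y₀ i‖ ≤ 4 * D * ε₁) ∧ ∀ p ∈ W, defect I y p = 0 := by
  set K : Set ((ι → EuclideanSpace ℝ (Fin D)) × ℝ) :=
    {q | (∀ i, ‖q.1 i‖ = 1) ∧ (0 ≤ q.2 ∧ q.2 ≤ ε₁) ∧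
      (∀ i, ‖q.1 i - y₀ i‖ ≤ 4 * D * (ε₁ - q.2)) ∧
      ∀ p ∈ W, |defect I q.1 p| ≤ q.2 * gradSum q.1 p} with hK
  have hKc : IsClosed K := by
    have hd : ∀ p, Continuous fun q : (ι → EuclideanSpace ℝ (Fin D)) × ℝ => defect I q.1 p := by
      intro p; unfold defect; fun_prop
    have hg : ∀ p, Continuous fun q : (ι → EuclideanSpace ℝ (Fin D)) × ℝ => gradSum q.1 p := by
      intro p; unfold gradSum; fun_prop
    simp only [hK, ofPred_and, ofPred_forall]
    refine ((isClosed_iInter fun i => isClosed_eq (by fun_prop) (by fun_prop))).inter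
      (((isClosed_le (by fun_prop) (by fun_prop)).inter (isClosed_le (by fun_prop)
        (by fun_prop))).inter
      ((isClosed_iInter fun i => isClosed_le (by fun_prop) (by fun_prop)).inter ?_))
    exact isClosed_iInter fun p => isClosed_iInter fun _ =>
      isClosed_le (hd p).abs (continuous_snd.mul (hg p))
  have hKb : K ⊆ Metric.closedBall 0 1 ×ˢ Icc 0 ε₁ := by
    rintro ⟨q, ε⟩ ⟨h1, h2, -, -⟩
    refine ⟨?_, h2⟩
    rw [mem_closedBall_zero_iff, pi_norm_le_iff_of_nonneg zero_le_one]
    exact fun i => (h1 i).le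
  have hKcomp : IsCompact K :=
    ((isCompact_closedBall _ _).prod isCompact_Icc).of_isClosed_subset hKc hKb
  obtain ⟨⟨y, ε⟩, ⟨hy1, ⟨hε0, hε1⟩, hy2, hy3⟩, hmin⟩ := hKcomp.exists_isMinOn
    ⟨(y₀, ε₁), hy₀, ⟨hε₁, le_rfl⟩, by simp, hE⟩ continuous_snd.continuousOn
  simp only at hy1 hε0 hε1 hy2 hy3
  have hq := quadC_nonneg D s m
  have hclose : ∀ i, ‖y i - y₀ i‖ ≤ 4 * D * ε₁ := fun i => (hy2 i).trans (by gcongr; linarith)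
  refine ⟨y, hy1, hclose, fun p hp => ?_⟩
  rcases eq_or_lt_of_le hε0 with h0 | h0
  · have := hy3 p hp
    rw [← h0, zero_mul] at this
    exact abs_eq_zero.1 (le_antisymm this (abs_nonneg _))
  exfalso
  have hr := hreg y hy1 hclose
  obtain ⟨v, hv1, hv2⟩ := exists_defect_coeff W I y hε0 hy3
  have hqε : quadC D s m * ε ≤ 1 / 2 := le_trans (by gcongr) hε₁2
  have hvn : ∀ i, ‖v i‖ ≤ D * ε := fun i => norm_le_of_abs_le (hv1 i)
  have hvn2 : ∀ i, ‖v i‖ ≤ 1 / 2 := by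
    intro i
    refine (hvn i).trans (le_trans ?_ hqε)
    have hm1 : (1 : ℝ) ≤ m := by exact_mod_cast hm
    have := oscC_pos s
    have h1 : (D : ℝ) * 1 ≤ D * (4 * m * (1 + 2 * oscC s)) := by
      gcongr; nlinarith
    calc (D : ℝ) * ε = D * 1 * ε := by ring
      _ ≤ D * (4 * m * (1 + 2 * oscC s)) * ε := by gcongr
      _ = _ := by rw [quadC]; ring
  have hmem : ((fun i => sph (y i) (v i)), ε / 2) ∈ K := by
    refine ⟨fun i => norm_sph (hy1 i) (hvn2 i), ⟨by positivity, by simp only; linarith⟩,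
      fun i => ?_, fun p hp => ?_⟩
    · have h1 := norm_sub_le_norm_sub_add_norm_sub (sph (y i) (v i)) (y i) (y₀ i)
      have h2 := norm_sph_sub_le (hy1 i) (hvn2 i)
      have h3 := hvn i
      have h4 := hy2 i
      simp only
      linarith
    · refine (hr.abs_defect_sph_le hm hD (hW p hp) I hε0 hqε hv1 (hv2 p hp)).trans ?_
      have := gradSum_nonneg (fun i => sph (y i) (v i)) p
      simp only
      gcongr
      nlinarith
  have := hmin hmem
  simp only [mem_ofPred_eq] at this
  linarith

end

section

variable {D : ℕ}

/-- A partition of unity into pieces of equal mass, each localized near a point of the sphere. -/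
structure IsEqPartition (μ : Measure (EuclideanSpace ℝ (Fin D))) (h : ℝ) {N : ℕ}
    (x : Fin N → EuclideanSpace ℝ (Fin D)) (ψ : Fin N → EuclideanSpace ℝ (Fin D) → ℝ) : Prop where
  norm_eq : ∀ i, ‖x i‖ = 1
  meas : ∀ i, Measurable (ψ i)
  nonneg : ∀ i z, 0 ≤ ψ i z
  sum_eq : ∀ z, ∑ i, ψ i z = 1
  int_eq : ∀ i, ∫ z, ψ i z ∂μ = 1 / N
  near : ∀ i z, ‖z‖ = 1 → ψ i z ≠ 0 → ‖z - x i‖ ≤ h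

section

variable {μ : Measure (EuclideanSpace ℝ (Fin D))} {h : ℝ} {N : ℕ}
  {x : Fin N → EuclideanSpace ℝ (Fin D)} {ψ : Fin N → EuclideanSpace ℝ (Fin D) → ℝ}

lemma IsEqPartition.le_one (H : IsEqPartition μ h x ψ) (i : Fin N)
    (z : EuclideanSpace ℝ (Fin D)) : ψ i z ≤ 1 := by
  rw [← H.sum_eq z]
  exact Finset.single_le_sum (f := fun i => ψ i z) (fun i _ => H.nonneg i z) (Finset.mem_univ i)

variable [IsProbabilityMeasure μ]

lemma IsEqPartition.integrable (H : IsEqPartition μ h x ψ) (i : Fin N) : Integrable (ψ i) μ := by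
  refine Integrable.of_bound (H.meas i).aestronglyMeasurable 1 (ae_of_all _ fun z => ?_)
  rw [Real.norm_of_nonneg (H.nonneg i z)]
  exact H.le_one i z

lemma IsEqPartition.real_eq_sum (H : IsEqPartition μ h x ψ) (A : Set (EuclideanSpace ℝ (Fin D))) :
    μ.real A = ∑ i, ∫ z in A, ψ i z ∂μ := by
  rw [← integral_finsetSum _ fun i _ => (H.integrable i).integrableOn]
  simp [H.sum_eq]

lemma IsEqPartition.real_le_cnt (H : IsEqPartition μ h x ψ) (hμ : ∀ᵐ z ∂μ, ‖z‖ = 1)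
    {y : Fin N → EuclideanSpace ℝ (Fin D)} {η : ℝ} (hy : ∀ i, ‖y i - x i‖ ≤ η)
    (z : EuclideanSpace ℝ (Fin D)) {ρ ρ' : ℝ} (hρ : ρ + h + η ≤ ρ') :
    μ.real (Metric.closedBall z ρ) ≤ 1 / N * cnt y z ρ' := by
  rw [H.real_eq_sum, cnt, Finset.mul_sum]
  refine Finset.sum_le_sum fun i _ => ?_
  split_ifs with hi
  · rw [mul_one, ← H.int_eq i]
    exact setIntegral_le_integral (H.integrable i) (ae_of_all _ (H.nonneg i))
  · rw [mul_zero]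
    refine (integral_eq_zero_of_ae ?_).le
    rw [Filter.EventuallyEq, ae_restrict_iff' Metric.isClosed_closedBall.measurableSet]
    filter_upwards [hμ] with u hu hus
    by_contra hne
    apply hi
    have h1 := H.near i u hu hne
    rw [mem_closedBall_iff_norm] at hus
    have h2 : y i - z = (y i - x i) + ((x i - u) + (u - z)) := by abel
    rw [h2]
    have h3 := norm_add_le (y i - x i) ((x i - u) + (u - z))
    have h4 := norm_add_le (x i - u) (u - z)
    rw [norm_sub_rev (x i) u] at h4
    linarith [hy i]

lemma IsEqPartition.cnt_le_real (H : IsEqPartition μ h x ψ) (hμ : ∀ᵐ z ∂μ, ‖z‖ = 1)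
    {y : Fin N → EuclideanSpace ℝ (Fin D)} {η : ℝ} (hy : ∀ i, ‖y i - x i‖ ≤ η)
    (z : EuclideanSpace ℝ (Fin D)) {ρ ρ' : ℝ} (hρ : ρ + h + η ≤ ρ') :
    1 / N * cnt y z ρ ≤ μ.real (Metric.closedBall z ρ') := by
  rw [H.real_eq_sum, cnt, Finset.mul_sum]
  refine Finset.sum_le_sum fun i _ => ?_
  split_ifs with hi
  · rw [mul_one, ← H.int_eq i]
    refine (setIntegral_eq_integral_of_ae_compl_eq_zero ?_).ge
    filter_upwards [hμ] with u hu hus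
    by_contra hne
    apply hus
    have h1 := H.near i u hu hne
    rw [mem_closedBall_iff_norm]
    have h2 : u - z = (u - x i) + ((x i - y i) + (y i - z)) := by abel
    rw [h2]
    have h3 := norm_add_le (u - x i) ((x i - y i) + (y i - z))
    have h4 := norm_add_le (x i - y i) (y i - z)
    rw [norm_sub_rev (x i) (y i)] at h4
    linarith [hy i]
  · rw [mul_zero]
    exact integral_nonneg (H.nonneg i)

lemma IsEqPartition.regConf (H : IsEqPartition μ h x ψ) (hN : 0 < N) (hμ : ∀ᵐ z ∂μ, ‖z‖ = 1)
    {t : ℕ} (hdbl : ∀ z : EuclideanSpace ℝ (Fin D), ‖z‖ = 1 → ∀ r, 0 < r →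
      μ.real (Metric.closedBall z (2 * r)) ≤ 2 ^ t * μ.real (Metric.closedBall z r))
    {y : Fin N → EuclideanSpace ℝ (Fin D)} (hy1 : ∀ i, ‖y i‖ = 1) {η r₀ : ℝ} (hr₀ : 0 < r₀)
    (hη : h + η ≤ r₀ / 2) (hy : ∀ i, ‖y i - x i‖ ≤ η) : RegConf (3 * t) r₀ y := by
  refine ⟨hy1, fun z hz r hr => ?_⟩
  have hr0 : 0 < r := hr₀.trans_le hr
  have hN0 : (0 : ℝ) < 1 / N := by positivity
  have h1 : 1 / N * cnt y z (2 * r) ≤ μ.real (Metric.closedBall z (2 * (2 * (2 * (r / 2))))) :=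
    H.cnt_le_real hμ hy z (by linarith)
  have h2 : μ.real (Metric.closedBall z (r / 2)) ≤ 1 / N * cnt y z r :=
    H.real_le_cnt hμ hy z (by linarith)
  have h3 := hdbl z hz (r / 2) (by positivity)
  have h4 := hdbl z hz (2 * (r / 2)) (by positivity)
  have h5 := hdbl z hz (2 * (2 * (r / 2))) (by positivity)
  refine le_of_mul_le_mul_left ?_ hN0
  calc _ ≤ (2 : ℝ) ^ t * (2 ^ t * (2 ^ t * μ.real (Metric.closedBall z (r / 2)))) := by
        refine (h1.trans h5).trans ?_
        gcongr
        refine h4.trans ?_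
        gcongr
    _ ≤ (2 : ℝ) ^ t * (2 ^ t * (2 ^ t * (1 / N * cnt y z r))) := by gcongr
    _ = _ := by rw [pow_mul' 2 3 t]; ring

end

lemma integrable_pEval {μ : Measure (EuclideanSpace ℝ (Fin D))} [IsFiniteMeasure μ]
    (hμ : ∀ᵐ z ∂μ, ‖z‖ = 1) (p : MvPolynomial (Fin D) ℝ) : Integrable (fun z => pEval p z) μ := by
  obtain ⟨C, hC⟩ := (isCompact_sphere (0 : EuclideanSpace ℝ (Fin D)) 1).exists_bound_of_continuousOn
    (continuous_pEval p).continuousOn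
  refine Integrable.of_bound (continuous_pEval p).aestronglyMeasurable C ?_
  filter_upwards [hμ] with z hz
  exact hC z (by simpa using hz)

/-- The functional `p ↦ N ∫ p dμ`. -/
def intL (μ : Measure (EuclideanSpace ℝ (Fin D))) [IsFiniteMeasure μ] (hμ : ∀ᵐ z ∂μ, ‖z‖ = 1)
    (N : ℕ) : MvPolynomial (Fin D) ℝ →ₗ[ℝ] ℝ where
  toFun p := N * ∫ z, pEval p z ∂μ
  map_add' p q := by
    simp only [pEval_add]
    rw [integral_add (integrable_pEval hμ p) (integrable_pEval hμ q), mul_add]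
  map_smul' c p := by
    simp only [pEval_smul, integral_const_mul, RingHom.id_apply, smul_eq_mul]; ring

lemma IsEqPartition.abs_defect_le {μ : Measure (EuclideanSpace ℝ (Fin D))}
    [IsProbabilityMeasure μ] {h : ℝ} {N : ℕ} {x : Fin N → EuclideanSpace ℝ (Fin D)}
    {ψ : Fin N → EuclideanSpace ℝ (Fin D) → ℝ} (H : IsEqPartition μ h x ψ) (hN : 0 < N)
    (hh : 0 ≤ h) (hμ : ∀ᵐ z ∂μ, ‖z‖ = 1) (p : MvPolynomial (Fin D) ℝ) :
    ∃ z : Fin N → EuclideanSpace ℝ (Fin D), (∀ i, ‖z i‖ = 1) ∧ (∀ i, ‖z i - x i‖ ≤ h) ∧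
      |defect (intL μ hμ N) x p| ≤ ∑ i, |pEval p (z i) - pEval p (x i)| := by
  have hN0 : (0 : ℝ) < N := by exact_mod_cast hN
  have hmax : ∀ i, ∃ z : EuclideanSpace ℝ (Fin D), (‖z‖ = 1 ∧ ‖z - x i‖ ≤ h) ∧
      ∀ u : EuclideanSpace ℝ (Fin D), ‖u‖ = 1 → ‖u - x i‖ ≤ h →
        |pEval p u - pEval p (x i)| ≤ |pEval p z - pEval p (x i)| := by
    intro i
    have hc : IsCompact (Metric.sphere (0 : EuclideanSpace ℝ (Fin D)) 1 ∩
        Metric.closedBall (x i) h) := (isCompact_sphere _ _).inter_right Metric.isClosed_closedBall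
    have hf : Continuous fun u => |pEval p u - pEval p (x i)| := by fun_prop
    obtain ⟨z, hz, hzm⟩ := hc.exists_isMaxOn ⟨x i, by simp [H.norm_eq], by simpa using hh⟩
      hf.continuousOn
    refine ⟨z, ⟨by simpa using hz.1, mem_closedBall_iff_norm.1 hz.2⟩,
      fun u hu hux => hzm ⟨by simpa using hu, mem_closedBall_iff_norm.2 hux⟩⟩
  choose z hz hzm using hmax
  refine ⟨z, fun i => (hz i).1, fun i => (hz i).2, ?_⟩
  have hpi : ∀ i, Integrable (fun u => ψ i u * pEval p u) μ := fun i =>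
    (integrable_pEval hμ p).bdd_mul (H.meas i).aestronglyMeasurable (c := 1)
      (ae_of_all _ fun u => by rw [Real.norm_of_nonneg (H.nonneg i u)]; exact H.le_one i u)
  have h1 : ∫ u, pEval p u ∂μ = ∑ i, ∫ u, ψ i u * pEval p u ∂μ := by
    rw [← integral_finsetSum _ fun i _ => hpi i]
    simp only [← Finset.sum_mul, H.sum_eq, one_mul]
  have h2 : defect (intL μ hμ N) x p =
      ∑ i, N * ∫ u, ψ i u * (pEval p (x i) - pEval p u) ∂μ := by
    change ∑ i, pEval p (x i) - N * ∫ u, pEval p u ∂μ = _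
    rw [h1, Finset.mul_sum, ← Finset.sum_sub_distrib]
    refine Finset.sum_congr rfl fun i _ => ?_
    simp only [mul_sub]
    rw [integral_sub ((H.integrable i).mul_const _) (hpi i), integral_mul_const, H.int_eq]
    field_simp
  rw [h2]
  refine (Finset.abs_sum_le_sum_abs _ _).trans (Finset.sum_le_sum fun i _ => ?_)
  rw [abs_mul, abs_of_pos hN0, ← Real.norm_eq_abs]
  have h3 : ‖∫ u, ψ i u * (pEval p (x i) - pEval p u) ∂μ‖ ≤
      ∫ u, ψ i u * |pEval p (z i) - pEval p (x i)| ∂μ := by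
    refine norm_integral_le_of_norm_le ((H.integrable i).mul_const _) ?_
    filter_upwards [hμ] with u hu
    rw [norm_mul, Real.norm_of_nonneg (H.nonneg i u), Real.norm_eq_abs, abs_sub_comm]
    by_cases h0 : ψ i u = 0
    · simp [h0]
    · exact mul_le_mul_of_nonneg_left (hzm i u hu (H.near i u hu h0)) (H.nonneg i u)
  rw [integral_mul_const, H.int_eq] at h3
  calc _ ≤ N * (1 / N * |pEval p (z i) - pEval p (x i)|) := by gcongr
    _ = _ := by field_simp

/-- The constant in the first order estimate of the initial defect. -/
def initC (s : ℕ) : ℝ := 4 * (1 + oscC s)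

lemma initC_pos (s : ℕ) : 0 < initC s := by
  have := oscC_pos s
  simp only [initC]; positivity

lemma RegConf.sum_abs_sub_le_gradSum {ι : Type*} [Fintype ι] {s m : ℕ} (hm : 0 < m)
    {x z : ι → EuclideanSpace ℝ (Fin D)} (hx : RegConf s (etaC s / m) x)
    {p : MvPolynomial (Fin D) ℝ} (hp : p.totalDegree < m) {h : ℝ} (hh0 : 0 ≤ h)
    (hh : 2 * m * h ≤ 1) (hz : ∀ i, ‖z i‖ = 1) (hzx : ∀ i, ‖z i - x i‖ ≤ h) :
    ∑ i, |pEval p (z i) - pEval p (x i)| ≤ initC s * h * gradSum x p := by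
  have hm1 : (1 : ℝ) ≤ m := by exact_mod_cast hm
  have hC := oscC_pos s
  have hh2 : h ≤ 1 / 2 := by nlinarith
  choose z' r hz' hzy hr heq using fun i =>
    exists_pEval_sph_sub_eq p (hx.1 i) ((hzx i).trans hh2)
  have hsph : ∀ i, sph (x i) (z i - x i) = z i := by
    intro i; simp [sph, hz i]
  have hosc : ∀ k, ∑ i, |pEval (tangGrad p k) (z' i) - pEval (tangGrad p k) (x i)|
      ≤ oscC s * 1 * ∑ i, |pEval (tangGrad p k) (x i)| := fun k =>
    hx.sum_abs_sub_le hm ((totalDegree_tangGrad_le p k).trans hp) le_rfl hz' hx.1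
      (fun i => le_trans (by
        calc (m : ℝ) * ‖z' i - x i‖ ≤ m * (2 * h) := by
              gcongr; exact (hzy i).trans (by linarith [hzx i])
          _ = 2 * m * h := by ring) hh) (fun i => by simp)
  have hterm : ∀ i, |pEval p (z i) - pEval p (x i)| ≤ ∑ k, 2 * h *
      (|pEval (tangGrad p k) (x i)| +
        |pEval (tangGrad p k) (z' i) - pEval (tangGrad p k) (x i)|) := by
    intro i
    have h1 := heq i
    rw [hsph] at h1
    rw [h1, Finset.mul_sum]
    refine (Finset.abs_sum_le_sum_abs _ _).trans (Finset.sum_le_sum fun k _ => ?_)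
    rw [abs_mul, abs_mul, ← mul_assoc]
    have h2 : |r i| ≤ 2 := by
      have := abs_le.1 ((hr i).trans (by linarith [hzx i] : 2 * ‖z i - x i‖ ≤ 1))
      exact abs_le.2 ⟨by linarith, by linarith⟩
    have h3 : |(z i - x i) k| ≤ h := (PiLp.norm_apply_le (z i - x i) k).trans (hzx i)
    have h4 := abs_sub_abs_le_abs_sub (pEval (tangGrad p k) (z' i)) (pEval (tangGrad p k) (x i))
    gcongr
    linarith
  have e1 : ∀ f : ι → Fin D → ℝ, ∑ i, ∑ k, f i k = ∑ k, ∑ i, f i k := fun f => Finset.sum_comm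
  calc _ ≤ ∑ i, ∑ k, 2 * h * (|pEval (tangGrad p k) (x i)| +
        |pEval (tangGrad p k) (z' i) - pEval (tangGrad p k) (x i)|) :=
        Finset.sum_le_sum fun i _ => hterm i
    _ = 2 * h * (gradSum x p +
        ∑ k, ∑ i, |pEval (tangGrad p k) (z' i) - pEval (tangGrad p k) (x i)|) := by
        rw [← e1, gradSum]
        simp only [Finset.mul_sum, mul_add, Finset.sum_add_distrib]
    _ ≤ 2 * h * (gradSum x p + ∑ k, oscC s * 1 * ∑ i, |pEval (tangGrad p k) (x i)|) := by
        gcongr with k; exact hosc k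
    _ = 2 * (1 + oscC s) * h * gradSum x p := by
        rw [← Finset.mul_sum, ← e1, gradSum]; ring
    _ ≤ _ := by
        have := gradSum_nonneg x p
        rw [initC]
        gcongr; norm_num

/-- The relative mesh size which makes Newton's method converge. -/
def meshC (D s : ℕ) : ℝ :=
  etaC s / (16 * (D + 1) * (1 + 2 * oscC s) * (1 + initC s))

lemma meshC_pos (D s : ℕ) : 0 < meshC D s := by
  have := oscC_pos s
  have := initC_pos s
  have := etaC_pos s
  simp only [meshC]; positivity

/-- Existence of equal weight quadrature on the sphere, with nodes all of whose small
perturbations are regular. -/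
lemma exists_exact_of_partition (hD : 0 < D) {μ : Measure (EuclideanSpace ℝ (Fin D))}
    [IsProbabilityMeasure μ] {h : ℝ} {N : ℕ} {x : Fin N → EuclideanSpace ℝ (Fin D)}
    {ψ : Fin N → EuclideanSpace ℝ (Fin D) → ℝ} (H : IsEqPartition μ h x ψ) (hN : 0 < N)
    (hμ : ∀ᵐ z ∂μ, ‖z‖ = 1) {t : ℕ} (hdbl : ∀ z : EuclideanSpace ℝ (Fin D), ‖z‖ = 1 →
      ∀ r, 0 < r → μ.real (Metric.closedBall z (2 * r)) ≤ 2 ^ t * μ.real (Metric.closedBall z r))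
    {m : ℕ} (hm : 0 < m) (hh : 0 ≤ h) (hhm : m * h ≤ meshC D (3 * t))
    {W : Submodule ℝ (MvPolynomial (Fin D) ℝ)} (hW : ∀ p ∈ W, p.totalDegree < m) :
    ∃ y : Fin N → EuclideanSpace ℝ (Fin D), (∀ i, ‖y i‖ = 1) ∧
      (∀ p ∈ W, defect (intL μ hμ N) y p = 0) ∧ ∃ κ : ℝ, 0 < κ ∧
      ∀ y' : Fin N → EuclideanSpace ℝ (Fin D), (∀ i, ‖y' i‖ = 1) → (∀ i, ‖y' i - y i‖ ≤ κ) →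
        RegConf (3 * t) (etaC (3 * t) / m) y' := by
  have hO := oscC_pos (3 * t)
  have hI := initC_pos (3 * t)
  have hE := etaC_pos (3 * t)
  have hE1 := etaC_le_one (3 * t)
  have hm1 : (1 : ℝ) ≤ m := by exact_mod_cast hm
  set s := 3 * t
  have hr₀ : 0 < etaC s / m := by positivity
  have hkey : 16 * (D + 1) * (1 + 2 * oscC s) * (1 + initC s) * (m * h) ≤ etaC s := by
    rw [meshC, le_div_iff₀ (by positivity)] at hhm
    linarith
  have hD0 : (0 : ℝ) ≤ D := by positivity
  have hmh : 0 ≤ m * h := by positivity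
  have hb1 : 16 * ((m : ℝ) * h) ≤ etaC s := by
    refine le_trans ?_ hkey
    refine mul_le_mul_of_nonneg_right ?_ hmh
    have h1 : (1 : ℝ) ≤ D + 1 := by linarith
    have h2 : 1 ≤ 1 + 2 * oscC s := by linarith
    have h3 : 1 ≤ 1 + initC s := by linarith
    have h4 : 1 ≤ (D + 1) * (1 + 2 * oscC s) := one_le_mul_of_one_le_of_one_le h1 h2
    have h5 := one_le_mul_of_one_le_of_one_le h4 h3
    linarith
  have hb2 : 16 * (D * initC s) * ((m : ℝ) * h) ≤ etaC s := by
    refine le_trans ?_ hkey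
    refine mul_le_mul_of_nonneg_right ?_ hmh
    rw [mul_assoc 16, mul_assoc 16]
    gcongr
    · have h2 : 1 ≤ 1 + 2 * oscC s := by linarith
      nlinarith [mul_nonneg hD0 hO.le]
    · linarith
  have hb3 : quadC D s m * (initC s * h) ≤ 1 / 2 := by
    have : 8 * D * (1 + 2 * oscC s) * initC s * (m * h) ≤ etaC s := by
      refine le_trans ?_ hkey
      gcongr <;> linarith
    calc quadC D s m * (initC s * h)
        = (8 * D * (1 + 2 * oscC s) * initC s * (m * h)) / 2 := by rw [quadC]; ring
      _ ≤ 1 / 2 := by linarith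
  have hreg : ∀ y : Fin N → EuclideanSpace ℝ (Fin D), (∀ i, ‖y i‖ = 1) →
      (∀ i, ‖y i - x i‖ ≤ 3 * etaC s / 8 / m) → RegConf s (etaC s / m) y := by
    intro y hy1 hy
    refine H.regConf hN hμ hdbl hy1 hr₀ ?_ hy
    have : h ≤ etaC s / 16 / m := by rw [le_div_iff₀ (by positivity)]; linarith
    calc h + 3 * etaC s / 8 / m ≤ etaC s / 16 / m + 3 * etaC s / 8 / m := by gcongr
      _ = (7 / 16 * etaC s) / m := by ring
      _ ≤ (1 / 2 * etaC s) / m := div_le_div_of_nonneg_right (by linarith) (by positivity)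
      _ = _ := by ring
  have hsmall : 4 * D * (initC s * h) ≤ etaC s / 4 / m := by
    rw [le_div_iff₀ (by positivity)]; linarith
  have hx : RegConf s (etaC s / m) x :=
    hreg x H.norm_eq fun i => by simp only [sub_self, norm_zero]; positivity
  obtain ⟨y, hy1, hy2, hy3⟩ := exists_exact hm hD hW (intL μ hμ N) (ε₁ := initC s * h)
    (by positivity) hb3 H.norm_eq (fun p hp => by
      obtain ⟨z, hz1, hz2, hz3⟩ := H.abs_defect_le hN hh hμ p
      refine hz3.trans (hx.sum_abs_sub_le_gradSum hm (hW p hp) hh ?_ hz1 hz2)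
      linarith) (fun y hy1 hy => hreg y hy1 fun i => (hy i).trans (hsmall.trans
        (div_le_div_of_nonneg_right (by linarith) (by positivity))))
  refine ⟨y, hy1, hy3, etaC s / 8 / m, by positivity, fun y' hy'1 hy' => hreg y' hy'1 fun i => ?_⟩
  have h1 := norm_sub_le_norm_sub_add_norm_sub (y' i) (y i) (x i)
  calc _ ≤ etaC s / 8 / m + etaC s / 4 / m := by linarith [hy' i, (hy2 i).trans hsmall]
    _ = _ := by ring

end

section

open Filter Topology

lemma eventually_ne_zero_of_hasDerivAt {F : ℝ → ℝ} {a B : ℝ} (hF : HasDerivAt F a 0)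
    (h0 : F 0 = 0) (ha : a ≠ 0) : ∀ᶠ t in 𝓝[>] (0 : ℝ), ∀ b, |b - F t| ≤ B * t ^ 2 → b ≠ 0 := by
  have h1 : Tendsto (slope F 0) (𝓝[>] 0) (𝓝 a) :=
    hF.tendsto_slope.mono_left (nhdsWithin_mono _ fun x hx => ne_of_gt hx)
  have h2 : Tendsto (fun t : ℝ => |slope F 0 t| - B * t) (𝓝[>] 0) (𝓝 (|a| - B * 0)) :=
    h1.abs.sub ((tendsto_id.mono_left nhdsWithin_le_nhds).const_mul B)
  filter_upwards [h2.eventually (lt_mem_nhds (by simpa using ha : (0 : ℝ) < |a| - B * 0)),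
    self_mem_nhdsWithin] with t ht ht0 b hb hb0
  have ht0' : (0 : ℝ) < t := ht0
  rw [slope_def_field, h0, sub_zero, sub_zero, abs_div, abs_of_pos ht0'] at ht
  rw [hb0, zero_sub, abs_neg] at hb
  have h3 : |F t| / t ≤ B * t := by rw [div_le_iff₀ ht0']; nlinarith
  linarith

lemma hasDerivAt_sph_apply {D : ℕ} {x u : EuclideanSpace ℝ (Fin D)} (hx : ‖x‖ = 1) (k : Fin D) :
    HasDerivAt (fun t : ℝ => sph x (t • u) k) (u k - x k * inner ℝ x u) 0 := by
  have h0 : x + (0 : ℝ) • u ≠ 0 := by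
    rw [zero_smul, add_zero, ← norm_pos_iff, hx]; exact one_pos
  have h := hasDerivAt_pEval_sph (MvPolynomial.X k) h0
  simp only [zero_smul, add_zero, hx, inv_one, one_mul, pEval_tangGrad, pEval_X] at h
  have hs : sph x 0 = x := by simp [sph, hx]
  rw [hs] at h
  convert h using 1
  have e1 : ∀ l, pEval (MvPolynomial.pderiv l (MvPolynomial.X k : MvPolynomial (Fin D) ℝ)) x =
      if l = k then 1 else 0 := by
    intro l
    rw [MvPolynomial.pderiv_X]
    by_cases hlk : l = k
    · subst hlk; simp [pEval]
    · simp [pEval, hlk, Ne.symm hlk]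
  simp only [e1, mul_sub, Finset.sum_sub_distrib, mul_ite, mul_one, mul_zero,
    Finset.sum_ite_eq', Finset.mem_univ, if_true, PiLp.inner_apply, RCLike.inner_apply,
    conj_trivial, Finset.mul_sum]
  congr 1
  exact Finset.sum_congr rfl fun l _ => by ring

section

variable {D : ℕ} {ι : Type*} [Fintype ι]

/-- Perturbing an exact configuration in a direction annihilating the first order term. -/
lemma exists_exact_perturb {s m : ℕ} (hm : 0 < m) (hD : 0 < D)
    {W : Submodule ℝ (MvPolynomial (Fin D) ℝ)} (hW : ∀ p ∈ W, p.totalDegree < m)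
    (I : MvPolynomial (Fin D) ℝ →ₗ[ℝ] ℝ) {y : ι → EuclideanSpace ℝ (Fin D)}
    (hy : ∀ i, ‖y i‖ = 1) (hE : ∀ p ∈ W, defect I y p = 0) {κ : ℝ} (hκ : 0 < κ)
    (hreg : ∀ y' : ι → EuclideanSpace ℝ (Fin D), (∀ i, ‖y' i‖ = 1) →
      (∀ i, ‖y' i - y i‖ ≤ κ) → RegConf s (etaC s / m) y')
    {u : ι → EuclideanSpace ℝ (Fin D)} (hu : ∀ i k, |u i k| ≤ 1)
    (hu0 : ∀ p ∈ W, ∑ i, ∑ k, u i k * pEval (tangGrad p k) (y i) = 0) :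
    ∃ A : ℝ, ∀ᶠ t in 𝓝[>] (0 : ℝ), ∃ y' : ι → EuclideanSpace ℝ (Fin D), (∀ i, ‖y' i‖ = 1) ∧
      (∀ p ∈ W, defect I y' p = 0) ∧ (∀ i, ‖y' i - y i‖ ≤ κ) ∧
      ∀ i, ‖y' i - sph (y i) (t • u i)‖ ≤ A * t ^ 2 := by
  have hq := quadC_nonneg D s m
  have hDp : (0 : ℝ) < D := by exact_mod_cast hD
  refine ⟨4 * D * quadC D s m, ?_⟩
  have lim : ∀ f : ℝ → ℝ, Continuous f → f 0 = 0 → ∀ c > 0, ∀ᶠ t in 𝓝[>] (0 : ℝ), f t < c := by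
    intro f hf h0 c hc
    have : Tendsto f (𝓝[>] 0) (𝓝 (f 0)) := (hf.tendsto 0).mono_left nhdsWithin_le_nhds
    rw [h0] at this
    exact this.eventually (gt_mem_nhds hc)
  filter_upwards [lim (fun t => quadC D s m * t) (by fun_prop) (by simp) (1 / 2) (by norm_num),
    lim (fun t => quadC D s m * (quadC D s m * t ^ 2)) (by fun_prop) (by simp) (1 / 2)
      (by norm_num),
    lim (fun t => (D : ℝ) * t) (by fun_prop) (by simp) (1 / 2) (by norm_num),
    lim (fun t => 2 * (D * t) + 4 * D * (quadC D s m * t ^ 2)) (by fun_prop) (by simp) κ hκ,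
    self_mem_nhdsWithin] with t h1 h2 h3 h4 ht
  have ht0 : 0 < t := ht
  have hv : ∀ i k, |(t • u i) k| ≤ t := by
    intro i k
    rw [PiLp.smul_apply, smul_eq_mul, abs_mul, abs_of_pos ht0]
    exact mul_le_of_le_one_right ht0.le (hu i k)
  have hvn : ∀ i, ‖t • u i‖ ≤ D * t := fun i => norm_le_of_abs_le (hv i)
  have hvn2 : ∀ i, ‖t • u i‖ ≤ 1 / 2 := fun i => (hvn i).trans h3.le
  have hr := hreg y hy fun i => by simpa using hκ.le
  have hnear : ∀ y' : ι → EuclideanSpace ℝ (Fin D), (∀ i, ‖y' i - sph (y i) (t • u i)‖ ≤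
      4 * D * (quadC D s m * t ^ 2)) → ∀ i, ‖y' i - y i‖ ≤ κ := by
    intro y' h i
    have := norm_sub_le_norm_sub_add_norm_sub (y' i) (sph (y i) (t • u i)) (y i)
    have := norm_sph_sub_le (hy i) (hvn2 i)
    linarith [h i, hvn i]
  obtain ⟨y', hy1, hy2, hy3⟩ := exists_exact (ι := ι) (s := s) hm hD hW I
    (ε₁ := quadC D s m * t ^ 2) (by positivity) h2.le
    (y₀ := fun i => sph (y i) (t • u i)) (fun i => norm_sph (hy i) (hvn2 i))
    (fun p hp => hr.abs_defect_sph_le hm hD (hW p hp) I ht0.le h1.le hv (by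
      have := hu0 p hp
      simp only [PiLp.smul_apply, smul_eq_mul, mul_assoc, ← Finset.mul_sum, this]
      rw [hE p hp]; simp))
    (fun y' hy1 hy2 => hreg y' hy1 (hnear y' hy2))
  exact ⟨y', hy1, hy3, hnear y' hy2, fun i => (hy2 i).trans_eq (by ring)⟩

end

/-- The orthogonal projection forgetting the last coordinate. -/
def proj (y : EuclideanSpace ℝ (Fin (d + 1))) : EuclideanSpace ℝ (Fin d) :=
  WithLp.toLp 2 fun i => y i.castSucc

@[simp] lemma proj_apply (y : EuclideanSpace ℝ (Fin (d + 1))) (i : Fin d) :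
    proj y i = y i.castSucc := rfl

lemma norm_sq_eq_proj (y : EuclideanSpace ℝ (Fin (d + 1))) :
    ‖y‖ ^ 2 = ‖proj y‖ ^ 2 + y (Fin.last d) ^ 2 := by
  simp [EuclideanSpace.norm_sq_eq, Fin.sum_univ_castSucc]

@[fun_prop] lemma continuous_proj : Continuous (proj : EuclideanSpace ℝ (Fin (d + 1)) → _) := by
  unfold proj; fun_prop

/-- Polynomials of degree at most `n` in all variables but the last one. -/
def cylPoly (d n : ℕ) : Submodule ℝ (MvPolynomial (Fin (d + 1)) ℝ) :=
  (MvPolynomial.restrictTotalDegree (Fin d) ℝ n).map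
    (MvPolynomial.rename Fin.castSucc).toLinearMap

lemma mem_cylPoly {n : ℕ} {p : MvPolynomial (Fin (d + 1)) ℝ} : p ∈ cylPoly d n ↔
    ∃ P : MvPolynomial (Fin d) ℝ, P.totalDegree ≤ n ∧ MvPolynomial.rename Fin.castSucc P = p := by
  simp [cylPoly, MvPolynomial.mem_restrictTotalDegree]

lemma totalDegree_lt_of_mem_cylPoly {n : ℕ} {p : MvPolynomial (Fin (d + 1)) ℝ}
    (hp : p ∈ cylPoly d n) : p.totalDegree < n + 1 := by
  obtain ⟨P, hP, rfl⟩ := mem_cylPoly.1 hp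
  exact Nat.lt_succ_of_le ((MvPolynomial.totalDegree_rename_le _ _).trans hP)

lemma pEval_rename (P : MvPolynomial (Fin d) ℝ) (y : EuclideanSpace ℝ (Fin (d + 1))) :
    pEval (MvPolynomial.rename Fin.castSucc P) y = pEval P (proj y) := by
  simp only [pEval, MvPolynomial.eval_rename]; rfl

lemma pderiv_last_rename (P : MvPolynomial (Fin d) ℝ) :
    MvPolynomial.pderiv (Fin.last d) (MvPolynomial.rename Fin.castSucc P) = 0 := by
  classical
  refine MvPolynomial.pderiv_eq_zero_of_notMem_vars fun h => ?_
  obtain ⟨i, -, hi⟩ := Finset.mem_image.1 (MvPolynomial.vars_rename Fin.castSucc P h)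
  exact (Fin.castSucc_lt_last i).ne hi

lemma pEval_tangGrad_rename (P : MvPolynomial (Fin d) ℝ) (k : Fin d)
    (y : EuclideanSpace ℝ (Fin (d + 1))) :
    pEval (tangGrad (MvPolynomial.rename Fin.castSucc P) k.castSucc) y =
      pEval (tangGrad P k) (proj y) := by
  simp [pEval_tangGrad, Fin.sum_univ_castSucc, pderiv_last_rename,
    MvPolynomial.pderiv_rename (Fin.castSucc_injective d), pEval_rename]
  simp [pEval]

lemma pEval_tangGrad_last {n : ℕ} {p : MvPolynomial (Fin (d + 1)) ℝ} (hp : p ∈ cylPoly d n)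
    {y : EuclideanSpace ℝ (Fin (d + 1))} (hy : y (Fin.last d) = 0) :
    pEval (tangGrad p (Fin.last d)) y = 0 := by
  obtain ⟨P, hP, rfl⟩ := mem_cylPoly.1 hp
  rw [pEval_tangGrad, pderiv_last_rename, hy]
  simp [pEval]

lemma pEval_tangGrad_castSucc_congr {n : ℕ} {p : MvPolynomial (Fin (d + 1)) ℝ}
    (hp : p ∈ cylPoly d n) {y y' : EuclideanSpace ℝ (Fin (d + 1))} (hy : proj y = proj y')
    (k : Fin d) : pEval (tangGrad p k.castSucc) y = pEval (tangGrad p k.castSucc) y' := by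
  obtain ⟨P, hP, rfl⟩ := mem_cylPoly.1 hp
  rw [pEval_tangGrad_rename, pEval_tangGrad_rename, hy]

/-- Counts the coincidences of projections and the nodes on the equator. -/
def badness {N : ℕ} (y : Fin N → EuclideanSpace ℝ (Fin (d + 1))) : ℕ := by
  classical
  exact (Finset.univ.filter fun q : Fin N × Fin N => proj (y q.1) = proj (y q.2)).card +
    (Finset.univ.filter fun i => y i (Fin.last d) = 0).card

lemma badness_lt {N : ℕ} {y y' : Fin N → EuclideanSpace ℝ (Fin (d + 1))}
    (h1 : ∀ i j, proj (y i) ≠ proj (y j) → proj (y' i) ≠ proj (y' j))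
    (h2 : ∀ i, y i (Fin.last d) ≠ 0 → y' i (Fin.last d) ≠ 0)
    (h3 : (∃ i j, proj (y i) = proj (y j) ∧ proj (y' i) ≠ proj (y' j)) ∨
      ∃ i, y i (Fin.last d) = 0 ∧ y' i (Fin.last d) ≠ 0) : badness y' < badness y := by
  classical
  unfold badness
  have s1 : (Finset.univ.filter fun q : Fin N × Fin N => proj (y' q.1) = proj (y' q.2)) ⊆
      Finset.univ.filter fun q : Fin N × Fin N => proj (y q.1) = proj (y q.2) := by
    intro q hq
    simp only [Finset.mem_filter, Finset.mem_univ, true_and] at hq ⊢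
    by_contra h
    exact h1 _ _ h hq
  have s2 : (Finset.univ.filter fun i => y' i (Fin.last d) = 0) ⊆
      Finset.univ.filter fun i => y i (Fin.last d) = 0 := by
    intro q hq
    simp only [Finset.mem_filter, Finset.mem_univ, true_and] at hq ⊢
    by_contra h
    exact h2 _ h hq
  rcases h3 with ⟨i, j, hi, hj⟩ | ⟨i, hi, hj⟩
  · refine add_lt_add_of_lt_of_le (Finset.card_lt_card ⟨s1, fun h => ?_⟩) (Finset.card_le_card s2)
    have := @h (i, j) (by simpa using hi)
    exact hj (by simpa using this)
  · refine add_lt_add_of_le_of_lt (Finset.card_le_card s1) (Finset.card_lt_card ⟨s2, fun h => ?_⟩)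
    have := @h i (by simpa using hi)
    exact hj (by simpa using this)

lemma exists_open_cond {N : ℕ} (y : Fin N → EuclideanSpace ℝ (Fin (d + 1))) :
    ∃ δ > 0, ∀ y' : Fin N → EuclideanSpace ℝ (Fin (d + 1)), (∀ i, ‖y' i - y i‖ ≤ δ) →
      (∀ i j, proj (y i) ≠ proj (y j) → proj (y' i) ≠ proj (y' j)) ∧
      ∀ i, y i (Fin.last d) ≠ 0 → y' i (Fin.last d) ≠ 0 := by
  have h1 : ∀ᶠ y' in 𝓝 y, ∀ i j, proj (y i) ≠ proj (y j) → proj (y' i) ≠ proj (y' j) := by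
    refine eventually_all.2 fun i => eventually_all.2 fun j => ?_
    by_cases h : proj (y i) = proj (y j)
    · exact Eventually.of_forall fun y' h' => absurd h h'
    · have c1 : Continuous fun y' : Fin N → EuclideanSpace ℝ (Fin (d + 1)) => proj (y' i) := by
        fun_prop
      have c2 : Continuous fun y' : Fin N → EuclideanSpace ℝ (Fin (d + 1)) => proj (y' j) := by
        fun_prop
      filter_upwards [(isOpen_ne_fun c1 c2).mem_nhds h] with y' hy' _ using hy'
  have h2 : ∀ᶠ y' in 𝓝 y, ∀ i, y i (Fin.last d) ≠ 0 → y' i (Fin.last d) ≠ 0 := by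
    refine eventually_all.2 fun i => ?_
    by_cases h : y i (Fin.last d) = 0
    · exact Eventually.of_forall fun y' h' => absurd h h'
    · have c1 : Continuous fun y' : Fin N → EuclideanSpace ℝ (Fin (d + 1)) =>
          y' i (Fin.last d) := by fun_prop
      filter_upwards [(isOpen_ne_fun c1 continuous_const).mem_nhds h] with y' hy' _ using hy'
  obtain ⟨δ, hδ, h⟩ := Metric.eventually_nhds_iff.1 (h1.and h2)
  refine ⟨δ / 2, by positivity, fun y' hy' => h ?_⟩
  refine ((dist_pi_le_iff (by positivity)).2 fun i => ?_).trans_lt (half_lt_self hδ)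
  rw [dist_eq_norm]; exact hy' i

/-- An exact configuration, all of whose perturbations are regular, can be moved so that the
nodes have distinct projections. -/
lemma exists_exact_injective {s n N : ℕ} (hd : 0 < d)
    (I : MvPolynomial (Fin (d + 1)) ℝ →ₗ[ℝ] ℝ) {y₀ : Fin N → EuclideanSpace ℝ (Fin (d + 1))}
    (hy₀ : ∀ i, ‖y₀ i‖ = 1) (hE : ∀ p ∈ cylPoly d n, defect I y₀ p = 0) {κ : ℝ} (hκ : 0 < κ)
    (hreg : ∀ y' : Fin N → EuclideanSpace ℝ (Fin (d + 1)), (∀ i, ‖y' i‖ = 1) →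
      (∀ i, ‖y' i - y₀ i‖ ≤ κ) → RegConf s (etaC s / (n + 1 : ℕ)) y') :
    ∃ y : Fin N → EuclideanSpace ℝ (Fin (d + 1)), (∀ i, ‖y i‖ = 1) ∧
      (∀ p ∈ cylPoly d n, defect I y p = 0) ∧ Function.Injective fun i => proj (y i) := by
  set S : Set (Fin N → EuclideanSpace ℝ (Fin (d + 1))) :=
    {y | (∀ i, ‖y i‖ = 1) ∧ (∀ p ∈ cylPoly d n, defect I y p = 0) ∧ ∀ i, ‖y i - y₀ i‖ < κ}
  obtain ⟨y, ⟨hy1, hy2, hy3⟩, hmin⟩ := (measure (badness (d := d) (N := N))).wf.has_min S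
    ⟨y₀, hy₀, hE, fun i => by simpa using hκ⟩
  obtain ⟨δ, hδ, hopen⟩ := exists_open_cond y
  have hslack : ∃ σ > 0, ∀ i, ‖y i - y₀ i‖ + σ < κ := by
    have : ∀ᶠ σ in 𝓝[>] (0 : ℝ), ∀ i, ‖y i - y₀ i‖ + σ < κ := by
      refine eventually_all.2 fun i => ?_
      have : Tendsto (fun σ : ℝ => ‖y i - y₀ i‖ + σ) (𝓝[>] 0) (𝓝 (‖y i - y₀ i‖ + 0)) :=
        (tendsto_id.mono_left nhdsWithin_le_nhds).const_add _
      exact this.eventually (gt_mem_nhds (by simpa using hy3 i))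
    obtain ⟨σ, hσ, hσ0⟩ := (this.and self_mem_nhdsWithin).exists
    exact ⟨σ, hσ0, hσ⟩
  obtain ⟨σ, hσ, hσκ⟩ := hslack
  have hmove : ∀ u : Fin N → EuclideanSpace ℝ (Fin (d + 1)), (∀ i k, |u i k| ≤ 1) →
      (∀ p ∈ cylPoly d n, ∑ i, ∑ k, u i k * pEval (tangGrad p k) (y i) = 0) →
      ∃ A : ℝ, ∀ᶠ t in 𝓝[>] (0 : ℝ), ∃ y' : Fin N → EuclideanSpace ℝ (Fin (d + 1)),
        (∀ i, ‖y' i - sph (y i) (t • u i)‖ ≤ A * t ^ 2) ∧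
        ¬ ((∃ i j, proj (y i) = proj (y j) ∧ proj (y' i) ≠ proj (y' j)) ∨
          ∃ i, y i (Fin.last d) = 0 ∧ y' i (Fin.last d) ≠ 0) := by
    intro u hu hu0
    obtain ⟨A, hA⟩ := exists_exact_perturb (s := s) (Nat.succ_pos n) (Nat.succ_pos d)
      (fun p hp => totalDegree_lt_of_mem_cylPoly hp) I hy1 hy2 (κ := min σ δ) (by positivity)
      (fun y' hy' hyy' => hreg y' hy' fun i => by
        have := norm_sub_le_norm_sub_add_norm_sub (y' i) (y i) (y₀ i)
        linarith [hσκ i, (hyy' i).trans (min_le_left _ _)]) hu hu0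
    refine ⟨A, hA.mono ?_⟩
    rintro t ⟨y', h1, h2, h3, h4⟩
    refine ⟨y', h4, fun hbad => ?_⟩
    obtain ⟨ho1, ho2⟩ := hopen y' fun i => (h3 i).trans (min_le_right _ _)
    refine hmin y' ⟨h1, h2, fun i => ?_⟩ (badness_lt ho1 ho2 hbad)
    have := norm_sub_le_norm_sub_add_norm_sub (y' i) (y i) (y₀ i)
    linarith [hσκ i, (h3 i).trans (min_le_left _ _)]
  have hne : ∀ i, y i (Fin.last d) ≠ 0 := by
    intro i hi
    obtain ⟨A, hA⟩ := hmove (fun j => if j = i then EuclideanSpace.single (Fin.last d) 1 else 0)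
      (fun j k => by
        dsimp only
        split_ifs
        · rw [PiLp.single_apply]; split_ifs <;> simp
        · simp)
      (fun p hp => by
        rw [Finset.sum_eq_single i]
        · simp only [if_true, PiLp.single_apply, ite_mul, one_mul, zero_mul,
            Finset.sum_ite_eq', Finset.mem_univ]
          exact pEval_tangGrad_last hp hi
        · intro j _ hj; simp [hj]
        · simp)
    have hder := hasDerivAt_sph_apply (u := EuclideanSpace.single (Fin.last d) 1) (hy1 i)
      (Fin.last d)
    obtain ⟨t, ⟨y', hy'1, hy'2⟩, ht⟩ := (hA.and (eventually_ne_zero_of_hasDerivAt (B := A) hder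
      (by simp [sph, hi]) (by simp [hi]))).exists
    refine hy'2 (Or.inr ⟨i, hi, ht _ ?_⟩)
    have h1 := hy'1 i
    rw [if_pos rfl] at h1
    exact (PiLp.norm_apply_le (y' i - sph (y i) (t • EuclideanSpace.single (Fin.last d) 1))
      (Fin.last d)).trans h1
  refine ⟨y, hy1, hy2, fun i j hij => ?_⟩
  by_contra hne'
  simp only at hij
  set k : Fin d := ⟨0, hd⟩
  obtain ⟨A, hA⟩ := hmove (fun l => if l = i then EuclideanSpace.single k.castSucc 1 else
      if l = j then - EuclideanSpace.single k.castSucc 1 else 0)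
      (fun l k => by
        dsimp only
        split_ifs
        · rw [PiLp.single_apply]; split_ifs <;> simp
        · rw [PiLp.neg_apply, PiLp.single_apply]; split_ifs <;> simp
        · simp)
      (fun p hp => by
        rw [Finset.sum_eq_add i j hne']
        · simp only [if_true, if_neg (Ne.symm hne'), PiLp.neg_apply, PiLp.single_apply,
            neg_mul, ite_mul, one_mul, zero_mul, Finset.sum_neg_distrib,
            Finset.sum_ite_eq', Finset.mem_univ]
          rw [pEval_tangGrad_castSucc_congr hp hij]; ring
        · intro l _ hl; simp [hl.1, hl.2]
        · simp
        · simp)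
  have hder := (hasDerivAt_sph_apply (u := EuclideanSpace.single k.castSucc 1) (hy1 i)
    k.castSucc).sub
    (hasDerivAt_sph_apply (u := - EuclideanSpace.single k.castSucc 1) (hy1 j) k.castSucc)
  have hk : y i k.castSucc = y j k.castSucc := by
    have := congrArg (fun z : EuclideanSpace ℝ (Fin d) => z k) hij
    simpa using this
  have hlt : y j k.castSucc ^ 2 < 1 := by
    have h1 := norm_sq_eq_proj (y j)
    have h2 : 0 < y j (Fin.last d) ^ 2 := by have := hne j; positivity
    have h3 : (proj (y j) k) ^ 2 ≤ ‖proj (y j)‖ ^ 2 := by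
      rw [← sq_abs]
      exact pow_le_pow_left₀ (abs_nonneg _) (PiLp.norm_apply_le (proj (y j)) k) 2
    rw [proj_apply] at h3
    rw [hy1] at h1
    linarith
  obtain ⟨t, ⟨y', hy'1, hy'2⟩, ht⟩ := (hA.and (eventually_ne_zero_of_hasDerivAt (B := 2 * A) hder
    (by simp [sph, hk, hy1]) (by
      simp only [PiLp.single_apply, if_true, PiLp.neg_apply, inner_neg_right,
        EuclideanSpace.inner_single_right, one_mul, conj_trivial, hk]
      nlinarith))).exists
  refine hy'2 (Or.inl ⟨i, j, hij, fun heq => ht (y' i k.castSucc - y' j k.castSucc) ?_ ?_⟩)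
  · have h1 := hy'1 i
    have h2 := hy'1 j
    rw [if_pos rfl] at h1
    rw [if_neg (Ne.symm hne'), if_pos rfl] at h2
    have h3 := (PiLp.norm_apply_le (y' i - sph (y i) (t • EuclideanSpace.single k.castSucc 1))
      k.castSucc).trans h1
    have h4 := (PiLp.norm_apply_le (y' j - sph (y j) (t • -EuclideanSpace.single k.castSucc 1))
      k.castSucc).trans h2
    rw [PiLp.sub_apply, Real.norm_eq_abs, abs_le] at h3 h4
    simp only [Pi.sub_apply]
    rw [abs_le]
    constructor <;> linarith [h3.1, h3.2, h4.1, h4.2]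
  · have := congrArg (fun z : EuclideanSpace ℝ (Fin d) => z k) heq
    simp only [proj_apply] at this
    rw [this, sub_self]

end

section

/-- The decay constant of the peaking polynomials used for a measure with doubling
exponent `t`. -/
def peakC (t : ℕ) : ℝ := (2 + 8 * ((t + 2 : ℕ) : ℝ) ^ 2) ^ (t + 2)

lemma peakC_pos (t : ℕ) : 0 < peakC t := by unfold peakC; positivity

variable {D : ℕ}

lemma exists_peak_of_pos (t : ℕ) {n : ℕ} (hn : 0 < n) {x : EuclideanSpace ℝ (Fin D)}
    (hx : ‖x‖ = 1) : ∃ Q : MvPolynomial (Fin D) ℝ, Q.totalDegree + 1 ≤ n ∧ pEval Q x = 1 ∧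
      ∀ z : EuclideanSpace ℝ (Fin D), ‖z‖ = 1 → 0 ≤ pEval Q z ∧ pEval Q z ≤ 1 ∧
        pEval Q z ≤ peakC t * ((1 + n * ‖x - z‖) ^ (2 * t + 4))⁻¹ := by
  obtain ⟨Q, h1, h2, h3⟩ := exists_peak (k := t + 2) (by omega) (n - 1) hx
  refine ⟨Q, by omega, h2, fun z hz => ⟨(h3 z hz).1, (h3 z hz).2.1, ?_⟩⟩
  have h4 := (h3 z hz).2.2
  rw [Nat.cast_pred hn, sub_add_cancel] at h4
  have : 0 < (1 + n * ‖x - z‖) ^ (2 * t + 4) := by positivity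
  rw [← div_eq_mul_inv, le_div_iff₀ this]
  exact h4

section

variable {μ : Measure (EuclideanSpace ℝ (Fin D))} {t : ℕ}

lemma real_closedBall_two_pow_mul_le
    (hdbl : ∀ z : EuclideanSpace ℝ (Fin D), ‖z‖ = 1 → ∀ r, 0 < r →
      μ.real (Metric.closedBall z (2 * r)) ≤ 2 ^ t * μ.real (Metric.closedBall z r))
    {x : EuclideanSpace ℝ (Fin D)} (hx : ‖x‖ = 1) {r : ℝ} (hr : 0 < r) (k : ℕ) :
    μ.real (Metric.closedBall x (2 ^ k * r)) ≤ 2 ^ (t * k) * μ.real (Metric.closedBall x r) := by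
  induction k with
  | zero => simp
  | succ k ih =>
    have := hdbl x hx (2 ^ k * r) (by positivity)
    rw [← mul_assoc, ← pow_succ'] at this
    calc _ ≤ (2 : ℝ) ^ t * (2 ^ (t * k) * μ.real (Metric.closedBall x r)) := by
          refine this.trans ?_
          gcongr
      _ = _ := by ring

variable [IsProbabilityMeasure μ]

lemma real_closedBall_pos (hμ : ∀ᵐ z ∂μ, ‖z‖ = 1)
    (hdbl : ∀ z : EuclideanSpace ℝ (Fin D), ‖z‖ = 1 → ∀ r, 0 < r →
      μ.real (Metric.closedBall z (2 * r)) ≤ 2 ^ t * μ.real (Metric.closedBall z r))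
    {x : EuclideanSpace ℝ (Fin D)} (hx : ‖x‖ = 1) {r : ℝ} (hr : 0 < r) :
    0 < μ.real (Metric.closedBall x r) := by
  obtain ⟨k, hk⟩ := pow_unbounded_of_one_lt (2 / r) (one_lt_two (α := ℝ))
  have h1 := real_closedBall_two_pow_mul_le hdbl hx hr k
  have h2 : μ (Metric.closedBall x (2 ^ k * r)) = 1 := by
    rw [prob_compl_eq_zero_iff Metric.isClosed_closedBall.measurableSet |>.symm]
    refine measure_mono_null ?_ (ae_iff.1 hμ)
    intro z hz hz1
    apply hz
    rw [mem_closedBall_iff_norm]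
    have := norm_sub_le z x
    rw [div_lt_iff₀ hr] at hk
    linarith
  rw [measureReal_def, h2, ENNReal.toReal_one] at h1
  by_contra hneg
  have h3 : μ.real (Metric.closedBall x r) = 0 := le_antisymm (not_lt.1 hneg) measureReal_nonneg
  rw [h3, mul_zero] at h1
  linarith

lemma integrable_inv_pow (x : EuclideanSpace ℝ (Fin D)) (n p : ℕ) :
    Integrable (fun z => ((1 + n * ‖x - z‖) ^ p)⁻¹) μ := by
  have hpos : ∀ z, (1 : ℝ) ≤ (1 + n * ‖x - z‖) ^ p := fun z =>
    one_le_pow₀ (le_add_of_nonneg_right (by positivity))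
  refine Integrable.of_bound (Continuous.aestronglyMeasurable ?_) 1 (ae_of_all _ fun z => ?_)
  · exact Continuous.inv₀ (by fun_prop) fun z => (one_pos.trans_le (hpos z)).ne'
  · rw [norm_inv, Real.norm_of_nonneg (zero_le_one.trans (hpos z))]
    exact inv_le_one_of_one_le₀ (hpos z)

lemma integral_inv_pow_le (hμ : ∀ᵐ z ∂μ, ‖z‖ = 1)
    (hdbl : ∀ z : EuclideanSpace ℝ (Fin D), ‖z‖ = 1 → ∀ r, 0 < r →
      μ.real (Metric.closedBall z (2 * r)) ≤ 2 ^ t * μ.real (Metric.closedBall z r))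
    {n : ℕ} (hn : 0 < n) {x : EuclideanSpace ℝ (Fin D)} (hx : ‖x‖ = 1) {p : ℕ} (hp : t + 1 ≤ p) :
    ∫ z, ((1 + n * ‖x - z‖) ^ p)⁻¹ ∂μ ≤ 2 ^ (p + 1) * μ.real (Metric.closedBall x (1 / n)) := by
  have hn0 : (0 : ℝ) < n := by exact_mod_cast hn
  set B : ℕ → Set (EuclideanSpace ℝ (Fin D)) := fun l => Metric.closedBall x (2 ^ l * (1 / n))
  have hB : ∀ l, MeasurableSet (B l) := fun l => Metric.isClosed_closedBall.measurableSet
  have hmem : ∀ l z, n * ‖x - z‖ ≤ 2 ^ l ↔ z ∈ B l := by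
    intro l z
    simp only [B]
    rw [mem_closedBall_iff_norm, norm_sub_rev, mul_one_div, le_div_iff₀ hn0, mul_comm]
  have hind : ∀ l, Integrable ((B l).indicator fun _ => (1 : ℝ)) μ := fun l =>
    (integrable_const _).indicator (hB l)
  calc ∫ z, ((1 + n * ‖x - z‖) ^ p)⁻¹ ∂μ
      ≤ ∫ z, ∑ l ∈ Finset.range (2 * n + 1), 2 ^ p * ((2 : ℝ) ^ (l * p))⁻¹ *
          (B l).indicator (fun _ => (1 : ℝ)) z ∂μ := by
        refine integral_mono_ae (integrable_inv_pow x n p)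
          (integrable_finsetSum _ fun l _ => (hind l).const_mul _) ?_
        filter_upwards [hμ] with z hz
        have h2 : n * ‖x - z‖ ≤ (2 : ℝ) ^ (2 * n) := by
          have h3 := norm_sub_le x z
          have h4 : ((2 * n : ℕ) : ℝ) < 2 ^ (2 * n) := by exact_mod_cast Nat.lt_two_pow_self
          push_cast at h4
          nlinarith
        refine (inv_pow_le_dyadic (by positivity) h2 p).trans_eq ?_
        refine Finset.sum_congr rfl fun l _ => ?_
        by_cases hzl : z ∈ B l
        · rw [if_pos ((hmem l z).2 hzl), indicator_of_mem hzl]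
        · rw [if_neg (mt (hmem l z).1 hzl), indicator_of_notMem hzl]
    _ = ∑ l ∈ Finset.range (2 * n + 1), 2 ^ p * ((2 : ℝ) ^ (l * p))⁻¹ * μ.real (B l) := by
        rw [integral_finsetSum _ fun l _ => (hind l).const_mul _]
        refine Finset.sum_congr rfl fun l _ => ?_
        rw [integral_const_mul, integral_indicator_const _ (hB l), smul_eq_mul, mul_one]
    _ ≤ 2 ^ (p + 1) * μ.real (B 0) := by
        refine dyadic_sum_le hp measureReal_nonneg (fun l => ?_) _
        have := hdbl x hx (2 ^ l * (1 / n)) (by positivity)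
        rwa [← mul_assoc, ← pow_succ'] at this
    _ = _ := by simp [B]

variable {ι : Type*} [Fintype ι] {n : ℕ} {X : ι → EuclideanSpace ℝ (Fin D)} {β : ℝ}

lemma weight_le_of_exact (hμ : ∀ᵐ z ∂μ, ‖z‖ = 1)
    (hdbl : ∀ z : EuclideanSpace ℝ (Fin D), ‖z‖ = 1 → ∀ r, 0 < r →
      μ.real (Metric.closedBall z (2 * r)) ≤ 2 ^ t * μ.real (Metric.closedBall z r))
    (hn : 0 < n) (hβ : 0 ≤ β) (hX : ∀ i, ‖X i‖ = 1)
    (hq : ∀ F : MvPolynomial (Fin D) ℝ, F.totalDegree ≤ n →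
      ∫ z, pEval F z ∂μ = β * ∑ i, pEval F (X i)) (i : ι) :
    β ≤ peakC t * 2 ^ (2 * t + 5) * μ.real (Metric.closedBall (X i) (1 / n)) := by
  have hC := peakC_pos t
  obtain ⟨Q, h1, h2, h3⟩ := exists_peak_of_pos t hn (hX i)
  have hle : 1 ≤ ∑ j, pEval Q (X j) := by
    rw [← h2]
    exact Finset.single_le_sum (f := fun j => pEval Q (X j)) (fun j _ => (h3 _ (hX j)).1)
      (Finset.mem_univ i)
  calc β ≤ β * ∑ j, pEval Q (X j) := le_mul_of_one_le_right hβ hle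
    _ = ∫ z, pEval Q z ∂μ := (hq Q (by omega)).symm
    _ ≤ ∫ z, peakC t * ((1 + n * ‖X i - z‖) ^ (2 * t + 4))⁻¹ ∂μ := by
        refine integral_mono_ae (integrable_pEval hμ Q) ((integrable_inv_pow _ _ _).const_mul _) ?_
        filter_upwards [hμ] with z hz using (h3 z hz).2.2
    _ ≤ peakC t * (2 ^ (2 * t + 5) * μ.real (Metric.closedBall (X i) (1 / n))) := by
        rw [integral_const_mul]
        gcongr
        exact integral_inv_pow_le hμ hdbl hn (hX i) (by omega)
    _ = _ := by ring

/-- The scaled covering radius of the nodes of an exact formula. -/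
def coverC (t : ℕ) : ℕ := ⌈peakC t * 2 ^ (7 * t + 5)⌉₊

lemma exists_node_near (hμ : ∀ᵐ z ∂μ, ‖z‖ = 1)
    (hdbl : ∀ z : EuclideanSpace ℝ (Fin D), ‖z‖ = 1 → ∀ r, 0 < r →
      μ.real (Metric.closedBall z (2 * r)) ≤ 2 ^ t * μ.real (Metric.closedBall z r))
    (hn : 0 < n) (hβ : 0 ≤ β) (hX : ∀ i, ‖X i‖ = 1)
    (hq : ∀ F : MvPolynomial (Fin D) ℝ, F.totalDegree ≤ n →
      ∫ z, pEval F z ∂μ = β * ∑ i, pEval F (X i)) {x : EuclideanSpace ℝ (Fin D)} (hx : ‖x‖ = 1) :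
    ∃ i, n * ‖x - X i‖ ≤ coverC t := by
  have hC := peakC_pos t
  have hn0 : (0 : ℝ) < n := by exact_mod_cast hn
  set K : ℝ := ((coverC t : ℕ) : ℝ)
  have hK : peakC t * 2 ^ (7 * t + 5) ≤ K := Nat.le_ceil _
  have hK1 : 1 ≤ K := by
    have h0 : 0 < coverC t := Nat.ceil_pos.2 (by positivity)
    have h1 : (1 : ℝ) ≤ (coverC t : ℕ) := by exact_mod_cast h0
    exact h1
  by_contra! hcon
  obtain ⟨Q, h1, h2, h3⟩ := exists_peak_of_pos t hn hx
  set U : MvPolynomial (Fin D) ℝ :=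
    Q * (MvPolynomial.C (K ^ 2 - 2 * (n : ℝ) ^ 2) +
      MvPolynomial.C (2 * (n : ℝ) ^ 2) * innerPoly x) with hU
  have hUdeg : U.totalDegree ≤ n := by
    refine (MvPolynomial.totalDegree_mul _ _).trans (le_trans ?_ h1)
    gcongr
    refine (MvPolynomial.totalDegree_add _ _).trans (max_le ?_ ?_)
    · rw [MvPolynomial.totalDegree_C]; exact Nat.zero_le _
    refine (MvPolynomial.totalDegree_mul _ _).trans ?_
    rw [MvPolynomial.totalDegree_C, zero_add]
    exact totalDegree_innerPoly_le x
  have hUev : ∀ z : EuclideanSpace ℝ (Fin D), ‖z‖ = 1 →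
      pEval U z = pEval Q z * (K ^ 2 - (n * ‖x - z‖) ^ 2) := by
    intro z hz
    rw [hU, pEval_mul, pEval_add, pEval_mul, pEval_C, pEval_C, pEval_innerPoly, mul_pow,
      norm_sub_sq_of_norm_one hx hz]
    ring
  have hsum : β * ∑ i, pEval U (X i) ≤ 0 := by
    refine mul_nonpos_of_nonneg_of_nonpos hβ (Finset.sum_nonpos fun i _ => ?_)
    rw [hUev _ (hX i)]
    refine mul_nonpos_of_nonneg_of_nonpos (h3 _ (hX i)).1 ?_
    have := hcon i
    nlinarith
  rw [← hq U hUdeg] at hsum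
  set m₀ := μ.real (Metric.closedBall x (1 / n)) with hm₀
  have hm₀pos : 0 < m₀ := real_closedBall_pos hμ hdbl hx (by positivity)
  have hQlow : 1 / 2 * (2 ^ (5 * t))⁻¹ * m₀ ≤ ∫ z, pEval Q z ∂μ := by
    set A := Metric.closedBall x (1 / (32 * n)) with hA
    have hAm : MeasurableSet A := Metric.isClosed_closedBall.measurableSet
    have h5 := real_closedBall_two_pow_mul_le hdbl hx (r := 1 / (32 * n)) (by positivity) 5
    have e : (2 : ℝ) ^ 5 * (1 / (32 * n)) = 1 / n := by field_simp; norm_num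
    rw [e, mul_comm t 5, ← hm₀] at h5
    have h6 : (2 ^ (5 * t))⁻¹ * m₀ ≤ μ.real A := by
      rw [inv_mul_le_iff₀ (by positivity)]; exact h5
    calc 1 / 2 * (2 ^ (5 * t))⁻¹ * m₀ ≤ 1 / 2 * μ.real A := by rw [mul_assoc]; gcongr
      _ = ∫ z, A.indicator (fun _ => (1 / 2 : ℝ)) z ∂μ := by
          rw [integral_indicator_const _ hAm, smul_eq_mul, mul_comm]
      _ ≤ ∫ z, pEval Q z ∂μ := by
          refine integral_mono_ae ((integrable_const _).indicator hAm) (integrable_pEval hμ Q) ?_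
          filter_upwards [hμ] with z hz
          by_cases hzA : z ∈ A
          · rw [indicator_of_mem hzA]
            have h7 := abs_pEval_sub_le (M := 1) hn (show Q.totalDegree ≤ n by omega)
              (fun u hu => abs_le.2 ⟨by linarith [(h3 u hu).1], (h3 u hu).2.1⟩) hx hz
            rw [hA, mem_closedBall_iff_norm, le_div_iff₀ (by positivity)] at hzA
            have h8 := (abs_le.1 h7).1
            rw [h2] at h8
            linarith
          · rw [indicator_of_notMem hzA]; exact (h3 z hz).1
  have hup : ∫ z, K ^ 2 * pEval Q z ∂μ - ∫ z, pEval U z ∂μ ≤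
      peakC t * (2 ^ (2 * t + 3) * m₀) := by
    rw [← integral_sub ((integrable_pEval hμ Q).const_mul _) (integrable_pEval hμ U)]
    calc _ ≤ ∫ z, peakC t * ((1 + n * ‖x - z‖) ^ (2 * t + 2))⁻¹ ∂μ := by
          refine integral_mono_ae (((integrable_pEval hμ Q).const_mul _).sub
            (integrable_pEval hμ U)) ((integrable_inv_pow _ _ _).const_mul _) ?_
          filter_upwards [hμ] with z hz
          rw [hUev z hz]
          have h9 := (h3 z hz).2.2
          have h10 : 0 ≤ n * ‖x - z‖ := by positivity
          set a := n * ‖x - z‖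
          have h11 : a ^ 2 ≤ (1 + a) ^ 2 := by gcongr; linarith
          calc K ^ 2 * pEval Q z - pEval Q z * (K ^ 2 - a ^ 2) = pEval Q z * a ^ 2 := by ring
            _ ≤ peakC t * ((1 + a) ^ (2 * t + 4))⁻¹ * (1 + a) ^ 2 := by
                gcongr
            _ = _ := by
                have : 1 + a ≠ 0 := by positivity
                rw [show 2 * t + 4 = (2 * t + 2) + 2 by ring, pow_add _ (2 * t + 2) 2]
                field_simp
      _ ≤ _ := by
          rw [integral_const_mul]
          gcongr
          exact integral_inv_pow_le hμ hdbl hn hx (by omega)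
  rw [integral_const_mul] at hup
  have hfin : K * (1 / 2 * (2 ^ (5 * t))⁻¹ * m₀) ≤ peakC t * (2 ^ (2 * t + 3) * m₀) := by
    have h12 : 0 ≤ 1 / 2 * (2 ^ (5 * t))⁻¹ * m₀ := by positivity
    calc _ ≤ K ^ 2 * (1 / 2 * (2 ^ (5 * t))⁻¹ * m₀) := by gcongr; nlinarith
      _ ≤ K ^ 2 * ∫ z, pEval Q z ∂μ := by gcongr
      _ ≤ _ := by linarith
  have h13 : 2 * (peakC t * (2 ^ (2 * t + 3) * m₀)) ≤ K * (1 / 2 * (2 ^ (5 * t))⁻¹ * m₀) := by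
    calc _ = (peakC t * 2 ^ (7 * t + 5)) * (1 / 2 * (2 ^ (5 * t))⁻¹ * m₀) := by
          rw [show 7 * t + 5 = 5 * t + (2 * t + 3) + 2 by ring, pow_add, pow_add]
          field_simp
          ring
      _ ≤ _ := by gcongr
  have h14 : 0 < peakC t * (2 ^ (2 * t + 3) * m₀) := by positivity
  linarith

/-- The constant in the lower bound for the measure of balls. -/
def lowC (t : ℕ) : ℝ := peakC t * 2 ^ (2 * t + 5) * 2 ^ (t * (coverC t + 1))

lemma lowC_pos (t : ℕ) : 0 < lowC t := by
  have := peakC_pos t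
  unfold lowC; positivity

/-- The weight of an exact formula with equal weights is bounded by the measure of any ball
of radius `1 / n`. -/
lemma weight_le_real_closedBall (hμ : ∀ᵐ z ∂μ, ‖z‖ = 1)
    (hdbl : ∀ z : EuclideanSpace ℝ (Fin D), ‖z‖ = 1 → ∀ r, 0 < r →
      μ.real (Metric.closedBall z (2 * r)) ≤ 2 ^ t * μ.real (Metric.closedBall z r))
    (hn : 0 < n) (hβ : 0 ≤ β) (hX : ∀ i, ‖X i‖ = 1)
    (hq : ∀ F : MvPolynomial (Fin D) ℝ, F.totalDegree ≤ n →
      ∫ z, pEval F z ∂μ = β * ∑ i, pEval F (X i)) {x : EuclideanSpace ℝ (Fin D)} (hx : ‖x‖ = 1) :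
    β ≤ lowC t * μ.real (Metric.closedBall x (1 / n)) := by
  have hC := peakC_pos t
  have hn0 : (0 : ℝ) < n := by exact_mod_cast hn
  obtain ⟨i, hi⟩ := exists_node_near hμ hdbl hn hβ hX hq hx
  have h1 := weight_le_of_exact hμ hdbl hn hβ hX hq i
  have h2 := real_closedBall_two_pow_mul_le hdbl hx (r := 1 / n) (by positivity) (coverC t + 1)
  have h3 : μ.real (Metric.closedBall (X i) (1 / n)) ≤
      μ.real (Metric.closedBall x (2 ^ (coverC t + 1) * (1 / n))) := by
    refine measureReal_mono (Metric.closedBall_subset_closedBall' ?_)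
    have h4 : ((coverC t + 1 : ℕ) : ℝ) < 2 ^ (coverC t + 1) := by
      exact_mod_cast Nat.lt_two_pow_self
    push_cast at h4
    have h5 : ‖x - X i‖ ≤ coverC t * (1 / n) := by
      rw [mul_one_div, le_div_iff₀ hn0]; linarith
    rw [dist_comm, dist_eq_norm]
    calc 1 / (n : ℝ) + ‖x - X i‖ ≤ (coverC t + 1) * (1 / n) := by linarith
      _ ≤ _ := by gcongr
  calc β ≤ _ := h1
    _ ≤ peakC t * 2 ^ (2 * t + 5) *
        (2 ^ (t * (coverC t + 1)) * μ.real (Metric.closedBall x (1 / n))) := by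
        gcongr; exact h3.trans h2
    _ = _ := by rw [lowC]; ring

end

end

section

open scoped ENNReal

section

/-- The lift of a point of the ball to the upper (`σ = 1`) or lower (`σ = -1`) hemisphere. -/
def lft (σ : ℝ) (x : EuclideanSpace ℝ (Fin d)) : EuclideanSpace ℝ (Fin (d + 1)) :=
  WithLp.toLp 2 (Fin.snoc (α := fun _ => ℝ) (fun i => x i) (σ * √(1 - ‖x‖ ^ 2)))

@[simp] lemma lft_castSucc (σ : ℝ) (x : EuclideanSpace ℝ (Fin d)) (i : Fin d) :
    lft σ x i.castSucc = x i := by simp [lft]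

@[simp] lemma lft_last (σ : ℝ) (x : EuclideanSpace ℝ (Fin d)) :
    lft σ x (Fin.last d) = σ * √(1 - ‖x‖ ^ 2) := by simp [lft]

@[simp] lemma proj_lft (σ : ℝ) (x : EuclideanSpace ℝ (Fin d)) : proj (lft σ x) = x := by
  ext i; simp

lemma continuous_lft (σ : ℝ) : Continuous (lft σ : EuclideanSpace ℝ (Fin d) → _) := by
  unfold lft
  refine (PiLp.continuous_toLp 2 _).comp (continuous_pi fun j => ?_)
  refine Fin.lastCases ?_ (fun i => ?_) j
  · simp only [Fin.snoc_last]; fun_prop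
  · simp only [Fin.snoc_castSucc]; fun_prop

lemma norm_lft {σ : ℝ} (hσ : σ ^ 2 = 1) {x : EuclideanSpace ℝ (Fin d)} (hx : ‖x‖ ≤ 1) :
    ‖lft σ x‖ = 1 := by
  have h := norm_sq_eq_proj (lft σ x)
  have h1 : ‖x‖ ^ 2 ≤ 1 := pow_le_one₀ (norm_nonneg _) hx
  rw [proj_lft, lft_last, mul_pow, hσ, Real.sq_sqrt (by linarith)] at h
  rw [← sq_eq_sq₀ (norm_nonneg _) zero_le_one, h]
  ring

lemma norm_proj_le {X : EuclideanSpace ℝ (Fin (d + 1))} (hX : ‖X‖ = 1) : ‖proj X‖ ≤ 1 := by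
  have h := norm_sq_eq_proj X
  rw [hX] at h
  exact (sq_le_one_iff₀ (norm_nonneg _)).1 (by nlinarith [sq_nonneg (X (Fin.last d))])

lemma exists_eq_lft {X : EuclideanSpace ℝ (Fin (d + 1))} (hX : ‖X‖ = 1) :
    ∃ σ : ℝ, (σ = 1 ∨ σ = -1) ∧ X = lft σ (proj X) := by
  have h := norm_sq_eq_proj X
  have h1 : √(1 - ‖proj X‖ ^ 2) = |X (Fin.last d)| := by
    rw [← Real.sqrt_sq_eq_abs]; congr 1; rw [hX] at h; linarith
  have key : ∀ σ : ℝ, X (Fin.last d) = σ * |X (Fin.last d)| → X = lft σ (proj X) := by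
    intro σ hσ
    ext j
    refine Fin.lastCases ?_ (fun i => ?_) j
    · rw [lft_last, h1, ← hσ]
    · simp
  rcases abs_cases (X (Fin.last d)) with ⟨h2, -⟩ | ⟨h2, -⟩
  · exact ⟨1, Or.inl rfl, key 1 (by rw [h2, one_mul])⟩
  · exact ⟨-1, Or.inr rfl, key (-1) (by rw [h2]; ring)⟩

lemma norm_lft_sub_sq (σ τ : ℝ) (x y : EuclideanSpace ℝ (Fin d)) :
    ‖lft σ x - lft τ y‖ ^ 2 =
      ‖x - y‖ ^ 2 + (σ * √(1 - ‖x‖ ^ 2) - τ * √(1 - ‖y‖ ^ 2)) ^ 2 := by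
  rw [norm_sq_eq_proj, PiLp.sub_apply, lft_last, lft_last]
  congr 3
  ext i; simp

lemma norm_lft_sub_le {σ : ℝ} (hσ : σ ^ 2 = 1) (x y : EuclideanSpace ℝ (Fin d)) :
    ‖lft σ x - lft σ y‖ ≤ rhoB x y := by
  refine abs_le_of_sq_le_sq' ?_ (by unfold rhoB; positivity) |>.2
  rw [norm_lft_sub_sq, ← mul_sub, mul_pow, hσ, one_mul, rhoB,
    ← sq_abs (√(1 - ‖x‖ ^ 2) - √(1 - ‖y‖ ^ 2))]
  nlinarith [mul_nonneg (norm_nonneg (x - y)) (abs_nonneg (√(1 - ‖x‖ ^ 2) - √(1 - ‖y‖ ^ 2)))]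

lemma rhoB_le_two_mul_norm {σ τ : ℝ} (hσ : σ = 1 ∨ σ = -1) (hτ : τ = 1 ∨ τ = -1)
    (x y : EuclideanSpace ℝ (Fin d)) : rhoB x y ≤ 2 * ‖lft σ x - lft τ y‖ := by
  have h := norm_lft_sub_sq σ τ x y
  set a := √(1 - ‖x‖ ^ 2) with ha
  set b := √(1 - ‖y‖ ^ 2) with hb
  have ha0 : 0 ≤ a := Real.sqrt_nonneg _
  have hb0 : 0 ≤ b := Real.sqrt_nonneg _
  have h1 : ‖x - y‖ ≤ ‖lft σ x - lft τ y‖ :=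
    abs_le_of_sq_le_sq' (by rw [h]; nlinarith [sq_nonneg (σ * a - τ * b)]) (norm_nonneg _) |>.2
  have h2 : |a - b| ≤ ‖lft σ x - lft τ y‖ := by
    refine abs_le_of_sq_le_sq' ?_ (norm_nonneg _) |>.2
    rw [h, sq_abs]
    have := mul_nonneg ha0 hb0
    have := sq_nonneg ‖x - y‖
    rcases hσ with rfl | rfl <;> rcases hτ with rfl | rfl <;> nlinarith
  unfold rhoB
  linarith

lemma isClosed_ballRho (x : EuclideanSpace ℝ (Fin d)) (r : ℝ) : IsClosed (ballRho x r) := by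
  unfold ballRho rhoB
  exact (isClosed_le continuous_norm continuous_const).inter
    (isClosed_le (f := fun y => ‖x - y‖ + |√(1 - ‖x‖ ^ 2) - √(1 - ‖y‖ ^ 2)|)
      (by fun_prop) continuous_const)

/-- The even lift to the sphere of a measure on the ball. -/
def lftMeasure (ν : Measure (EuclideanSpace ℝ (Fin d))) :
    Measure (EuclideanSpace ℝ (Fin (d + 1))) :=
  (2⁻¹ : ℝ≥0∞) • (ν.map (lft 1) + ν.map (lft (-1)))

variable {ν : Measure (EuclideanSpace ℝ (Fin d))}

lemma ae_lftMeasure (hν : ∀ᵐ z ∂ν, ‖z‖ ≤ 1) : ∀ᵐ z ∂lftMeasure ν, ‖z‖ = 1 := by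
  have key : ∀ σ : ℝ, σ ^ 2 = 1 → ∀ᵐ z ∂ν.map (lft σ), ‖z‖ = 1 := by
    intro σ hσ
    rw [ae_map_iff (continuous_lft σ).aemeasurable
      (isClosed_eq continuous_norm continuous_const).measurableSet]
    filter_upwards [hν] with z hz using norm_lft hσ hz
  refine Measure.ae_smul_measure ?_ _
  exact ae_add_measure_iff.2 ⟨key 1 (by norm_num), key (-1) (by norm_num)⟩

variable [IsProbabilityMeasure ν]

instance : IsProbabilityMeasure (lftMeasure ν) := by
  constructor
  have h1 : Measurable (lft 1 : EuclideanSpace ℝ (Fin d) → _) := (continuous_lft 1).measurable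
  have h2 : Measurable (lft (-1) : EuclideanSpace ℝ (Fin d) → _) := (continuous_lft (-1)).measurable
  rw [lftMeasure, Measure.smul_apply, Measure.add_apply, Measure.map_apply h1 .univ,
    Measure.map_apply h2 .univ, preimage_univ, preimage_univ, measure_univ, smul_eq_mul,
    one_add_one_eq_two]
  exact ENNReal.inv_mul_cancel (by norm_num) (by norm_num)

lemma lftMeasure_real {S : Set (EuclideanSpace ℝ (Fin (d + 1)))} (hS : MeasurableSet S) :
    (lftMeasure ν).real S = 1 / 2 * (ν.real (lft 1 ⁻¹' S) + ν.real (lft (-1) ⁻¹' S)) := by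
  have h1 : Measurable (lft 1 : EuclideanSpace ℝ (Fin d) → _) := (continuous_lft 1).measurable
  have h2 : Measurable (lft (-1) : EuclideanSpace ℝ (Fin d) → _) := (continuous_lft (-1)).measurable
  rw [measureReal_def, lftMeasure, Measure.smul_apply, Measure.add_apply, Measure.map_apply h1 hS,
    Measure.map_apply h2 hS, smul_eq_mul, ENNReal.toReal_mul,
    ENNReal.toReal_add (measure_ne_top _ _) (measure_ne_top _ _)]
  simp [measureReal_def]

lemma half_le_lftMeasure {σ : ℝ} (hσ : σ = 1 ∨ σ = -1) (x : EuclideanSpace ℝ (Fin d)) (r : ℝ) :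
    1 / 2 * ν.real (ballRho x r) ≤ (lftMeasure ν).real (Metric.closedBall (lft σ x) r) := by
  rw [lftMeasure_real Metric.isClosed_closedBall.measurableSet]
  have key : ν.real (ballRho x r) ≤ ν.real (lft σ ⁻¹' Metric.closedBall (lft σ x) r) := by
    refine measureReal_mono fun y hy => ?_
    rw [mem_preimage, mem_closedBall_iff_norm, norm_sub_rev]
    exact (norm_lft_sub_le (by rcases hσ with rfl | rfl <;> norm_num) x y).trans hy.2
  rcases hσ with rfl | rfl
  · have : 0 ≤ ν.real (lft (-1) ⁻¹' Metric.closedBall (lft 1 x) r) := measureReal_nonneg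
    linarith
  · have : 0 ≤ ν.real (lft 1 ⁻¹' Metric.closedBall (lft (-1) x) r) := measureReal_nonneg
    linarith

lemma lftMeasure_le (hν : ∀ᵐ z ∂ν, ‖z‖ ≤ 1) {σ : ℝ} (hσ : σ = 1 ∨ σ = -1)
    (x : EuclideanSpace ℝ (Fin d)) (r : ℝ) :
    (lftMeasure ν).real (Metric.closedBall (lft σ x) r) ≤ ν.real (ballRho x (2 * r)) := by
  rw [lftMeasure_real Metric.isClosed_closedBall.measurableSet]
  have key : ∀ τ : ℝ, τ = 1 ∨ τ = -1 →
      ν.real (lft τ ⁻¹' Metric.closedBall (lft σ x) r) ≤ ν.real (ballRho x (2 * r)) := by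
    intro τ hτ
    refine ENNReal.toReal_mono (measure_ne_top _ _) (measure_mono_ae ?_)
    filter_upwards [hν] with y hy hmem
    have hmem' : ‖lft τ y - lft σ x‖ ≤ r := mem_closedBall_iff_norm.1 hmem
    refine ⟨hy, (rhoB_le_two_mul_norm hσ hτ x y).trans ?_⟩
    rw [norm_sub_rev]
    linarith
  have h1 := key 1 (Or.inl rfl)
  have h2 := key (-1) (Or.inr rfl)
  linarith

lemma integral_lftMeasure (hν : ∀ᵐ z ∂ν, ‖z‖ ≤ 1) (F : MvPolynomial (Fin (d + 1)) ℝ) :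
    ∫ z, pEval F z ∂lftMeasure ν = 1 / 2 * ∫ z, (pEval F (lft 1 z) + pEval F (lft (-1) z)) ∂ν := by
  have hi : Integrable (pEval F) (lftMeasure ν) := integrable_pEval (ae_lftMeasure hν) F
  have hi2 : Integrable (pEval F) (ν.map (lft 1) + ν.map (lft (-1))) := by
    refine (integrable_smul_measure ?_ ?_).1 hi <;> norm_num
  have h1 := hi2.left_of_add_measure
  have h2 := hi2.right_of_add_measure
  have c := (continuous_pEval F).aestronglyMeasurable (μ := ν.map (lft 1))
  have c' := (continuous_pEval F).aestronglyMeasurable (μ := ν.map (lft (-1)))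
  have a := (continuous_lft (d := d) 1).aemeasurable (μ := ν)
  have a' := (continuous_lft (d := d) (-1)).aemeasurable (μ := ν)
  rw [lftMeasure, integral_smul_measure, integral_add_measure h1 h2, integral_map a c,
    integral_map a' c']
  have h3 : ∫ z, (pEval F (lft 1 z) + pEval F (lft (-1) z)) ∂ν = _ :=
    integral_add ((integrable_map_measure c a).1 h1) ((integrable_map_measure c' a').1 h2)
  rw [h3]
  simp

lemma integral_lftMeasure_rename (hν : ∀ᵐ z ∂ν, ‖z‖ ≤ 1) (P : MvPolynomial (Fin d) ℝ) :
    ∫ z, pEval (MvPolynomial.rename Fin.castSucc P) z ∂lftMeasure ν = ∫ z, pEval P z ∂ν := by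
  rw [integral_lftMeasure hν]
  simp only [pEval_rename, proj_lft, ← two_mul]
  rw [integral_const_mul]
  ring

lemma lftMeasure_doubling (hν : ∀ᵐ z ∂ν, ‖z‖ ≤ 1) {L : ℝ} (hL : 0 ≤ L) {t : ℕ}
    (ht : 2 * L ^ 2 ≤ 2 ^ t)
    (hdbl : ∀ x : EuclideanSpace ℝ (Fin d), ‖x‖ ≤ 1 → ∀ r : ℝ, 0 < r →
      ν.real (ballRho x (2 * r)) ≤ L * ν.real (ballRho x r))
    {X : EuclideanSpace ℝ (Fin (d + 1))} (hX : ‖X‖ = 1) {r : ℝ} (hr : 0 < r) :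
    (lftMeasure ν).real (Metric.closedBall X (2 * r)) ≤
      2 ^ t * (lftMeasure ν).real (Metric.closedBall X r) := by
  obtain ⟨σ, hσ, hXσ⟩ := exists_eq_lft hX
  rw [hXσ]
  have hx := norm_proj_le hX
  set x := proj X
  calc _ ≤ ν.real (ballRho x (2 * (2 * r))) := lftMeasure_le hν hσ x (2 * r)
    _ ≤ L * (L * ν.real (ballRho x r)) := by
        refine (hdbl x hx (2 * r) (by positivity)).trans ?_
        gcongr
        exact hdbl x hx r hr
    _ = 2 * L ^ 2 * (1 / 2 * ν.real (ballRho x r)) := by ring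
    _ ≤ _ := by gcongr; exact half_le_lftMeasure hσ x r

end

end

section

lemma pEval_monomial (s : Fin d →₀ ℕ) (c : ℝ) (x : EuclideanSpace ℝ (Fin d)) :
    pEval (MvPolynomial.monomial s c) x = c * ∏ i, x i ^ s i := by
  rw [pEval, MvPolynomial.eval_monomial, Finsupp.prod_fintype _ _ fun i => pow_zero _]

/-- The sum of the values of a polynomial at the two lifts of a point of the ball is a polynomial
of no larger degree. -/
lemma exists_pEval_eq_add_lft {n : ℕ} (F : MvPolynomial (Fin (d + 1)) ℝ) (hF : F.totalDegree ≤ n) :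
    ∃ P : MvPolynomial (Fin d) ℝ, P.totalDegree ≤ n ∧ ∀ z : EuclideanSpace ℝ (Fin d), ‖z‖ ≤ 1 →
      pEval P z = pEval F (lft 1 z) + pEval F (lft (-1) z) := by
  have key : ∀ s ∈ F.support, ∃ P : MvPolynomial (Fin d) ℝ, P.totalDegree ≤ n ∧
      ∀ z : EuclideanSpace ℝ (Fin d), ‖z‖ ≤ 1 →
        pEval P z = pEval (MvPolynomial.monomial s (F.coeff s)) (lft 1 z) +
          pEval (MvPolynomial.monomial s (F.coeff s)) (lft (-1) z) := by
    intro s hs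
    have hdeg : ∑ i, s i ≤ n := by
      have h := (MvPolynomial.le_totalDegree hs).trans hF
      rwa [Finsupp.sum_fintype _ _ fun _ => rfl] at h
    rw [Fin.sum_univ_castSucc] at hdeg
    rcases Nat.even_or_odd (s (Fin.last d)) with ⟨j, hj⟩ | hodd
    · refine ⟨MvPolynomial.C (2 * F.coeff s) * (∏ i, MvPolynomial.X i ^ s i.castSucc) *
        (MvPolynomial.C 1 - ∑ l, MvPolynomial.X l ^ 2) ^ j, ?_, fun z hz => ?_⟩
      · have h1 : (∏ i, (MvPolynomial.X i : MvPolynomial (Fin d) ℝ) ^ s i.castSucc).totalDegree ≤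
            ∑ i : Fin d, s i.castSucc := by
          refine (MvPolynomial.totalDegree_finsetProd _ _).trans (Finset.sum_le_sum fun i _ => ?_)
          refine (MvPolynomial.totalDegree_pow _ _).trans ?_
          rw [MvPolynomial.totalDegree_X, mul_one]
        have h2 : ((MvPolynomial.C 1 - ∑ l, MvPolynomial.X l ^ 2 :
            MvPolynomial (Fin d) ℝ) ^ j).totalDegree ≤ j * 2 := by
          refine (MvPolynomial.totalDegree_pow _ _).trans (Nat.mul_le_mul_left _ ?_)
          refine (MvPolynomial.totalDegree_sub _ _).trans (max_le ?_ ?_)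
          · rw [MvPolynomial.totalDegree_C]; exact Nat.zero_le _
          · refine MvPolynomial.totalDegree_finsetSum_le fun l _ => ?_
            refine (MvPolynomial.totalDegree_pow _ _).trans ?_
            rw [MvPolynomial.totalDegree_X]
        refine (MvPolynomial.totalDegree_mul _ _).trans ?_
        have h3 := MvPolynomial.totalDegree_mul (MvPolynomial.C (2 * F.coeff s))
          (∏ i, (MvPolynomial.X i : MvPolynomial (Fin d) ℝ) ^ s i.castSucc)
        rw [MvPolynomial.totalDegree_C] at h3
        omega
      · have h1 : ‖z‖ ^ 2 ≤ 1 := pow_le_one₀ (norm_nonneg _) hz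
        have h2 : pEval (∏ i, MvPolynomial.X i ^ s i.castSucc) z = ∏ i, z i ^ s i.castSucc := by
          simp [pEval]
        simp only [pEval_monomial, Fin.prod_univ_castSucc, lft_castSucc, lft_last, pEval_mul,
          pEval_pow, pEval_sub, pEval_sum, pEval_C, pEval_X, hj, h2]
        rw [← EuclideanSpace.real_norm_sq_eq, ← two_mul, mul_pow, mul_pow, pow_mul, pow_mul,
          pow_mul, Real.sq_sqrt (by linarith)]
        norm_num
        ring
    · refine ⟨0, by simp, fun z hz => ?_⟩
      simp only [pEval_monomial, Fin.prod_univ_castSucc, lft_castSucc, lft_last, mul_pow,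
        hodd.neg_one_pow, one_pow]
      rw [show pEval (0 : MvPolynomial (Fin d) ℝ) z = 0 by simp [pEval]]
      ring
  choose! P hP1 hP2 using key
  refine ⟨∑ s ∈ F.support, P s, MvPolynomial.totalDegree_finsetSum_le hP1, fun z hz => ?_⟩
  have e : ∀ y, pEval F y = ∑ s ∈ F.support, pEval (MvPolynomial.monomial s (F.coeff s)) y := by
    intro y
    rw [← pEval_sum, ← MvPolynomial.as_sum]
  rw [pEval_sum, e, e, ← Finset.sum_add_distrib]
  exact Finset.sum_congr rfl fun s hs => hP2 s hs z hz

variable {ν : Measure (EuclideanSpace ℝ (Fin d))} [IsProbabilityMeasure ν]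

/-- The number of nodes of an exact equal weight formula is bounded below. -/
lemma inv_card_le (hν : ∀ᵐ z ∂ν, ‖z‖ ≤ 1) {L : ℝ} (hL : 0 ≤ L) {t : ℕ}
    (ht : 2 * L ^ 2 ≤ 2 ^ t)
    (hdbl : ∀ x : EuclideanSpace ℝ (Fin d), ‖x‖ ≤ 1 → ∀ r : ℝ, 0 < r →
      ν.real (ballRho x (2 * r)) ≤ L * ν.real (ballRho x r))
    {n : ℕ} (hn : 0 < n) {Z : Finset (EuclideanSpace ℝ (Fin d))} (hZ : ∀ z ∈ Z, ‖z‖ ≤ 1)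
    (hex : ∀ P : MvPolynomial (Fin d) ℝ, P.totalDegree ≤ n →
      ∫ x, pEval P x ∂ν = 1 / (Z.card : ℝ) * ∑ z ∈ Z, pEval P z)
    {x : EuclideanSpace ℝ (Fin d)} (hx : ‖x‖ ≤ 1) :
    1 / (2 * (Z.card : ℝ)) ≤ lowC t * L * ν.real (ballRho x (1 / n)) := by
  have hn0 : (0 : ℝ) < n := by exact_mod_cast hn
  have hlow := lowC_pos t
  have h := weight_le_real_closedBall (μ := lftMeasure ν) (t := t) (ae_lftMeasure hν)
    (fun X hX r hr => lftMeasure_doubling hν hL ht hdbl hX hr) hn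
    (β := 1 / (2 * (Z.card : ℝ))) (by positivity)
    (X := Sum.elim (fun z : Z => lft 1 z.1) fun z : Z => lft (-1) z.1) ?_ ?_
    (x := lft 1 x) (norm_lft (by norm_num) hx)
  · calc _ ≤ _ := h
      _ ≤ lowC t * (L * ν.real (ballRho x (1 / n))) := by
          gcongr
          exact (lftMeasure_le hν (Or.inl rfl) x _).trans (hdbl x hx _ (by positivity))
      _ = _ := by ring
  · rintro (z | z)
    · exact norm_lft (by norm_num) (hZ z z.2)
    · exact norm_lft (by norm_num) (hZ z z.2)
  · intro F hF
    obtain ⟨P, hP1, hP2⟩ := exists_pEval_eq_add_lft F hF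
    rw [integral_lftMeasure hν, Fintype.sum_sum_type]
    simp only [Sum.elim_inl, Sum.elim_inr]
    have e : ∫ z, (pEval F (lft 1 z) + pEval F (lft (-1) z)) ∂ν = ∫ z, pEval P z ∂ν := by
      refine integral_congr_ae ?_
      filter_upwards [hν] with z hz using (hP2 z hz).symm
    have e2 : ∑ z ∈ Z, pEval P z = ∑ z ∈ Z, (pEval F (lft 1 z) + pEval F (lft (-1) z)) :=
      Finset.sum_congr rfl fun z hz => hP2 z (hZ z hz)
    rw [e, hex P hP1, e2, Finset.sum_add_distrib,
      Finset.sum_coe_sort Z fun z => pEval F (lft 1 z),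
      Finset.sum_coe_sort Z fun z => pEval F (lft (-1) z), one_div, one_div, one_div, mul_inv,
      mul_assoc]

/-- Exact equal weight formulas exist as soon as the weights are small compared to the mass of
balls. -/
lemma exists_exact_nodes (hd : 0 < d) (hν : ∀ᵐ z ∂ν, ‖z‖ ≤ 1) {L : ℝ} (hL : 0 ≤ L) {t : ℕ}
    (ht : 2 * L ^ 2 ≤ 2 ^ t)
    (hdbl : ∀ x : EuclideanSpace ℝ (Fin d), ‖x‖ ≤ 1 → ∀ r : ℝ, 0 < r →
      ν.real (ballRho x (2 * r)) ≤ L * ν.real (ballRho x r))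
    {n N : ℕ} (hN : 0 < N)
    (hmass : ∀ x : EuclideanSpace ℝ (Fin d), ‖x‖ ≤ 1 →
      1 / (N : ℝ) ≤ 1 / 2 * ν.real (ballRho x (meshC (d + 1) (3 * t) / (6 * (n + 1))))) :
    ∃ Z : Finset (EuclideanSpace ℝ (Fin d)), Z.card = N ∧ (∀ z ∈ Z, ‖z‖ ≤ 1) ∧
      ∀ P : MvPolynomial (Fin d) ℝ, P.totalDegree ≤ n →
        ∫ x, pEval P x ∂ν = 1 / (N : ℝ) * ∑ z ∈ Z, pEval P z := by
  classical
  have hM := meshC_pos (d + 1) (3 * t)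
  set r : ℝ := meshC (d + 1) (3 * t) / (3 * (n + 1)) with hr
  have hr0 : 0 < r := by positivity
  have hr2 : r / 2 = meshC (d + 1) (3 * t) / (6 * (n + 1)) := by rw [hr]; field_simp; norm_num
  obtain ⟨x, ψ, p1, p2, p3, p4, p5, p6⟩ := exists_equal_partition (D := d + 1) (by omega)
    (lftMeasure ν) hr0 hN (fun X hX => by
      obtain ⟨σ, hσ, hXσ⟩ := exists_eq_lft hX
      rw [hXσ, hr2]
      exact (hmass _ (norm_proj_le hX)).trans (half_le_lftMeasure hσ _ _))
  have H : IsEqPartition (lftMeasure ν) (3 * r) x ψ := ⟨p1, p2, p3, p4, p5, p6⟩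
  obtain ⟨y₀, hy1, hy2, κ, hκ, hreg⟩ := exists_exact_of_partition (Nat.succ_pos d) H hN
    (ae_lftMeasure hν) (t := t)
    (fun X hX r hr => lftMeasure_doubling hν hL ht hdbl hX hr) (Nat.succ_pos n) (by positivity)
    (by rw [hr]; push_cast; field_simp; exact le_rfl)
    (W := cylPoly d n) (fun p hp => totalDegree_lt_of_mem_cylPoly hp)
  obtain ⟨y, hy, hE, hinj⟩ := exists_exact_injective hd _ hy1 hy2 hκ hreg
  refine ⟨Finset.univ.image fun i => proj (y i), ?_, ?_, fun P hP => ?_⟩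
  · rw [Finset.card_image_of_injective _ hinj, Finset.card_fin]
  · simp only [Finset.mem_image, Finset.mem_univ, true_and]
    rintro z ⟨i, rfl⟩
    exact norm_proj_le (hy i)
  · have h := hE _ (mem_cylPoly.2 ⟨P, hP, rfl⟩)
    have hN0 : (N : ℝ) ≠ 0 := by exact_mod_cast hN.ne'
    rw [defect, sub_eq_zero] at h
    simp only [pEval_rename] at h
    rw [Finset.sum_image fun i _ j _ hij => hinj hij, h]
    change _ = 1 / (N : ℝ) * (N * ∫ z, pEval (MvPolynomial.rename Fin.castSucc P) z ∂lftMeasure ν)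
    rw [integral_lftMeasure_rename hν]
    field_simp

end

section

/-- The measure with density `w` on the ball. -/
def wMeas (w : EuclideanSpace ℝ (Fin d) → ℝ) : Measure (EuclideanSpace ℝ (Fin d)) :=
  (ballVol d).withDensity fun x => ENNReal.ofReal (w x)

section

variable {w : EuclideanSpace ℝ (Fin d) → ℝ}

lemma wMeas_real (hw0 : ∀ x, 0 ≤ w x) (hw : Integrable w (ballVol d))
    {A : Set (EuclideanSpace ℝ (Fin d))} (hA : MeasurableSet A) :
    (wMeas w).real A = wMassB w A := by
  rw [measureReal_def, wMeas, withDensity_apply _ hA,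
    ← ofReal_integral_eq_lintegral_ofReal hw.restrict (ae_of_all _ hw0),
    ENNReal.toReal_ofReal (integral_nonneg hw0), wMassB]

lemma ae_ballVol : ∀ᵐ z ∂ballVol d, ‖z‖ ≤ 1 := by
  filter_upwards [ae_restrict_mem (μ := volume)
    (Metric.isClosed_closedBall (x := (0 : EuclideanSpace ℝ (Fin d))) (ε := 1)).measurableSet]
    with z hz using by simpa using hz

lemma ae_wMeas : ∀ᵐ z ∂wMeas w, ‖z‖ ≤ 1 :=
  (withDensity_absolutelyContinuous _ _).ae_le ae_ballVol

lemma isProbabilityMeasure_wMeas (hw0 : ∀ x, 0 ≤ w x) (hw : Integrable w (ballVol d))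
    (h1 : wMassB w (Metric.closedBall (0 : EuclideanSpace ℝ (Fin d)) 1) = 1) :
    IsProbabilityMeasure (wMeas w) := by
  constructor
  rw [wMassB, ballVol, Measure.restrict_restrict Metric.isClosed_closedBall.measurableSet,
    inter_self, ← ballVol] at h1
  rw [wMeas, withDensity_apply _ .univ, Measure.restrict_univ,
    ← ofReal_integral_eq_lintegral_ofReal hw (ae_of_all _ hw0), h1, ENNReal.ofReal_one]

lemma integral_wMeas (hw0 : ∀ x, 0 ≤ w x) (hw : Integrable w (ballVol d))
    (f : EuclideanSpace ℝ (Fin d) → ℝ) : ∫ x, f x ∂wMeas w = ∫ x, f x * w x ∂ballVol d := by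
  rw [wMeas, integral_withDensity_eq_integral_toReal_smul₀ hw.1.aemeasurable.ennreal_ofReal
    (ae_of_all _ fun x => ENNReal.ofReal_lt_top)]
  refine integral_congr_ae (ae_of_all _ fun x => ?_)
  simp only [ENNReal.toReal_ofReal (hw0 x), smul_eq_mul, mul_comm]

end

variable {ν : Measure (EuclideanSpace ℝ (Fin d))}

lemma real_ballRho_two_pow_mul_le {L : ℝ} (hL : 0 ≤ L)
    (hdbl : ∀ x : EuclideanSpace ℝ (Fin d), ‖x‖ ≤ 1 → ∀ r : ℝ, 0 < r →
      ν.real (ballRho x (2 * r)) ≤ L * ν.real (ballRho x r))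
    {x : EuclideanSpace ℝ (Fin d)} (hx : ‖x‖ ≤ 1) {r : ℝ} (hr : 0 < r) (k : ℕ) :
    ν.real (ballRho x (2 ^ k * r)) ≤ L ^ k * ν.real (ballRho x r) := by
  induction k with
  | zero => simp
  | succ k ih =>
    have := hdbl x hx (2 ^ k * r) (by positivity)
    rw [← mul_assoc, ← pow_succ'] at this
    calc _ ≤ L * (L ^ k * ν.real (ballRho x r)) := this.trans (by gcongr)
      _ = _ := by ring

lemma ballRho_mono (x : EuclideanSpace ℝ (Fin d)) {r s : ℝ} (h : r ≤ s) :
    ballRho x r ⊆ ballRho x s := fun _ hy => ⟨hy.1, hy.2.trans h⟩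

lemma rhoB_le_four {x y : EuclideanSpace ℝ (Fin d)} (hx : ‖x‖ ≤ 1) (hy : ‖y‖ ≤ 1) :
    rhoB x y ≤ 4 := by
  have h1 := norm_sub_le x y
  have h (z : EuclideanSpace ℝ (Fin d)) : √(1 - ‖z‖ ^ 2) ≤ 1 :=
    Real.sqrt_le_one.2 (by nlinarith [sq_nonneg ‖z‖])
  have h2 : |√(1 - ‖x‖ ^ 2) - √(1 - ‖y‖ ^ 2)| ≤ 1 := by
    rw [abs_le]
    constructor <;> linarith [h x, h y, Real.sqrt_nonneg (1 - ‖x‖ ^ 2),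
      Real.sqrt_nonneg (1 - ‖y‖ ^ 2)]
  unfold rhoB
  linarith

variable [IsProbabilityMeasure ν]

lemma inv_pow_le_real_ballRho (hν : ∀ᵐ z ∂ν, ‖z‖ ≤ 1) {L : ℝ} (hL : 0 < L)
    (hdbl : ∀ x : EuclideanSpace ℝ (Fin d), ‖x‖ ≤ 1 → ∀ r : ℝ, 0 < r →
      ν.real (ballRho x (2 * r)) ≤ L * ν.real (ballRho x r))
    {n : ℕ} (hn : 0 < n) {x : EuclideanSpace ℝ (Fin d)} (hx : ‖x‖ ≤ 1) :
    (L ^ (n + 2))⁻¹ ≤ ν.real (ballRho x (1 / n)) := by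
  have hn0 : (0 : ℝ) < n := by exact_mod_cast hn
  have h1 : ν (ballRho x (2 ^ (n + 2) * (1 / n))) = 1 := by
    rw [← mem_ae_iff_prob_eq_one (isClosed_ballRho x _).measurableSet]
    filter_upwards [hν] with y hy
    refine ⟨hy, (rhoB_le_four hx hy).trans ?_⟩
    rw [mul_one_div, le_div_iff₀ hn0]
    have : (n : ℝ) < 2 ^ n := by exact_mod_cast Nat.lt_two_pow_self
    rw [pow_add]
    linarith
  have h2 := real_ballRho_two_pow_mul_le hL.le hdbl hx (r := 1 / n) (by positivity) (n + 2)
  rw [measureReal_def, h1, ENNReal.toReal_one] at h2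
  rwa [inv_le_iff_one_le_mul₀' (by positivity)]

end

end CubBall

open CubBall

/-- Sharp asymptotics of the minimal number of nodes of strict
Chebyshev-type cubature formulas for doubling weights on the unit ball. -/
theorem ball_minCubNodes_asymptotics (d : ℕ) (hd : 1 ≤ d) (L : ℝ) :
    ∃ c C : ℝ, 0 < c ∧ c ≤ C ∧
      ∀ w : EuclideanSpace ℝ (Fin d) → ℝ,
        (∀ x, 0 ≤ w x) →
        Integrable w (ballVol d) →
        wMassB w (Metric.closedBall (0 : EuclideanSpace ℝ (Fin d)) 1) = 1 →
        (∀ x : EuclideanSpace ℝ (Fin d), ‖x‖ ≤ 1 → ∀ r : ℝ, 0 < r →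
          wMassB w (ballRho x (2 * r)) ≤ L * wMassB w (ballRho x r)) →
        ∀ n : ℕ, 0 < n →
          c * sSup ((fun x => 1 / wMassB w (ballRho x (1 / (n : ℝ)))) ''
              Metric.closedBall (0 : EuclideanSpace ℝ (Fin d)) 1)
            ≤ (minCubNodesB d w n : ℝ) ∧
          (minCubNodesB d w n : ℝ)
            ≤ C * sSup ((fun x => 1 / wMassB w (ballRho x (1 / (n : ℝ)))) ''
              Metric.closedBall (0 : EuclideanSpace ℝ (Fin d)) 1) := by
  set L₁ := max L 1
  have hL1 : 1 ≤ L₁ := le_max_right _ _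
  have hL0 : 0 < L₁ := by linarith
  obtain ⟨t, ht⟩ := pow_unbounded_of_one_lt (2 * L₁ ^ 2) (one_lt_two (α := ℝ))
  have hlow := lowC_pos t
  have hmesh := meshC_pos (d + 1) (3 * t)
  obtain ⟨k, hk⟩ := pow_unbounded_of_one_lt (12 / meshC (d + 1) (3 * t)) (one_lt_two (α := ℝ))
  set c := 1 / (2 * lowC t * L₁) with hc
  refine ⟨c, max c (3 * L₁ ^ k), by positivity, le_max_left _ _, ?_⟩
  intro w hw0 hw hw1 hdbl n hn
  have hn0 : (0 : ℝ) < n := by exact_mod_cast hn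
  have hn1 : (1 : ℝ) ≤ n := by exact_mod_cast hn
  have := isProbabilityMeasure_wMeas hw0 hw hw1
  have hν := ae_wMeas (w := w)
  have hmass : ∀ x r, wMassB w (ballRho x r) = (wMeas w).real (ballRho x r) := fun x r =>
    (wMeas_real hw0 hw (isClosed_ballRho x r).measurableSet).symm
  simp only [hmass] at hdbl ⊢
  replace hdbl : ∀ x : EuclideanSpace ℝ (Fin d), ‖x‖ ≤ 1 → ∀ r : ℝ, 0 < r →
      (wMeas w).real (ballRho x (2 * r)) ≤ L₁ * (wMeas w).real (ballRho x r) :=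
    fun x hx r hr => (hdbl x hx r hr).trans
      (mul_le_mul_of_nonneg_right (le_max_left _ _) measureReal_nonneg)
  have hW : ∀ x : EuclideanSpace ℝ (Fin d), ‖x‖ ≤ 1 →
      (L₁ ^ (n + 2))⁻¹ ≤ (wMeas w).real (ballRho x (1 / n)) := fun x hx =>
    inv_pow_le_real_ballRho hν hL0 hdbl hn hx
  have hWpos : ∀ x : EuclideanSpace ℝ (Fin d), ‖x‖ ≤ 1 →
      0 < (wMeas w).real (ballRho x (1 / n)) := fun x hx =>
    lt_of_lt_of_le (by positivity) (hW x hx)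
  set S := (fun x => 1 / (wMeas w).real (ballRho x (1 / (n : ℝ)))) ''
    Metric.closedBall (0 : EuclideanSpace ℝ (Fin d)) 1 with hS
  have hbdd : BddAbove S := by
    refine ⟨L₁ ^ (n + 2), ?_⟩
    rintro _ ⟨x, hx, rfl⟩
    simp only
    rw [one_div, inv_le_comm₀ (hWpos x (by simpa using hx)) (by positivity)]
    exact hW x (by simpa using hx)
  have hle : ∀ x : EuclideanSpace ℝ (Fin d), ‖x‖ ≤ 1 →
      1 / (wMeas w).real (ballRho x (1 / n)) ≤ sSup S := fun x hx =>
    le_csSup hbdd ⟨x, by simpa using hx, rfl⟩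
  have hne : S.Nonempty := ⟨_, 0, by simp, rfl⟩
  set M := sSup S
  have hM1 : 1 ≤ M := by
    refine le_trans ?_ (hle 0 (by simp))
    rw [le_div_iff₀ (hWpos 0 (by simp)), one_mul]
    exact measureReal_le_one
  have hM0 : 0 < M := by linarith
  obtain ⟨N, hN, hNle, Z, hZ⟩ : ∃ N : ℕ, 0 < N ∧ (N : ℝ) ≤ 3 * L₁ ^ k * M ∧
      ∃ Z : Finset (EuclideanSpace ℝ (Fin d)), Z.card = N ∧ (∀ z ∈ Z, ‖z‖ ≤ 1) ∧
        ∀ P : MvPolynomial (Fin d) ℝ, P.totalDegree ≤ n →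
          ∫ x, pEval P x ∂wMeas w = 1 / (N : ℝ) * ∑ z ∈ Z, pEval P z := by
    have hB : 0 < 2 * L₁ ^ k * M := by positivity
    have hN : 0 < ⌈2 * L₁ ^ k * M⌉₊ := Nat.ceil_pos.2 hB
    refine ⟨⌈2 * L₁ ^ k * M⌉₊, hN, ?_, exists_exact_nodes hd hν hL0.le ht.le hdbl hN ?_⟩
    · have h1 := Nat.ceil_lt_add_one hB.le
      have h2 : 1 * 1 ≤ L₁ ^ k * M :=
        mul_le_mul (one_le_pow₀ hL1) hM1 zero_le_one (by positivity)
      linarith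
    · intro x hx
      set ρ := meshC (d + 1) (3 * t) / (6 * (n + 1)) with hρ
      have hρ0 : 0 < ρ := by positivity
      have h1 : 1 / (n : ℝ) ≤ 2 ^ k * ρ := by
        rw [div_lt_iff₀ hmesh] at hk
        rw [hρ, ← mul_div_assoc, div_le_div_iff₀ hn0 (by positivity)]
        nlinarith
      have h2 : (wMeas w).real (ballRho x (1 / n)) ≤ L₁ ^ k * (wMeas w).real (ballRho x ρ) :=
        (measureReal_mono (ballRho_mono x h1)).trans
          (real_ballRho_two_pow_mul_le hL0.le hdbl hx hρ0 k)
      have h3 := hle x hx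
      rw [div_le_iff₀ (hWpos x hx)] at h3
      calc 1 / ((⌈2 * L₁ ^ k * M⌉₊ : ℕ) : ℝ) ≤ 1 / (2 * L₁ ^ k * M) :=
            one_div_le_one_div_of_le hB (Nat.le_ceil _)
        _ ≤ _ := by
            rw [div_le_iff₀ hB]
            calc 1 ≤ M * (L₁ ^ k * (wMeas w).real (ballRho x ρ)) := h3.trans (by gcongr)
              _ = _ := by ring
  simp only [integral_wMeas hw0 hw] at hZ
  constructor
  · obtain ⟨hpos, Z', hcard, hball, hex⟩ := Nat.sInf_mem (s := {N : ℕ | 0 < N ∧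
      ∃ Z : Finset (EuclideanSpace ℝ (Fin d)), Z.card = N ∧ (∀ z ∈ Z, ‖z‖ ≤ 1) ∧
      ∀ P : MvPolynomial (Fin d) ℝ, P.totalDegree ≤ n →
      (∫ x, pEval P x * w x ∂(ballVol d)) = (1 / (N : ℝ)) * ∑ z ∈ Z, pEval P z}) ⟨N, hN, Z, hZ⟩
    rw [← minCubNodesB] at hpos hcard hex
    rw [← hcard] at hex hpos ⊢
    have hpos' : (0 : ℝ) < Z'.card := by exact_mod_cast hpos
    simp only [← integral_wMeas hw0 hw] at hex
    rw [hc, div_mul_eq_mul_div, one_mul, div_le_iff₀ (by positivity)]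
    refine csSup_le hne ?_
    rintro _ ⟨x, hx, rfl⟩
    have hx' : ‖x‖ ≤ 1 := by simpa using hx
    have h := inv_card_le hν hL0.le ht.le hdbl hn hball hex hx'
    simp only
    rw [div_le_iff₀ (hWpos x hx')]
    rw [div_le_iff₀ (by positivity)] at h
    linarith
  · calc (minCubNodesB d w n : ℝ) ≤ N := by
          have h : minCubNodesB d w n ≤ N := Nat.sInf_le ⟨hN, Z, hZ⟩
          exact_mod_cast h
      _ ≤ 3 * L₁ ^ k * M := hNle
      _ ≤ _ := by gcongr; exact le_max_right _ _
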